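/- (Energy conservation.) Let (ψ, Φ, q) be a classical solution of the Schrödinger–Poisson–Newton system on ℝ satisfying the normalization ∫_{T_N} |ψ(x,0)|² dx = Z·N³. Then the energy E(t) := ½∫_{T_N} |∇ψ(x,t)|² dx + ½∫_{T_N} Φ(x,t)·ρ(x,t) dx + (M/2)·∑_{n∈Γ_N} |q̇(n,t)|² is independent of t ∈ ℝ. -/

import Mathlib

noncomputable section

namespace SPN

open MeasureTheory Finset
open scoped Real

/-- Points of `ℝ³`. -/
abbrev V3 : Type := Fin 3 → ℝ

/-- Euclidean dot product on `ℝ³`. -/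
def dotP (v w : V3) : ℝ := ∑ i, v i * w i

/-- Squared Euclidean norm on `ℝ³`. -/
def nsqV (v : V3) : ℝ := ∑ i, v i ^ 2

/-- The fundamental cube `[0,N)³` of the torus `T_N = ℝ³/(N·ℤ³)`. -/
def cubeN (N : ℕ) : Set V3 := {x | ∀ i, x i ∈ Set.Ico (0 : ℝ) (N : ℝ)}

/-- `N·ℤ³`-periodicity of a function on `ℝ³`. -/
def IsPerN {α : Type*} (N : ℕ) (f : V3 → α) : Prop :=
  ∀ (x : V3) (k : Fin 3 → ℤ), f (x + fun i => (N : ℝ) * (k i : ℝ)) = f x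

/-- Index set for `Γ_N = {0,…,N−1}³`. -/
abbrev GammaIdx (N : ℕ) : Type := Fin 3 → Fin N

/-- The lattice point of `Γ_N` associated to an index. -/
def embG {N : ℕ} (n : GammaIdx N) : V3 := fun i => ((n i : ℕ) : ℝ)

/-- Fourier coefficient `f̂(ξ) = ∫_{T_N} e^{iξ·x} f(x) dx`. -/
def fCoeff (N : ℕ) (f : V3 → ℂ) (ξ : V3) : ℂ :=
  ∫ x in cubeN N, Complex.exp (Complex.I * ((dotP ξ x : ℝ) : ℂ)) * f x

/-- Fourier coefficient of a real-valued function. -/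
def fCoeffR (N : ℕ) (f : V3 → ℝ) (ξ : V3) : ℂ :=
  fCoeff N (fun x => ((f x : ℝ) : ℂ)) ξ

/-- The point `(2π/N)·k` of the dual lattice `Γ*_N`. -/
def xiN (N : ℕ) (k : Fin 3 → ℤ) : V3 := fun i => (2 * π / (N : ℝ)) * (k i : ℝ)

/-- The Jellium condition: `σ̂(ξ) = 0` for all `ξ ∈ Γ*_1 \ {0}`. -/
def JelliumCond (N : ℕ) (σ : V3 → ℝ) : Prop :=
  ∀ k : Fin 3 → ℤ, k ≠ 0 → fCoeffR N σ (fun i => 2 * π * (k i : ℝ)) = 0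

/-- `(2π/N)·k ∈ Γ*_1`, i.e. every coordinate of `k` is divisible by `N`. -/
def inGamma1 (N : ℕ) (k : Fin 3 → ℤ) : Prop := ∀ i, (N : ℤ) ∣ k i

/-- `|∇φ(x)|²` for a complex-valued function. -/
def gradSq (φ : V3 → ℂ) (x : V3) : ℝ :=
  ∑ i, Complex.normSq (fderiv ℝ φ x (Pi.single i 1))

/-- Gradient of a real-valued function on `ℝ³`. -/
def gradV (f : V3 → ℝ) (x : V3) : V3 := fun i => fderiv ℝ f x (Pi.single i 1)

/-- Total charge density `ρ(x) = ∑_n σ(x−n−q(n)) − e|ψ(x)|²`. -/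
def rhoT (N : ℕ) (σ : V3 → ℝ) (e : ℝ) (ψ : V3 → ℂ) (q : GammaIdx N → V3) (x : V3) : ℝ :=
  (∑ n : GammaIdx N, σ (x - embG n - q n)) - e * Complex.normSq (ψ x)

/-- `∑_{ξ∈Γ*_N\{0}} |f̂(ξ)|²/|ξ|²`. -/
def dualSum (N : ℕ) (f : V3 → ℝ) : ℝ :=
  ∑' k : Fin 3 → ℤ, if k = 0 then 0 else
    Complex.normSq (fCoeffR N f (xiN N k)) / nsqV (xiN N k)

/-- The energy functional `E(ψ,q,p)`. -/
def energyE (N : ℕ) (σ : V3 → ℝ) (e M : ℝ) (ψ : V3 → ℂ) (q p : GammaIdx N → V3) : ℝ :=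
  (1 / 2) * (∫ x in cubeN N, gradSq ψ x)
    + (2 * (N : ℝ) ^ 3)⁻¹ * dualSum N (rhoT N σ e ψ q)
    + (2 * M)⁻¹ * ∑ n : GammaIdx N, nsqV (p n)

/-- The matrix `Σ(θ) = ∑_{m∈ℤ³} (ξξᵀ/|ξ|²)|σ̂(ξ)|²`, `ξ = θ + 2πm`. -/
def SigMat (N : ℕ) (σ : V3 → ℝ) (θ : V3) : Matrix (Fin 3) (Fin 3) ℝ :=
  Matrix.of fun a b => ∑' m : Fin 3 → ℤ,
    ((θ a + 2 * π * (m a : ℝ)) * (θ b + 2 * π * (m b : ℝ))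
        / nsqV (fun i => θ i + 2 * π * (m i : ℝ)))
      * Complex.normSq (fCoeffR N σ (fun i => θ i + 2 * π * (m i : ℝ)))

/-- The Wiener condition: `Σ(θ)` is positive definite for all `θ ∈ Γ*_N \ Γ*_1`. -/
def WienerCond (N : ℕ) (σ : V3 → ℝ) : Prop :=
  ∀ k : Fin 3 → ℤ, ¬ inGamma1 N k → (SigMat N σ (xiN N k)).PosDef

/-- First-order ionic density `σ⁽¹⁾(x) = −∑_n κ(n)·∇σ(x−n−r)`. -/
def sigma1F (N : ℕ) (σ : V3 → ℝ) (r : V3) (κ : GammaIdx N → V3) (x : V3) : ℝ :=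
  - ∑ n : GammaIdx N, dotP (κ n) (gradV σ (x - embG n - r))

/-- First-order charge density `ρ⁽¹⁾(x) = σ⁽¹⁾(x) − 2e√Z·Re(e^{−iα}φ(x))`. -/
def rho1F (N : ℕ) (σ : V3 → ℝ) (e Z α : ℝ) (r : V3) (κ : GammaIdx N → V3)
    (φ : V3 → ℂ) (x : V3) : ℝ :=
  sigma1F N σ r κ x - 2 * e * Real.sqrt Z * (Complex.exp (-Complex.I * (α : ℂ)) * φ x).re

/-- The quadratic form `B(φ,κ,p)` (half of the energy Hessian). -/
def BformQ (N : ℕ) (σ : V3 → ℝ) (e Z M α : ℝ) (r : V3)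
    (φ : V3 → ℂ) (κ p : GammaIdx N → V3) : ℝ :=
  (1 / 2) * (∫ x in cubeN N, gradSq φ x)
    + (2 * (N : ℝ) ^ 3)⁻¹ * dualSum N (rho1F N σ e Z α r κ φ)
    + (2 * M)⁻¹ * ∑ n : GammaIdx N, nsqV (p n)

/-- Second-order charge density `ρ⁽²⁾`. -/
def rho2F (N : ℕ) (σ : V3 → ℝ) (e : ℝ) (r : V3) (κ : GammaIdx N → V3)
    (φ : V3 → ℂ) (x : V3) : ℝ :=
  (∑ n : GammaIdx N,
      (σ (x - embG n - r - κ n) - σ (x - embG n - r)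
        + dotP (κ n) (gradV σ (x - embG n - r))))
    - e * Complex.normSq (φ x)

/-- The pairing `(f, Gg) = N⁻³ ∑_{ξ∈Γ*_N\{0}} Re(f̂(ξ)·conj(ĝ(ξ)))/|ξ|²`. -/
def GPair (N : ℕ) (f g : V3 → ℝ) : ℝ :=
  ((N : ℝ) ^ 3)⁻¹ * ∑' k : Fin 3 → ℤ, if k = 0 then 0 else
    (fCoeffR N f (xiN N k) * (starRingEnd ℂ) (fCoeffR N g (xiN N k))).re / nsqV (xiN N k)

/-- The distance to the solitary manifold of ground states. -/
def distS (N : ℕ) (Z : ℝ) (ψ : V3 → ℂ) (q p : GammaIdx N → V3) : ℝ :=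
  ⨅ (α : ℝ) (r : V3),
    (Real.sqrt (∫ x in cubeN N,
        (Complex.normSq (ψ x - Complex.exp (Complex.I * (α : ℂ)) * ((Real.sqrt Z : ℝ) : ℂ))
          + gradSq ψ x))
      + Real.sqrt (∑ n : GammaIdx N, ⨅ k : Fin 3 → ℤ,
          nsqV (fun i => q n i - r i - (N : ℝ) * (k i : ℝ)))
      + Real.sqrt (∑ n : GammaIdx N, nsqV (p n)))

/-- The discrete Fourier transform `κ̂(θ) ∈ ℂ³` of `κ : Γ_N → ℝ³`. -/
def hatK (N : ℕ) (κ : GammaIdx N → V3) (θ : V3) (a : Fin 3) : ℂ :=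
  ∑ n : GammaIdx N, Complex.exp (Complex.I * ((dotP θ (embG n) : ℝ) : ℂ)) * ((κ n a : ℝ) : ℂ)

/-- Laplacian of a complex-valued function on `ℝ³`. -/
def lapC (f : V3 → ℂ) (x : V3) : ℂ :=
  ∑ i, fderiv ℝ (fun y => fderiv ℝ f y (Pi.single i 1)) x (Pi.single i 1)

/-- Laplacian of a real-valued function on `ℝ³`. -/
def lapR (f : V3 → ℝ) (x : V3) : ℝ :=
  ∑ i, fderiv ℝ (fun y => fderiv ℝ f y (Pi.single i 1)) x (Pi.single i 1)

/-- A classical solution of the Schrödinger–Poisson–Newton system on `ℝ`. -/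
structure IsSPN (N : ℕ) (σ : V3 → ℝ) (e M : ℝ)
    (ψ : V3 → ℝ → ℂ) (Φ : V3 → ℝ → ℝ) (q : ℝ → GammaIdx N → V3) : Prop where
  per_psi : ∀ t : ℝ, IsPerN N (fun x => ψ x t)
  per_Phi : ∀ t : ℝ, IsPerN N (fun x => Φ x t)
  regx_psi : ∀ t : ℝ, ContDiff ℝ 2 (fun x => ψ x t)
  regt_psi : ∀ x : V3, ContDiff ℝ 1 (fun t => ψ x t)
  regx_Phi : ∀ t : ℝ, ContDiff ℝ 2 (fun x => Φ x t)
  regt_Phi : ∀ x : V3, ContDiff ℝ 1 (fun t => Φ x t)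
  reg_q : ContDiff ℝ 2 q
  schrodinger : ∀ (x : V3) (t : ℝ),
    Complex.I * deriv (fun s => ψ x s) t =
      -(1 / 2 : ℂ) * lapC (fun y => ψ y t) x - ((e : ℝ) : ℂ) * ((Φ x t : ℝ) : ℂ) * ψ x t
  poisson : ∀ (x : V3) (t : ℝ),
    - lapR (fun y => Φ y t) x =
      (∑ n : GammaIdx N, σ (x - embG n - q t n)) - e * Complex.normSq (ψ x t)
  newton : ∀ (n : GammaIdx N) (t : ℝ) (i : Fin 3),
    M * deriv (fun s => deriv (fun u => q u n i) s) t =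
      - ∫ x in cubeN N, fderiv ℝ (fun y => Φ y t) x (Pi.single i 1) * σ (x - embG n - q t n)


/-! ### Part 0: calculus on the cube -/

lemma cubeN_eq_pi (N : ℕ) : cubeN N = Set.pi Set.univ (fun _ : Fin 3 => Set.Ico (0:ℝ) (N:ℝ)) := by
  ext x; simp [cubeN]

lemma measSet_cube (N : ℕ) : MeasurableSet (cubeN N) := by
  rw [cubeN_eq_pi]
  exact MeasurableSet.univ_pi (fun _ => measurableSet_Ico)

lemma cube_ae (N : ℕ) : cubeN N =ᵐ[volume] Set.Icc (fun _ : Fin 3 => (0:ℝ)) (fun _ => (N:ℝ)) := by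
  rw [cubeN_eq_pi]
  exact Measure.univ_pi_Ico_ae_eq_Icc

lemma cube_sub (N : ℕ) : cubeN N ⊆ Set.Icc (fun _ : Fin 3 => (0:ℝ)) (fun _ => (N:ℝ)) := by
  intro x hx
  exact ⟨fun i => (hx i).1, fun i => (hx i).2.le⟩

lemma vol_cube (N : ℕ) : volume (cubeN N) = (N:ENNReal) ^ 3 := by
  rw [cubeN_eq_pi, Real.volume_pi_Ico]
  simp

instance finMeas_cube (N : ℕ) : IsFiniteMeasure (volume.restrict (cubeN N)) := by
  constructor
  rw [Measure.restrict_apply_univ, vol_cube]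
  exact ENNReal.pow_lt_top (ENNReal.natCast_lt_top N)

lemma integ {E : Type*} [NormedAddCommGroup E] {N : ℕ} {f : V3 → E} (hf : Continuous f) :
    Integrable f (volume.restrict (cubeN N)) :=
  (hf.continuousOn.integrableOn_compact isCompact_Icc).mono_set (cube_sub N)

/-- every point is congruent to a point of the cube -/
lemma exists_cube {N : ℕ} (hN : 0 < N) (x : V3) :
    ∃ k : Fin 3 → ℤ, (x + fun i => (N:ℝ) * (k i : ℝ)) ∈ cubeN N := by
  have hN' : (0:ℝ) < N := by exact_mod_cast hN
  refine ⟨fun i => -⌊x i / N⌋, fun i => ?_⟩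
  have h1 := Int.floor_le (x i / N)
  have h2 := Int.lt_floor_add_one (x i / N)
  rw [le_div_iff₀ hN'] at h1
  rw [div_lt_iff₀ hN'] at h2
  simp only [Pi.add_apply, Int.cast_neg, Set.mem_Ico]
  constructor <;> nlinarith

lemma per_bdd {E : Type*} [NormedAddCommGroup E] {N : ℕ} (hN : 0 < N) {f : V3 → E}
    (hf : Continuous f) (hp : IsPerN N f) : ∃ C : ℝ, 0 ≤ C ∧ ∀ x, ‖f x‖ ≤ C := by
  obtain ⟨C, hC⟩ := (isCompact_Icc (a := (fun _ : Fin 3 => (0:ℝ)))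
    (b := (fun _ : Fin 3 => (N:ℝ)))).exists_bound_of_continuousOn hf.continuousOn
  have h : ∀ x, ‖f x‖ ≤ C := by
    intro x
    obtain ⟨k, hk⟩ := exists_cube hN x
    rw [← hp x k]
    exact hC _ (cube_sub N hk)
  exact ⟨C, (norm_nonneg _).trans (h 0), h⟩

lemma per_fderiv {E : Type*} [NormedAddCommGroup E] [NormedSpace ℝ E] {N : ℕ} {f : V3 → E}
    (hp : IsPerN N f) (v : V3) : IsPerN N (fun x => fderiv ℝ f x v) := by
  intro x k
  have : (fun y => f (y + fun i => (N:ℝ) * (k i : ℝ))) = f := funext fun y => hp y k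
  have h2 := fderiv_comp_add_right (𝕜 := ℝ) (f := f) (x := x) (fun i => (N:ℝ) * (k i : ℝ))
  rw [this] at h2
  simp only [h2]

lemma cont_fderiv {E : Type*} [NormedAddCommGroup E] [NormedSpace ℝ E] {f : V3 → E}
    (hf : ContDiff ℝ 1 f) (v : V3) : Continuous (fun x => fderiv ℝ f x v) :=
  (hf.continuous_fderiv (by norm_num)).clm_apply continuous_const

lemma c1_fderiv {E : Type*} [NormedAddCommGroup E] [NormedSpace ℝ E] {f : V3 → E}
    (hf : ContDiff ℝ 2 f) (v : V3) : ContDiff ℝ 1 (fun x => fderiv ℝ f x v) :=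
  (hf.fderiv_right (m := 1) (by norm_num)).clm_apply contDiff_const

/-- the integral of a partial derivative of a periodic function vanishes -/
lemma int_fderiv_zero {E : Type*} [NormedAddCommGroup E] [NormedSpace ℝ E] {N : ℕ}
    {f : V3 → E} (hf : ContDiff ℝ 1 f) (hp : IsPerN N f) (i : Fin 3) :
    ∫ x in cubeN N, fderiv ℝ f x (Pi.single i 1) = 0 := by
  by_cases hE : CompleteSpace E
  swap
  · rw [integral]; simp [hE]
  have hN0 : (0:ℝ) ≤ N := Nat.cast_nonneg N
  rw [setIntegral_congr_set (cube_ae N)]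
  have key := integral_divergence_of_hasFDerivAt_off_countable'
    (fun _ : Fin 3 => (0:ℝ)) (fun _ => (N:ℝ)) (fun _ => hN0)
    (fun j x => if j = i then f x else 0)
    (fun j x => if j = i then fderiv ℝ f x else 0) ∅ Set.countable_empty
    (by
      intro j
      by_cases h : j = i
      · simp only [h, if_true]; exact hf.continuous.continuousOn
      · simp only [h, if_false]; exact continuousOn_const)
    (by
      intro x _ j
      by_cases h : j = i
      · simp only [h, if_true]
        exact (hf.differentiable (by norm_num) x).hasFDerivAt
      · simp only [h, if_false]; exact hasFDerivAt_const _ _)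
    (by
      have : (fun x => ∑ j, (if j = i then fderiv ℝ f x else 0) (Pi.single j 1))
          = fun x => fderiv ℝ f x (Pi.single i 1) := by
        funext x
        rw [Finset.sum_eq_single i] <;> simp +contextual
      rw [this]
      exact (cont_fderiv hf _).continuousOn.integrableOn_compact isCompact_Icc)
  have e1 : ∀ x : V3, ∑ j, (if j = i then fderiv ℝ f x else 0) (Pi.single j 1)
      = fderiv ℝ f x (Pi.single i 1) := by
    intro x
    rw [Finset.sum_eq_single i] <;> simp +contextual
  simp only [e1] at key
  rw [key]
  refine Finset.sum_eq_zero fun j _ => ?_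
  by_cases h : j = i
  · subst h
    simp only [if_true]
    rw [sub_eq_zero]
    refine integral_congr_ae (Filter.Eventually.of_forall fun y => ?_)
    have := hp (j.insertNth (0:ℝ) y) (Pi.single j 1)
    simp only
    rw [← this]
    congr 1
    ext l
    refine Fin.succAboveCases j ?_ (fun m => ?_) l
    · simp
    · simp [Fin.succAbove_ne]
  · simp [h]

/-- Cauchy–Schwarz for nonneg quantities -/
lemma cs_sq {N : ℕ} {f g : V3 → ℝ} (hf : Continuous f) (hg : Continuous g) :
    (∫ x in cubeN N, f x * g x) ^ 2 ≤ (∫ x in cubeN N, f x ^ 2) * ∫ x in cubeN N, g x ^ 2 := by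
  set A := ∫ x in cubeN N, f x ^ 2
  set B := ∫ x in cubeN N, f x * g x
  set C := ∫ x in cubeN N, g x ^ 2
  have key : ∀ t : ℝ, 0 ≤ A * (t * t) + (2 * B) * t + C := by
    intro t
    have h : ∫ x in cubeN N, (t * f x + g x) ^ 2 = A * (t * t) + (2 * B) * t + C := by
      have : ∀ x, (t * f x + g x) ^ 2 = (t * t) * f x ^ 2 + (2 * t) * (f x * g x) + g x ^ 2 := by
        intro x; ring
      simp_rw [this]
      rw [integral_add, integral_add, integral_const_mul, integral_const_mul]
      · ring
      all_goals exact integ (by fun_prop)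
    rw [← h]
    exact integral_nonneg fun x => sq_nonneg _
  have := discrim_le_zero key
  rw [discrim] at this
  nlinarith

lemma cs_le {N : ℕ} {f g : V3 → ℝ} (hf : Continuous f) (hg : Continuous g) :
    |∫ x in cubeN N, f x * g x| ≤
      √(∫ x in cubeN N, f x ^ 2) * √(∫ x in cubeN N, g x ^ 2) := by
  rw [← Real.sqrt_mul (integral_nonneg fun x => sq_nonneg _)]
  exact Real.abs_le_sqrt (cs_sq hf hg)

lemma cs_norm {N : ℕ} {f g : V3 → ℂ} (hf : Continuous f) (hg : Continuous g) :
    ‖∫ x in cubeN N, f x * g x‖ ≤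
      √(∫ x in cubeN N, ‖f x‖ ^ 2) * √(∫ x in cubeN N, ‖g x‖ ^ 2) := by
  refine (norm_integral_le_integral_norm _).trans ?_
  simp only [norm_mul]
  exact (le_abs_self _).trans (cs_le hf.norm hg.norm)

/-- integration by parts -/
lemma ibp {𝕜 : Type*} [NontriviallyNormedField 𝕜] [NormedAlgebra ℝ 𝕜] {N : ℕ}
    {f g : V3 → 𝕜} (hf : ContDiff ℝ 1 f) (hg : ContDiff ℝ 1 g)
    (hfp : IsPerN N f) (hgp : IsPerN N g) (i : Fin 3) :
    ∫ x in cubeN N, f x * fderiv ℝ g x (Pi.single i 1)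
      = - ∫ x in cubeN N, fderiv ℝ f x (Pi.single i 1) * g x := by
  have h := int_fderiv_zero (hf.mul hg) (fun x k => by simp only [hfp x k, hgp x k]) i (N := N)
  have e : ∀ x, fderiv ℝ (fun y => f y * g y) x (Pi.single i 1) =
      f x * fderiv ℝ g x (Pi.single i 1) + fderiv ℝ f x (Pi.single i 1) * g x := by
    intro x
    rw [fderiv_fun_mul (hf.differentiable (by norm_num) x) (hg.differentiable (by norm_num) x)]
    simp [mul_comm]
  simp only [e] at h
  rw [integral_add] at h
  · exact eq_neg_of_add_eq_zero_left h
  · exact integ (hf.continuous.mul (cont_fderiv hg _))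
  · exact integ ((cont_fderiv hf _).mul hg.continuous)

/-! ### Part 1: Fourier series on the torus -/

/-- the exponential `e^{-i ξ·x}` -/
def ekc (N : ℕ) (k : Fin 3 → ℤ) (x : V3) : ℂ :=
  Complex.exp (-Complex.I * ((dotP (xiN N k) x : ℝ) : ℂ))

/-- Fourier coefficient (not normalized) -/
def fc (N : ℕ) (f : V3 → ℂ) (k : Fin 3 → ℤ) : ℂ := ∫ x in cubeN N, ekc N k x * f x

lemma ekc_norm (N : ℕ) (k : Fin 3 → ℤ) (x : V3) : ‖ekc N k x‖ = 1 := by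
  rw [ekc, neg_mul, mul_comm, ← neg_mul, ← Complex.ofReal_neg]
  exact Complex.norm_exp_ofReal_mul_I _

lemma dotP_contDiff (v : V3) : ContDiff ℝ 2 (fun x => dotP v x) := by
  unfold dotP; fun_prop

lemma ekc_contDiff (N : ℕ) (k : Fin 3 → ℤ) : ContDiff ℝ 2 (ekc N k) := by
  unfold ekc
  have h : ContDiff ℝ 2 (fun x => ((dotP (xiN N k) x : ℝ) : ℂ)) :=
    Complex.ofRealCLM.contDiff.comp (dotP_contDiff _)
  exact (contDiff_const.mul h).cexp

lemma ekc_per {N : ℕ} (hN : 0 < N) (k : Fin 3 → ℤ) : IsPerN N (ekc N k) := by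
  intro x m
  have hN' : (N:ℝ) ≠ 0 := by positivity
  have h : dotP (xiN N k) (x + fun i => (N:ℝ) * (m i : ℝ)) =
      dotP (xiN N k) x + ((∑ i, k i * m i : ℤ) : ℝ) * (2 * π) := by
    simp only [dotP, xiN, Pi.add_apply, mul_add, Finset.sum_add_distrib]
    push_cast
    rw [Finset.sum_mul]
    congr 1
    refine Finset.sum_congr rfl fun i _ => ?_
    field_simp
  rw [ekc, ekc, h]
  rw [Complex.exp_eq_exp_iff_exists_int]
  refine ⟨-(∑ i, k i * m i), ?_⟩
  push_cast
  ring

lemma ekc_fderiv (N : ℕ) (k : Fin 3 → ℤ) (x : V3) (i : Fin 3) :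
    fderiv ℝ (ekc N k) x (Pi.single i 1) = -Complex.I * (xiN N k i : ℝ) * ekc N k x := by
  have h0 : HasFDerivAt (fun x => dotP (xiN N k) x)
      (∑ j, (xiN N k j) • (ContinuousLinearMap.proj j : V3 →L[ℝ] ℝ)) x := by
    unfold dotP
    have : ∀ j ∈ (Finset.univ : Finset (Fin 3)), HasFDerivAt (fun x : V3 => xiN N k j * x j)
      ((xiN N k j) • (ContinuousLinearMap.proj j : V3 →L[ℝ] ℝ)) x := by
      intro j _
      exact (ContinuousLinearMap.proj (R := ℝ) j : V3 →L[ℝ] ℝ).hasFDerivAt.const_mul _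
    exact HasFDerivAt.fun_sum this
  have h1 := (Complex.ofRealCLM.hasFDerivAt.comp x h0)
  have h2 := (h1.const_mul (-Complex.I)).cexp
  have h3 : HasFDerivAt (ekc N k) _ x := h2
  rw [h3.fderiv]
  simp [ekc, Pi.single_apply]
  ring

/-- the projection to the torus -/
def prT (x : V3) : UnitAddTorus (Fin 3) := fun i => (x i : UnitAddCircle)

lemma prT_quot : IsOpenQuotientMap prT := by
  exact IsOpenQuotientMap.piMap (f := fun _ : Fin 3 => (QuotientAddGroup.mk : ℝ → UnitAddCircle))
    (fun _ => QuotientAddGroup.isOpenQuotientMap_mk)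

lemma exists_torus {N : ℕ} (hN : 0 < N) {f : V3 → ℂ} (hf : Continuous f) (hp : IsPerN N f) :
    ∃ F : C(UnitAddTorus (Fin 3), ℂ), ∀ x : V3, F (prT x) = f ((N:ℝ) • x) := by
  let g : C(V3, ℂ) := ⟨fun x => f ((N:ℝ) • x), by fun_prop⟩
  have hg : Function.FactorsThrough g prT := by
    intro x y hxy
    have : ∀ i, ∃ m : ℤ, x i = y i + m := by
      intro i
      have h := congrFun hxy i
      simp only [prT] at h
      rw [eq_comm, QuotientAddGroup.eq, AddSubgroup.mem_zmultiples_iff] at h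
      obtain ⟨m, hm⟩ := h
      refine ⟨m, ?_⟩
      simp at hm
      linarith
    choose m hm using this
    have hx : (N:ℝ) • x = (N:ℝ) • y + fun i => (N:ℝ) * (m i : ℝ) := by
      ext i
      simp [hm i]; ring
    change f _ = f _
    rw [hx, hp]
  have hG : ∀ x, g (Function.surjInv prT_quot.surjective (prT x)) = g x := fun x =>
    hg (Function.surjInv_eq prT_quot.surjective (prT x))
  have hc : Continuous (fun y => g (Function.surjInv prT_quot.surjective y)) := by
    rw [prT_quot.isQuotientMap.continuous_iff]
    have : ((fun y => g (Function.surjInv prT_quot.surjective y)) ∘ prT) = g := funext hG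
    rw [this]
    exact g.continuous
  exact ⟨⟨_, hc⟩, hG⟩

open scoped Pointwise in
lemma torus_int {E : Type*} [NormedAddCommGroup E] [NormedSpace ℝ E] {N : ℕ} (hN : 0 < N)
    (G : UnitAddTorus (Fin 3) → E) (g : V3 → E) (hG : ∀ x, G (prT x) = g ((N:ℝ) • x)) :
    (∫ y, G y ∂(Measure.pi fun _ => (AddCircle.haarAddCircle : Measure UnitAddCircle)))
      = ((N:ℝ)^3)⁻¹ • ∫ x in cubeN N, g x := by
  have hN' : (0:ℝ) < N := by exact_mod_cast hN
  have h1 := UnitAddTorus.integral_preimage G (fun _ => 0)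
  refine h1.trans ?_
  have h2 : {x : Fin 3 → ℝ | ∀ i, x i ∈ Set.Ioc (0:ℝ) (0+1)} =ᵐ[volume] cubeN 1 := by
    have a : {x : Fin 3 → ℝ | ∀ i, x i ∈ Set.Ioc (0:ℝ) (0+1)} =
      Set.pi Set.univ (fun _ : Fin 3 => Set.Ioc (0:ℝ) 1) := by ext x; simp
    rw [a, cubeN_eq_pi]
    have b1 := Measure.univ_pi_Ioc_ae_eq_Icc (μ := fun _ : Fin 3 => (volume : Measure ℝ))
      (f := fun _ => 0) (g := fun _ => 1)
    have b2 := Measure.univ_pi_Ico_ae_eq_Icc (μ := fun _ : Fin 3 => (volume : Measure ℝ))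
      (f := fun _ => 0) (g := fun _ => 1)
    have := b1.trans b2.symm
    simp only [Nat.cast_one]
    exact this
  rw [setIntegral_congr_set h2]
  have h3 : ∀ x : V3, G (fun i => (x i : UnitAddCircle)) = g ((N:ℝ) • x) := hG
  simp only [h3]
  rw [Measure.setIntegral_comp_smul_of_pos volume g (cubeN 1) hN']
  have h4 : (N:ℝ) • cubeN 1 = cubeN N := by
    ext x
    rw [Set.mem_smul_set_iff_inv_smul_mem₀ hN'.ne']
    simp only [cubeN, Set.mem_setOf_eq, Pi.smul_apply, smul_eq_mul, Set.mem_Ico, Nat.cast_one]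
    refine forall_congr' fun i => ?_
    rw [inv_mul_lt_iff₀ hN', mul_one]
    refine and_congr_left fun _ => ?_
    constructor
    · intro h
      have := mul_nonneg hN'.le h
      rwa [mul_inv_cancel_left₀ hN'.ne'] at this
    · intro h; positivity
  rw [h4]
  simp

lemma mF_eq {N : ℕ} (hN : 0 < N) (k : Fin 3 → ℤ) (x : V3) :
    UnitAddTorus.mFourier (-k) (prT x) = ekc N k ((N:ℝ) • x) := by
  have hN' : (N:ℂ) ≠ 0 := by exact_mod_cast hN.ne'
  have : ∀ i, fourier ((-k) i) (prT x i) =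
      Complex.exp (2 * π * Complex.I * ((-k i : ℤ) : ℂ) * (x i : ℂ)) := by
    intro i
    simp only [prT]
    rw [fourier_coe_apply]
    simp
  simp only [UnitAddTorus.mFourier, ContinuousMap.coe_mk, this]
  rw [← Complex.exp_sum, ekc]
  congr 1
  simp only [dotP, xiN, Complex.ofReal_sum, Finset.mul_sum, Pi.smul_apply, smul_eq_mul]
  refine Finset.sum_congr rfl fun i _ => ?_
  push_cast
  field_simp

lemma coeff_eq {N : ℕ} (hN : 0 < N) {f : V3 → ℂ}
    (F : C(UnitAddTorus (Fin 3), ℂ)) (hF : ∀ x : V3, F (prT x) = f ((N:ℝ) • x)) (k : Fin 3 → ℤ) :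
    UnitAddTorus.mFourierCoeff F k = ((N:ℝ)^3)⁻¹ • fc N f k := by
  have := torus_int hN (fun t => UnitAddTorus.mFourier (-k) t • F t)
    (fun x => ekc N k x * f x) (fun x => by rw [mF_eq hN, hF, smul_eq_mul])
  exact this

/-- Parseval -/
lemma parseval {N : ℕ} (hN : 0 < N) {f : V3 → ℂ} (hf : Continuous f) (hp : IsPerN N f) :
    HasSum (fun k => ‖fc N f k‖ ^ 2) ((N:ℝ)^3 * ∫ x in cubeN N, ‖f x‖ ^ 2) := by
  have hN' : (0:ℝ) < N := by exact_mod_cast hN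
  obtain ⟨F, hF⟩ := exists_torus hN hf hp
  letI : MeasureSpace UnitAddCircle := ⟨AddCircle.haarAddCircle⟩
  haveI : IsProbabilityMeasure (volume : Measure UnitAddCircle) :=
    inferInstanceAs (IsProbabilityMeasure AddCircle.haarAddCircle)
  haveI : Measure.IsAddHaarMeasure (volume : Measure UnitAddCircle) :=
    inferInstanceAs (Measure.IsAddHaarMeasure AddCircle.haarAddCircle)
  have h := UnitAddTorus.hasSum_sq_mFourierCoeff (ContinuousMap.toLp 2 volume ℂ F)
  simp only [UnitAddTorus.mFourierCoeff_toLp, coeff_eq hN F hF] at h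
  have h2 : ∫ t, ‖(ContinuousMap.toLp 2 volume ℂ F) t‖ ^ 2 =
      ((N:ℝ)^3)⁻¹ * ∫ x in cubeN N, ‖f x‖ ^ 2 := by
    have := torus_int hN (fun t => ‖F t‖ ^ 2) (fun x => ‖f x‖ ^ 2) (fun x => by rw [hF])
    rw [← smul_eq_mul, ← this]
    refine integral_congr_ae ?_
    filter_upwards [ContinuousMap.coeFn_toLp (p := 2) (𝕜 := ℂ) volume F] with t ht
    rw [ht]
  rw [h2] at h
  have h3 := h.mul_left (((N:ℝ)^3) ^ 2)
  have e1 : (fun k => ((N:ℝ)^3) ^ 2 * ‖((N:ℝ)^3)⁻¹ • fc N f k‖ ^ 2) =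
      fun k => ‖fc N f k‖ ^ 2 := by
    funext k
    rw [norm_smul, Real.norm_of_nonneg (by positivity), mul_pow]
    field_simp
  have e2 : ((N:ℝ)^3) ^ 2 * (((N:ℝ)^3)⁻¹ * ∫ x in cubeN N, ‖f x‖ ^ 2) =
      (N:ℝ)^3 * ∫ x in cubeN N, ‖f x‖ ^ 2 := by
    field_simp
  rw [e1, e2] at h3
  exact h3

/-- pointwise bound from summable coefficients -/
lemma sup_le_fc {N : ℕ} (hN : 0 < N) {f : V3 → ℂ} (hf : Continuous f) (hp : IsPerN N f)
    (hs : Summable fun k => ‖fc N f k‖) (x : V3) :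
    ‖f x‖ ≤ ((N:ℝ)^3)⁻¹ * ∑' k, ‖fc N f k‖ := by
  have hN' : (0:ℝ) < N := by exact_mod_cast hN
  obtain ⟨F, hF⟩ := exists_torus hN hf hp
  have hc := coeff_eq hN F hF
  have hsum : Summable (UnitAddTorus.mFourierCoeff F) := by
    apply Summable.of_norm
    simp only [hc, norm_smul]
    exact hs.mul_left _
  have h := UnitAddTorus.hasSum_mFourier_series_apply_of_summable hsum (prT ((N:ℝ)⁻¹ • x))
  rw [hF, smul_inv_smul₀ hN'.ne'] at h
  rw [← h.tsum_eq, ← tsum_mul_left]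
  have e : ∀ k, ‖UnitAddTorus.mFourierCoeff F k • UnitAddTorus.mFourier k (prT ((N:ℝ)⁻¹ • x))‖
     = ((N:ℝ)^3)⁻¹ * ‖fc N f k‖ := by
    intro k
    have h1 : ‖UnitAddTorus.mFourier k (prT ((N:ℝ)⁻¹ • x))‖ = 1 := by
      have := mF_eq hN (-k) ((N:ℝ)⁻¹ • x)
      rw [neg_neg] at this
      rw [this, ekc_norm]
    rw [norm_smul, h1, mul_one, hc, norm_smul, Real.norm_of_nonneg (by positivity)]
  refine (norm_tsum_le_tsum_norm ?_).trans (le_of_eq ?_)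
  · simp only [e]; exact hs.mul_left _
  · simp only [e]

/-- Fourier coefficient of a derivative -/
lemma fc_fderiv {N : ℕ} (hN : 0 < N) {f : V3 → ℂ} (hf : ContDiff ℝ 1 f) (hp : IsPerN N f)
    (k : Fin 3 → ℤ) (i : Fin 3) :
    fc N (fun x => fderiv ℝ f x (Pi.single i 1)) k = Complex.I * (xiN N k i : ℝ) * fc N f k := by
  rw [fc, ibp ((ekc_contDiff N k).of_le (by norm_num)) hf (ekc_per hN k) hp, fc]
  simp only [ekc_fderiv]
  rw [← integral_const_mul, ← integral_neg]
  congr 1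
  funext x
  ring

lemma fc_lapC {N : ℕ} (hN : 0 < N) {f : V3 → ℂ} (hf : ContDiff ℝ 2 f) (hp : IsPerN N f)
    (k : Fin 3 → ℤ) :
    fc N (lapC f) k = - (nsqV (xiN N k) : ℝ) * fc N f k := by
  have h : fc N (lapC f) k = ∑ i, fc N (fun x => fderiv ℝ (fun y => fderiv ℝ f y (Pi.single i 1)) x
      (Pi.single i 1)) k := by
    simp only [fc]
    rw [← integral_finsetSum]
    · congr 1
      funext x
      rw [lapC, Finset.mul_sum]
    · intro i _
      exact integ ((ekc_contDiff N k).continuous.mul (cont_fderiv (c1_fderiv hf _) _))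
  rw [h]
  simp only [fc_fderiv hN (c1_fderiv hf _) (per_fderiv hp _),
    fc_fderiv hN (hf.of_le (by norm_num)) hp]
  rw [nsqV]
  push_cast
  rw [← Finset.sum_neg_distrib, Finset.sum_mul]
  refine Finset.sum_congr rfl fun i _ => ?_
  linear_combination (xiN N k i : ℂ)^2 * fc N f k * Complex.I_sq

lemma fc_norm_le {N : ℕ} {f : V3 → ℂ} (k : Fin 3 → ℤ) :
    ‖fc N f k‖ ≤ ∫ x in cubeN N, ‖f x‖ := by
  refine (norm_integral_le_integral_norm _).trans (le_of_eq ?_)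
  simp only [norm_mul, ekc_norm, one_mul]

lemma nsqV_xi_pos {N : ℕ} (hN : 0 < N) {k : Fin 3 → ℤ} (hk : k ≠ 0) : 0 < nsqV (xiN N k) := by
  have hN' : (0:ℝ) < N := by exact_mod_cast hN
  obtain ⟨i, hi⟩ := Function.ne_iff.mp hk
  refine Finset.sum_pos' (fun j _ => sq_nonneg _) ⟨i, Finset.mem_univ i, ?_⟩
  have : (k i : ℝ) ≠ 0 := by exact_mod_cast hi
  simp only [xiN]
  positivity

/-! ### Part 2: summability and the Gagliardo-Nirenberg-Sobolev inequality -/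

lemma summ_xi {N : ℕ} (hN : 0 < N) :
    Summable (fun k : Fin 3 → ℤ => (nsqV (xiN N k))⁻¹ ^ 2) := by
  have hN' : (0:ℝ) < N := by exact_mod_cast hN
  let L := Submodule.span ℤ (Set.range (Pi.basisFun ℝ (Fin 3)))
  have hfr : Module.finrank ℤ L = 3 := by
    have := ZLattice.rank ℝ L
    rw [this]; simp
  have h := ZLattice.summable_norm_pow_inv L 4 (by rw [hfr]; norm_num)
  have hmem : ∀ k : Fin 3 → ℤ, (fun i => (k i : ℝ)) ∈ L := by
    intro k
    refine ((Pi.basisFun ℝ (Fin 3)).mem_span_iff_repr_mem ℤ _).mpr ?_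
    intro i
    exact ⟨k i, by simp⟩
  let j : (Fin 3 → ℤ) → L := fun k => ⟨fun i => (k i : ℝ), hmem k⟩
  have hj : Function.Injective j := by
    intro a b hab
    have := congrArg Subtype.val hab
    funext i
    have h3 : (a i : ℝ) = (b i : ℝ) := congrFun this i
    exact_mod_cast h3
  have h2 := h.comp_injective hj
  refine Summable.of_nonneg_of_le (fun k => by positivity) ?_
    (h2.mul_left ((2 * π / N)⁻¹ ^ 4))
  intro k
  by_cases hk : k = 0
  · subst hk
    have : nsqV (xiN N 0) = 0 := by simp [nsqV, xiN]
    rw [this]; simp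
    positivity
  have hpos : 0 < ‖j k‖ := by
    rw [norm_pos_iff]
    intro h0
    apply hk
    apply hj
    rw [h0]
    ext i; simp [j]
  have hle : (2 * π / N) ^ 2 * ‖j k‖ ^ 2 ≤ nsqV (xiN N k) := by
    have hx : ‖(fun i => (k i : ℝ) : V3)‖ ^ 2 ≤ ∑ i, (k i : ℝ) ^ 2 := by
      have h3 : ‖(fun i => (k i : ℝ) : V3)‖ ≤ √(∑ i, (k i : ℝ) ^ 2) := by
        rw [pi_norm_le_iff_of_nonneg (Real.sqrt_nonneg _)]
        intro i
        apply Real.abs_le_sqrt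
        exact Finset.single_le_sum (f := fun i => (k i : ℝ)^2) (fun i _ => sq_nonneg _)
          (Finset.mem_univ i)
      have := pow_le_pow_left₀ (norm_nonneg _) h3 2
      rwa [Real.sq_sqrt (Finset.sum_nonneg fun i _ => sq_nonneg _)] at this
    have e : nsqV (xiN N k) = (2 * π / N) ^ 2 * ∑ i, (k i : ℝ) ^ 2 := by
      simp [nsqV, xiN, Finset.mul_sum, mul_pow]
    rw [e]
    gcongr
    exact hx
  have hp : 0 < (2 * π / N) ^ 2 * ‖j k‖ ^ 2 := by positivity
  calc (nsqV (xiN N k))⁻¹ ^ 2 ≤ ((2 * π / N) ^ 2 * ‖j k‖ ^ 2)⁻¹ ^ 2 := by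
        have := nsqV_xi_pos hN hk
        gcongr
    _ = _ := by
        simp only [Function.comp]
        rw [mul_inv, mul_pow, ← inv_pow, ← inv_pow, ← pow_mul, ← pow_mul]

lemma lint_ball {N : ℕ} (hN : 0 < N) : ∃ m : ℕ, ∀ g : V3 → ENNReal, IsPerN N g →
    ∫⁻ x in Metric.ball 0 (2 * N), g x ≤ m * ∫⁻ x in cubeN N, g x := by
  have hN' : (0:ℝ) < N := by exact_mod_cast hN
  let S : Finset (Fin 3 → ℤ) := Fintype.piFinset fun _ => Finset.Icc (-3) 3
  let Q : (Fin 3 → ℤ) → Set V3 := fun k => (fun x => x + fun i => (N:ℝ) * (k i : ℝ)) ⁻¹' cubeN N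
  refine ⟨S.card, fun g hg => ?_⟩
  have hcov : Metric.ball (0:V3) (2 * N) ⊆ ⋃ k : S, Q k := by
    intro x hx
    rw [mem_ball_zero_iff, pi_norm_lt_iff (by positivity)] at hx
    simp only [Set.mem_iUnion]
    obtain ⟨k, hk⟩ := exists_cube hN x
    refine ⟨⟨k, ?_⟩, hk⟩
    simp only [S, Fintype.mem_piFinset, Finset.mem_Icc]
    intro i
    have h1 := hk i
    have h2 := abs_lt.mp (hx i)
    simp only [Pi.add_apply, Set.mem_Ico] at h1
    have h3 : (N:ℝ) * (k i : ℝ) < N * 3 := by nlinarith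
    have h4 : (N:ℝ) * (-3) < N * (k i : ℝ) := by nlinarith
    have h3' := lt_of_mul_lt_mul_left h3 hN'.le
    have h4' := lt_of_mul_lt_mul_left h4 hN'.le
    constructor
    · have : (-3 : ℤ) < k i := by exact_mod_cast h4'
      omega
    · have : k i < (3 : ℤ) := by exact_mod_cast h3'
      omega
  have hQ : ∀ k, ∫⁻ x in Q k, g x = ∫⁻ x in cubeN N, g x := by
    intro k
    have h := (measurePreserving_add_right (volume : Measure V3)
      (fun i => (N:ℝ) * (k i : ℝ))).setLIntegral_comp_preimage_emb
      (measurableEmbedding_addRight _) g (cubeN N)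
    rw [← h]
    refine lintegral_congr fun x => ?_
    rw [hg]
  calc ∫⁻ x in Metric.ball 0 (2 * N), g x ≤ ∫⁻ x in ⋃ k : S, Q k, g x := lintegral_mono_set hcov
    _ ≤ ∑' k : S, ∫⁻ x in Q k, g x := lintegral_iUnion_le _ _
    _ = _ := by simp [hQ]

lemma norm_fderiv_sq_le (f : V3 → ℂ) (x : V3) : ‖fderiv ℝ f x‖ ^ 2 ≤ 3 * gradSq f x := by
  set L := fderiv ℝ f x
  have h1 : ‖L‖ ≤ ∑ i, ‖L (Pi.single i 1)‖ := by
    refine ContinuousLinearMap.opNorm_le_bound _ (Finset.sum_nonneg fun i _ => norm_nonneg _) ?_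
    intro v
    have hv : v = ∑ i, v i • (Pi.single i 1 : V3) := by
      ext j; simp [Pi.single_apply]
    conv_lhs => rw [hv]
    rw [map_sum, Finset.sum_mul]
    refine (norm_sum_le _ _).trans (Finset.sum_le_sum fun i _ => ?_)
    rw [map_smul, norm_smul, mul_comm]
    gcongr
    exact norm_le_pi_norm v i
  have h2 : (∑ i, ‖L (Pi.single i 1)‖) ^ 2 ≤ 3 * ∑ i, ‖L (Pi.single i 1)‖ ^ 2 := by
    have := sq_sum_le_card_mul_sum_sq (s := (Finset.univ : Finset (Fin 3)))
      (f := fun i => ‖L (Pi.single i 1)‖)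
    simpa using this
  have h3 : gradSq f x = ∑ i, ‖L (Pi.single i 1)‖ ^ 2 := by
    simp only [gradSq, Complex.normSq_eq_norm_sq]; rfl
  rw [h3]
  exact (pow_le_pow_left₀ (norm_nonneg _) h1 2).trans h2

lemma gradSq_nonneg (f : V3 → ℂ) (x : V3) : 0 ≤ gradSq f x :=
  Finset.sum_nonneg fun _ _ => Complex.normSq_nonneg _

lemma gradSq_cont {f : V3 → ℂ} (hf : ContDiff ℝ 1 f) : Continuous (gradSq f) := by
  unfold gradSq
  exact continuous_finsetSum _ fun i _ => Complex.continuous_normSq.comp (cont_fderiv hf _)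

lemma gradSq_per {N : ℕ} {f : V3 → ℂ} (hp : IsPerN N f) : IsPerN N (gradSq f) := by
  intro x k
  unfold gradSq
  refine Finset.sum_congr rfl fun i _ => ?_
  have := per_fderiv hp (Pi.single i 1) x k
  simp only at this
  rw [this]

lemma gns {N : ℕ} (hN : 0 < N) : ∃ C : ℝ, 0 ≤ C ∧ ∀ f : V3 → ℂ, ContDiff ℝ 1 f → IsPerN N f →
    ∫ x in cubeN N, ‖f x‖ ^ 4 ≤ C * (∫ x in cubeN N, (gradSq f x + ‖f x‖ ^ 2)) ^ 2 := by
  have hN' : (0:ℝ) < N := by exact_mod_cast hN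
  let χ : ContDiffBump (0 : V3) := ⟨N, 2 * N, hN', by linarith⟩
  have hχ : ContDiff ℝ 1 (χ : V3 → ℝ) := χ.contDiff
  obtain ⟨B, hB⟩ := χ.hasCompactSupport.fderiv (𝕜 := ℝ) |>.exists_bound_of_continuous
    (hχ.continuous_fderiv (by norm_num))
  obtain ⟨m, hm⟩ := lint_ball hN
  set c := eLpNormLESNormFDerivOfLeConst ℂ (volume : Measure V3) (Metric.ball 0 (2 * N)) 2 4
  let K : ℝ := 6 + 2 * B ^ 2
  refine ⟨(c : ℝ) ^ 4 * (m * K) ^ 2, by positivity, fun f hf hp => ?_⟩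
  let u : V3 → ℂ := fun x => χ x • f x
  have hu : ContDiff ℝ 1 u := hχ.smul hf
  have hsupp : u.support ⊆ Metric.ball 0 (2 * N) := by
    intro x hx
    rw [← show (χ : V3 → ℝ).support = Metric.ball 0 (2 * N) from χ.support_eq]
    intro h0
    apply hx
    simp [u, h0]
  have hs := eLpNorm_le_eLpNorm_fderiv_of_le (volume : Measure V3) hu hsupp (p := 2) (q := 4)
    (by norm_num) (by simp; norm_num) (by simp; norm_num) Metric.isBounded_ball
  have hfd : ∀ x, ‖fderiv ℝ u x‖ ^ 2 ≤ K * (gradSq f x + ‖f x‖ ^ 2) := by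
    intro x
    have h1 : fderiv ℝ u x = _ := ((hχ.differentiable (by norm_num) x).hasFDerivAt.smul
      (hf.differentiable (by norm_num) x).hasFDerivAt).fderiv
    have h2 : ‖fderiv ℝ u x‖ ≤ ‖fderiv ℝ f x‖ + B * ‖f x‖ := by
      rw [h1]
      refine (norm_add_le _ _).trans ?_
      rw [norm_smul, ContinuousLinearMap.norm_smulRight_apply]
      gcongr
      · rw [Real.norm_of_nonneg χ.nonneg]
        exact mul_le_of_le_one_left (norm_nonneg _) χ.le_one
      · exact hB x
    have h3 := norm_fderiv_sq_le f x
    have h4 := gradSq_nonneg f x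
    have h5 := pow_le_pow_left₀ (norm_nonneg _) h2 2
    have h6 : 0 ≤ B ^ 2 * gradSq f x := by positivity
    simp only [K]
    nlinarith [sq_nonneg (‖fderiv ℝ f x‖ - B * ‖f x‖), sq_nonneg (‖f x‖)]
  set w : V3 → ℝ := fun x => gradSq f x + ‖f x‖ ^ 2
  have hw0 : ∀ x, 0 ≤ w x := fun x => add_nonneg (gradSq_nonneg f x) (sq_nonneg _)
  have hwc : Continuous w := (gradSq_cont hf).add (hf.continuous.norm.pow 2)
  have hwp : IsPerN N (fun x => ENNReal.ofReal (w x)) := by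
    intro x k
    simp only [w, gradSq_per hp x k, hp x k]
  have hzero : ∀ x ∉ Metric.ball (0:V3) (2 * N), fderiv ℝ u x = 0 := by
    intro x hx
    have h1 : ‖fderiv ℝ u x‖ = 0 := by
      have h0 : χ x = 0 := χ.zero_of_le_dist (by simpa [χ] using hx)
      have h0' : fderiv ℝ (χ : V3 → ℝ) x = 0 := by
        have : IsLocalMin (χ : V3 → ℝ) x := by
          refine Filter.Eventually.of_forall fun y => ?_
          rw [h0]; exact χ.nonneg
        exact this.fderiv_eq_zero
      have h1 : fderiv ℝ u x = _ := ((hχ.differentiable (by norm_num) x).hasFDerivAt.smul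
        (hf.differentiable (by norm_num) x).hasFDerivAt).fderiv
      rw [h1, h0, h0']
      simp
    exact norm_eq_zero.mp h1
  have hR : eLpNorm (fderiv ℝ u) 2 volume ^ 2 ≤
      ENNReal.ofReal (m * K * ∫ x in cubeN N, w x) := by
    have e1 : eLpNorm (fderiv ℝ u) 2 volume ^ 2 = ∫⁻ x, ‖fderiv ℝ u x‖ₑ ^ 2 := by
      have := eLpNorm_nnreal_pow_eq_lintegral (μ := (volume : Measure V3)) (f := fderiv ℝ u)
        (p := 2) (by norm_num)
      simpa using this
    have e2 : ∫⁻ x, ‖fderiv ℝ u x‖ₑ ^ 2 = ∫⁻ x in Metric.ball 0 (2 * N), ‖fderiv ℝ u x‖ₑ ^ 2 := by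
      rw [← lintegral_indicator Metric.isOpen_ball.measurableSet]
      refine lintegral_congr fun x => ?_
      by_cases hx : x ∈ Metric.ball (0:V3) (2 * N)
      · rw [Set.indicator_of_mem hx]
      · rw [Set.indicator_of_notMem hx, ← ofReal_norm, hzero x hx, norm_zero]; simp
    rw [e1, e2]
    calc ∫⁻ x in Metric.ball 0 (2 * N), ‖fderiv ℝ u x‖ₑ ^ 2
        ≤ ∫⁻ x in Metric.ball 0 (2 * N), ENNReal.ofReal K * ENNReal.ofReal (w x) := by
          refine lintegral_mono fun x => ?_
          rw [← ENNReal.ofReal_mul (by positivity), ← ofReal_norm, ← ENNReal.ofReal_pow (norm_nonneg _)]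
          exact ENNReal.ofReal_le_ofReal (hfd x)
      _ = ENNReal.ofReal K * ∫⁻ x in Metric.ball 0 (2 * N), ENNReal.ofReal (w x) :=
          lintegral_const_mul' _ _ ENNReal.ofReal_ne_top
      _ ≤ ENNReal.ofReal K * (m * ∫⁻ x in cubeN N, ENNReal.ofReal (w x)) := by
          gcongr
          exact hm _ hwp
      _ = _ := by
          rw [← ofReal_integral_eq_lintegral_ofReal (integ hwc) (Filter.Eventually.of_forall hw0)]
          rw [ENNReal.ofReal_mul (by positivity), ENNReal.ofReal_mul (by positivity),
            ENNReal.ofReal_natCast]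
          ring
  have hLf : ENNReal.ofReal (∫ x in cubeN N, ‖f x‖ ^ 4) ≤ eLpNorm u 4 volume ^ 4 := by
    have e1 : eLpNorm u 4 volume ^ 4 = ∫⁻ x, ‖u x‖ₑ ^ 4 := by
      have := eLpNorm_nnreal_pow_eq_lintegral (μ := (volume : Measure V3)) (f := u)
        (p := 4) (by norm_num)
      simp only [NNReal.coe_ofNat, ENNReal.coe_ofNat] at this
      exact_mod_cast this
    rw [e1, ofReal_integral_eq_lintegral_ofReal (integ (f := fun x => ‖f x‖ ^ 4) (by have := hf.continuous; fun_prop))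
      (Filter.Eventually.of_forall fun x => by positivity)]
    refine le_trans ?_ (setLIntegral_le_lintegral (cubeN N) _)
    refine setLIntegral_mono' (measSet_cube N) fun x hx => ?_
    have h1 : χ x = 1 := by
      apply χ.one_of_mem_closedBall
      rw [mem_closedBall_zero_iff, pi_norm_le_iff_of_nonneg (by positivity)]
      intro i
      rw [Real.norm_of_nonneg (hx i).1]
      exact (hx i).2.le
    simp only [u, h1, one_smul]
    rw [ENNReal.ofReal_pow (norm_nonneg _), ofReal_norm]
  have hfin : ENNReal.ofReal (∫ x in cubeN N, ‖f x‖ ^ 4) ≤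
      ENNReal.ofReal ((c : ℝ) ^ 4 * (m * K * ∫ x in cubeN N, w x) ^ 2) := by
    refine hLf.trans ?_
    have h4 : eLpNorm u 4 volume ≤ c * eLpNorm (fderiv ℝ u) 2 volume := hs
    calc eLpNorm u 4 volume ^ 4 ≤ (c * eLpNorm (fderiv ℝ u) 2 volume) ^ 4 := by gcongr
      _ = (c:ENNReal) ^ 4 * (eLpNorm (fderiv ℝ u) 2 volume ^ 2) ^ 2 := by ring
      _ ≤ (c:ENNReal) ^ 4 * (ENNReal.ofReal (m * K * ∫ x in cubeN N, w x)) ^ 2 := by gcongr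
      _ = _ := by
          have hi : 0 ≤ ∫ x in cubeN N, w x := integral_nonneg hw0
          have hK : 0 ≤ m * K * ∫ x in cubeN N, w x := by positivity
          rw [ENNReal.ofReal_mul (by positivity : (0:ℝ) ≤ (c:ℝ) ^ 4), ENNReal.ofReal_pow hK,
            ENNReal.ofReal_pow (by positivity : (0:ℝ) ≤ (c:ℝ)), ENNReal.ofReal_coe_nnreal]
  have hi : 0 ≤ ∫ x in cubeN N, w x := integral_nonneg hw0
  have := (ENNReal.ofReal_le_ofReal_iff (by positivity)).mp hfin
  calc _ ≤ _ := this
    _ = _ := by ring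

/-! ### Part 3: Green identities and the Poisson equation -/

lemma lapR_cont {u : V3 → ℝ} (hu : ContDiff ℝ 2 u) : Continuous (lapR u) := by
  unfold lapR
  exact continuous_finsetSum _ fun i _ => cont_fderiv (c1_fderiv hu _) _

lemma lapC_cont {u : V3 → ℂ} (hu : ContDiff ℝ 2 u) : Continuous (lapC u) := by
  unfold lapC
  exact continuous_finsetSum _ fun i _ => cont_fderiv (c1_fderiv hu _) _

lemma lapC_per {N : ℕ} {u : V3 → ℂ} (hp : IsPerN N u) : IsPerN N (lapC u) := by
  intro x k
  unfold lapC
  refine Finset.sum_congr rfl fun i _ => ?_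
  exact per_fderiv (per_fderiv hp (Pi.single i 1)) (Pi.single i 1) x k

lemma lapR_per {N : ℕ} {u : V3 → ℝ} (hp : IsPerN N u) : IsPerN N (lapR u) := by
  intro x k
  unfold lapR
  refine Finset.sum_congr rfl fun i _ => ?_
  exact per_fderiv (per_fderiv hp (Pi.single i 1)) (Pi.single i 1) x k

lemma lapR_int_zero {N : ℕ} {u : V3 → ℝ} (hu : ContDiff ℝ 2 u) (hp : IsPerN N u) :
    ∫ x in cubeN N, lapR u x = 0 := by
  unfold lapR
  rw [integral_finsetSum _ fun i _ => integ (cont_fderiv (c1_fderiv hu _) _)]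
  exact Finset.sum_eq_zero fun i _ => int_fderiv_zero (c1_fderiv hu _) (per_fderiv hp _) i

lemma greenR {N : ℕ} {u v : V3 → ℝ} (hu : ContDiff ℝ 1 u) (hv : ContDiff ℝ 2 v)
    (hup : IsPerN N u) (hvp : IsPerN N v) :
    ∫ x in cubeN N, u x * lapR v x = - ∫ x in cubeN N, dotP (gradV u x) (gradV v x) := by
  have hu1 : ∀ i : Fin 3, Continuous (fun x => fderiv ℝ u x (Pi.single i 1)) :=
    fun i => cont_fderiv hu _
  have hv1 : ∀ i : Fin 3, Continuous (fun x => fderiv ℝ v x (Pi.single i 1)) :=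
    fun i => cont_fderiv (hv.of_le (by norm_num)) _
  simp only [lapR, dotP, gradV, Finset.mul_sum]
  rw [integral_finsetSum, integral_finsetSum, ← Finset.sum_neg_distrib]
  · exact Finset.sum_congr rfl fun i _ => ibp hu (c1_fderiv hv _) hup (per_fderiv hvp _) i
  · exact fun i _ => integ ((hu1 i).mul (hv1 i))
  · exact fun i _ => integ (hu.continuous.mul (cont_fderiv (c1_fderiv hv _) _))

lemma lapR_sym {N : ℕ} {u v : V3 → ℝ} (hu : ContDiff ℝ 2 u) (hv : ContDiff ℝ 2 v)
    (hup : IsPerN N u) (hvp : IsPerN N v) :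
    ∫ x in cubeN N, u x * lapR v x = ∫ x in cubeN N, v x * lapR u x := by
  rw [greenR (hu.of_le (by norm_num)) hv hup hvp, greenR (hv.of_le (by norm_num)) hu hvp hup]
  simp only [dotP, mul_comm]

lemma conj_contDiff {n : WithTop ℕ∞} {f : V3 → ℂ} (hf : ContDiff ℝ n f) :
    ContDiff ℝ n (fun x => (starRingEnd ℂ) (f x)) :=
  Complex.conjCLE.contDiff.comp hf

lemma conj_fderiv (f : V3 → ℂ) (x v : V3) :
    fderiv ℝ (fun y => (starRingEnd ℂ) (f y)) x v = (starRingEnd ℂ) (fderiv ℝ f x v) := by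
  have := Complex.conjCLE.comp_fderiv (f := f) (x := x)
  have h2 := congrArg (fun L => L v) this
  exact h2

lemma greenC {N : ℕ} {u v : V3 → ℂ} (hu : ContDiff ℝ 1 u) (hv : ContDiff ℝ 2 v)
    (hup : IsPerN N u) (hvp : IsPerN N v) :
    ∫ x in cubeN N, (starRingEnd ℂ) (u x) * lapC v x =
      - ∫ x in cubeN N, ∑ i, (starRingEnd ℂ) (fderiv ℝ u x (Pi.single i 1)) *
        fderiv ℝ v x (Pi.single i 1) := by
  have hu0 : Continuous (fun x => (starRingEnd ℂ) (u x)) := (conj_contDiff hu).continuous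
  have hu1 : ∀ i : Fin 3, Continuous (fun x => (starRingEnd ℂ) (fderiv ℝ u x (Pi.single i 1))) :=
    fun i => Complex.continuous_conj.comp (cont_fderiv hu _)
  have hv1 : ∀ i : Fin 3, Continuous (fun x => fderiv ℝ v x (Pi.single i 1)) :=
    fun i => cont_fderiv (hv.of_le (by norm_num)) _
  simp only [lapC, Finset.mul_sum]
  rw [integral_finsetSum, integral_finsetSum, ← Finset.sum_neg_distrib]
  · refine Finset.sum_congr rfl fun i _ => ?_
    rw [ibp (conj_contDiff hu) (c1_fderiv hv _) (fun x k => by simp only [hup x k])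
      (per_fderiv hvp _) i]
    simp only [conj_fderiv]
  · exact fun i _ => integ ((hu1 i).mul (hv1 i))
  · exact fun i _ => integ (hu0.mul (cont_fderiv (c1_fderiv hv _) _))

lemma ofReal_contDiff {n : WithTop ℕ∞} {f : V3 → ℝ} (hf : ContDiff ℝ n f) :
    ContDiff ℝ n (fun x => (f x : ℂ)) :=
  Complex.ofRealCLM.contDiff.comp hf

lemma ofReal_fderiv {f : V3 → ℝ} {x : V3} (hf : DifferentiableAt ℝ f x) (v : V3) :
    fderiv ℝ (fun y => (f y : ℂ)) x v = ((fderiv ℝ f x v : ℝ) : ℂ) := by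
  have h : HasFDerivAt (fun y => (f y : ℂ)) (Complex.ofRealCLM.comp (fderiv ℝ f x)) x :=
    Complex.ofRealCLM.hasFDerivAt.comp x hf.hasFDerivAt
  rw [h.fderiv]; rfl

lemma lapC_ofReal {f : V3 → ℝ} (hf : ContDiff ℝ 2 f) (x : V3) :
    lapC (fun y => (f y : ℂ)) x = ((lapR f x : ℝ) : ℂ) := by
  unfold lapC lapR
  push_cast
  refine Finset.sum_congr rfl fun i _ => ?_
  have h : (fun y => fderiv ℝ (fun z => (f z : ℂ)) y (Pi.single i 1)) =
      fun y => ((fderiv ℝ f y (Pi.single i 1) : ℝ) : ℂ) := by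
    funext y
    exact ofReal_fderiv (hf.differentiable (by norm_num) y) _
  rw [h]
  exact ofReal_fderiv ((c1_fderiv hf _).differentiable (by norm_num) x) _

/-- mean value -/
def mn (N : ℕ) (u : V3 → ℝ) : ℝ := ((N:ℝ)^3)⁻¹ * ∫ x in cubeN N, u x

lemma vol_real (N : ℕ) : (volume.restrict (cubeN N)).real Set.univ = (N:ℝ)^3 := by
  rw [Measure.real, Measure.restrict_apply_univ, vol_cube]
  simp

lemma int_const (N : ℕ) (c : ℝ) : ∫ _ in cubeN N, c = (N:ℝ)^3 * c := by
  rw [integral_const, vol_real, smul_eq_mul]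

lemma int_sub_mn {N : ℕ} (hN : 0 < N) {u : V3 → ℝ} (hu : Continuous u) :
    ∫ x in cubeN N, (u x - mn N u) = 0 := by
  have hN' : (0:ℝ) < N := by exact_mod_cast hN
  rw [integral_sub (integ hu) (integ continuous_const), int_const, mn]
  field_simp
  ring

lemma fc_sub_mn {N : ℕ} (hN : 0 < N) {u : V3 → ℝ} (hu : ContDiff ℝ 2 u) (hp : IsPerN N u)
    (k : Fin 3 → ℤ) :
    ‖fc N (fun x => ((u x - mn N u : ℝ) : ℂ)) k‖ =
      ‖fc N (fun x => ((lapR u x : ℝ) : ℂ)) k‖ * (nsqV (xiN N k))⁻¹ := by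
  by_cases hk : k = 0
  · subst hk
    have h0 : nsqV (xiN N 0) = 0 := by simp [nsqV, xiN]
    have h1 : fc N (fun x => ((u x - mn N u : ℝ) : ℂ)) 0 = 0 := by
      have : ∀ x, ekc N 0 x = 1 := by intro x; simp [ekc, xiN, dotP]
      simp only [fc, this, one_mul]
      rw [integral_complex_ofReal, int_sub_mn hN hu.continuous]
      simp
    rw [h0, h1]; simp
  · have hv : ContDiff ℝ 2 (fun x => u x - mn N u) := hu.sub contDiff_const
    have h := fc_lapC hN (ofReal_contDiff hv) (fun x m => by simp only [hp x m]) k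
    have e : lapC (fun x => ((u x - mn N u : ℝ) : ℂ)) = fun x => ((lapR u x : ℝ) : ℂ) := by
      funext x
      rw [lapC_ofReal hv]
      simp [lapR, fderiv_sub_const]
    rw [e] at h
    have hpos := nsqV_xi_pos hN hk
    rw [h, norm_mul, norm_neg, Complex.norm_real, Real.norm_of_nonneg hpos.le]
    field_simp

lemma poisson_L2 {N : ℕ} (hN : 0 < N) : ∃ C : ℝ, 0 ≤ C ∧ ∀ u : V3 → ℝ, ContDiff ℝ 2 u →
    IsPerN N u → ∫ x in cubeN N, (u x - mn N u) ^ 2 ≤ C * (∫ x in cubeN N, |lapR u x|) ^ 2 := by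
  have hN' : (0:ℝ) < N := by exact_mod_cast hN
  refine ⟨((N:ℝ)^3)⁻¹ * ∑' k : Fin 3 → ℤ, (nsqV (xiN N k))⁻¹ ^ 2, by positivity, ?_⟩
  intro u hu hp
  have hc : Continuous (fun x => ((u x - mn N u : ℝ) : ℂ)) :=
    Complex.continuous_ofReal.comp (hu.continuous.sub continuous_const)
  have hP := parseval hN hc (fun x m => by simp only [hp x m])
  simp only [fc_sub_mn hN hu hp] at hP
  have hle : ∀ k, (‖fc N (fun x => ((lapR u x : ℝ) : ℂ)) k‖ * (nsqV (xiN N k))⁻¹) ^ 2 ≤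
      (∫ x in cubeN N, |lapR u x|) ^ 2 * (nsqV (xiN N k))⁻¹ ^ 2 := by
    intro k
    rw [mul_pow]
    gcongr
    refine (fc_norm_le k).trans (le_of_eq ?_)
    simp only [Complex.norm_real, Real.norm_eq_abs]
  have h2 := hasSum_le hle hP ((summ_xi hN).hasSum.mul_left _)
  simp only [Complex.norm_real, Real.norm_eq_abs, sq_abs] at h2
  rw [mul_assoc, inv_mul_eq_div, le_div_iff₀ (by positivity)]
  linarith

lemma poisson_sup {N : ℕ} (hN : 0 < N) : ∃ C : ℝ, 0 ≤ C ∧ ∀ u : V3 → ℝ, ContDiff ℝ 2 u →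
    IsPerN N u → ∀ x, |u x - mn N u| ≤ C * √(∫ x in cubeN N, (lapR u x) ^ 2) := by
  have hN' : (0:ℝ) < N := by exact_mod_cast hN
  set S := ∑' k : Fin 3 → ℤ, (nsqV (xiN N k))⁻¹ ^ 2
  refine ⟨((N:ℝ)^3)⁻¹ * (√((N:ℝ)^3) * √S), by positivity, ?_⟩
  intro u hu hp x
  have hc : Continuous (fun x => ((u x - mn N u : ℝ) : ℂ)) :=
    Complex.continuous_ofReal.comp (hu.continuous.sub continuous_const)
  have hcl : Continuous (fun x => ((lapR u x : ℝ) : ℂ)) :=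
    Complex.continuous_ofReal.comp (lapR_cont hu)
  have hP := parseval hN hcl (fun x m => by simp only [lapR_per hp x m])
  have hnn : ∀ k, 0 ≤ ‖fc N (fun x => ((u x - mn N u : ℝ) : ℂ)) k‖ := fun k => norm_nonneg _
  have hfin : ∀ F : Finset (Fin 3 → ℤ), ∑ k ∈ F, ‖fc N (fun x => ((u x - mn N u : ℝ) : ℂ)) k‖ ≤
      √((N:ℝ)^3 * ∫ x in cubeN N, (lapR u x) ^ 2) * √S := by
    intro F
    simp only [fc_sub_mn hN hu hp]
    refine (Real.sum_mul_le_sqrt_mul_sqrt _ _ _).trans ?_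
    gcongr
    · have := sum_le_hasSum F (fun k _ => by positivity) hP
      simpa only [Complex.norm_real, Real.norm_eq_abs, sq_abs] using this
    · exact (summ_xi hN).sum_le_tsum F (fun k _ => by positivity)
  have hs := summable_of_sum_le hnn hfin
  have h1 := sup_le_fc hN hc (fun x m => by simp only [hp x m]) hs x
  have h2 := Real.tsum_le_of_sum_le hnn hfin
  rw [Complex.norm_real, Real.norm_eq_abs] at h1
  calc _ ≤ _ := h1
    _ ≤ ((N:ℝ)^3)⁻¹ * (√((N:ℝ)^3 * ∫ x in cubeN N, (lapR u x) ^ 2) * √S) := by gcongr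
    _ = _ := by
      rw [Real.sqrt_mul (by positivity)]; ring

lemma grad_parseval {N : ℕ} (hN : 0 < N) {f : V3 → ℂ} (hf : ContDiff ℝ 1 f) (hp : IsPerN N f) :
    HasSum (fun k => nsqV (xiN N k) * ‖fc N f k‖ ^ 2) ((N:ℝ)^3 * ∫ x in cubeN N, gradSq f x) := by
  have h : ∀ i ∈ (Finset.univ : Finset (Fin 3)), HasSum (fun k => (xiN N k i) ^ 2 * ‖fc N f k‖ ^ 2)
      ((N:ℝ)^3 * ∫ x in cubeN N, ‖fderiv ℝ f x (Pi.single i 1)‖ ^ 2) := by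
    intro i _
    have := parseval hN (cont_fderiv hf (Pi.single i 1)) (per_fderiv hp _)
    simp only [fc_fderiv hN hf hp, norm_mul, Complex.norm_I, one_mul, Complex.norm_real,
      mul_pow, Real.norm_eq_abs, sq_abs] at this
    exact this
  have h2 := hasSum_sum h
  have e : ∫ x in cubeN N, gradSq f x =
      ∑ i : Fin 3, ∫ x in cubeN N, ‖fderiv ℝ f x (Pi.single i 1)‖ ^ 2 := by
    simp only [gradSq, Complex.normSq_eq_norm_sq]
    rw [integral_finsetSum]
    intro i _
    exact integ ((cont_fderiv hf _).norm.pow 2)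
  rw [e, Finset.mul_sum]
  simp only [nsqV, Finset.sum_mul]
  exact h2

/-! ### Part 4: abstract analytic lemmas -/

/-- the `L²` norm over the cube -/
def l2 (N : ℕ) (f : V3 → ℂ) : ℝ := √(∫ x in cubeN N, ‖f x‖ ^ 2)

lemma l2_nonneg (N : ℕ) (f : V3 → ℂ) : 0 ≤ l2 N f := Real.sqrt_nonneg _

lemma l2_sq (N : ℕ) (f : V3 → ℂ) : l2 N f ^ 2 = ∫ x in cubeN N, ‖f x‖ ^ 2 :=
  Real.sq_sqrt (integral_nonneg fun _ => sq_nonneg _)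

lemma l2_add {N : ℕ} {f g : V3 → ℂ} (hf : Continuous f) (hg : Continuous g) :
    l2 N (fun x => f x + g x) ≤ l2 N f + l2 N g := by
  have h1 : l2 N (fun x => f x + g x) ^ 2 ≤ (l2 N f + l2 N g) ^ 2 := by
    rw [add_sq, l2_sq, l2_sq, l2_sq]
    have hcs := cs_le (N := N) hf.norm hg.norm
    have hle : ∫ x in cubeN N, ‖f x + g x‖ ^ 2 ≤
        ∫ x in cubeN N, (‖f x‖ ^ 2 + 2 * (‖f x‖ * ‖g x‖) + ‖g x‖ ^ 2) := by
      refine integral_mono (integ (by fun_prop)) (integ (by fun_prop)) fun x => ?_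
      have := pow_le_pow_left₀ (norm_nonneg _) (norm_add_le (f x) (g x)) 2
      simp only
      nlinarith
    rw [integral_add (integ (by fun_prop)) (integ (by fun_prop)),
      integral_add (integ (by fun_prop)) (integ (by fun_prop)), integral_const_mul] at hle
    have := le_abs_self (∫ x in cubeN N, ‖f x‖ * ‖g x‖)
    have e : 2 * l2 N f * l2 N g = 2 * (l2 N f * l2 N g) := by ring
    rw [e]
    have e2 : √(∫ x in cubeN N, ‖f x‖ ^ 2) * √(∫ x in cubeN N, ‖g x‖ ^ 2) = l2 N f * l2 N g := rfl
    linarith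
  exact le_of_sq_le_sq h1 (add_nonneg (l2_nonneg _ _) (l2_nonneg _ _))

lemma l2_neg_sub (N : ℕ) (f g : V3 → ℂ) :
    l2 N (fun x => f x - g x) = l2 N (fun x => g x - f x) := by
  unfold l2; simp only [norm_sub_rev]

lemma l2_zero (N : ℕ) : l2 N (fun _ => 0) = 0 := by simp [l2]

lemma l2_le_of_bound {N : ℕ} {f : V3 → ℂ} (hf : Continuous f) {B : ℝ} (hB : 0 ≤ B)
    (h : ∀ x, ‖f x‖ ≤ B) : l2 N f ≤ √((N:ℝ)^3) * B := by
  have : ∫ x in cubeN N, ‖f x‖ ^ 2 ≤ ∫ _ in cubeN N, B ^ 2 :=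
    integral_mono (integ (by fun_prop)) (integ continuous_const) fun x => by
      have := h x
      simp only; gcongr
  rw [int_const] at this
  refine (Real.sqrt_le_sqrt this).trans (le_of_eq ?_)
  rw [Real.sqrt_mul (by positivity), Real.sqrt_sq hB]

open Filter Topology in
/-- bounded in `L²` plus pointwise convergence gives convergence in `L¹` -/
lemma WK {ι E : Type*} [NormedAddCommGroup E] {N : ℕ} {l : Filter ι} [l.IsCountablyGenerated]
    {F : ι → V3 → E} {f : V3 → E} (hF : ∀ i, Continuous (F i)) (hf : Continuous f)
    (hlim : ∀ x, Tendsto (fun i => F i x) l (𝓝 (f x))) {B : ℝ}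
    (hB : ∀ᶠ i in l, ∫ x in cubeN N, ‖F i x‖ ^ 2 ≤ B) :
    Tendsto (fun i => ∫ x in cubeN N, ‖F i x - f x‖) l (𝓝 0) := by
  set B' : ℝ := 2 * |B| + 2 * (∫ x in cubeN N, ‖f x‖ ^ 2) + 1
  have hfp : 0 ≤ ∫ x in cubeN N, ‖f x‖ ^ 2 := integral_nonneg fun _ => sq_nonneg _
  have hB'pos : 0 < B' := by positivity
  have hB' : ∀ᶠ i in l, ∫ x in cubeN N, ‖F i x - f x‖ ^ 2 ≤ B' := by
    filter_upwards [hB] with i hi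
    have hFi := hF i
    have hle : ∫ x in cubeN N, ‖F i x - f x‖ ^ 2 ≤
        ∫ x in cubeN N, (2 * ‖F i x‖ ^ 2 + 2 * ‖f x‖ ^ 2) := by
      refine integral_mono (integ (by fun_prop)) (integ (by fun_prop)) fun x => ?_
      have := pow_le_pow_left₀ (norm_nonneg _) (norm_sub_le (F i x) (f x)) 2
      simp only
      nlinarith [sq_nonneg (‖F i x‖ - ‖f x‖)]
    rw [integral_add (integ (by fun_prop)) (integ (by fun_prop)), integral_const_mul,
      integral_const_mul] at hle
    have := le_abs_self B
    simp only [B']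
    linarith
  have hmin : ∀ R : ℝ, 0 < R →
      Tendsto (fun i => ∫ x in cubeN N, min ‖F i x - f x‖ R) l (𝓝 0) := by
    intro R hR
    have h := tendsto_integral_filter_of_dominated_convergence (μ := volume.restrict (cubeN N))
      (l := l) (F := fun i x => min ‖F i x - f x‖ R) (f := fun _ => (0:ℝ)) (fun _ => R)
      (Eventually.of_forall fun i => by
        have hFi := hF i
        exact Continuous.aestronglyMeasurable (by fun_prop))
      (Eventually.of_forall fun i => Eventually.of_forall fun x => by
        rw [Real.norm_of_nonneg (le_min (norm_nonneg _) hR.le)]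
        exact min_le_right _ _)
      (integ continuous_const)
      (Eventually.of_forall fun x => by
        have h1 : Tendsto (fun i => ‖F i x - f x‖) l (𝓝 0) :=
          tendsto_iff_norm_sub_tendsto_zero.mp (hlim x)
        have h2 := h1.min (tendsto_const_nhds (x := R))
        rwa [min_eq_left hR.le] at h2)
    simpa using h
  rw [Metric.tendsto_nhds]
  intro ε hε
  set R : ℝ := 2 * B' / ε
  have hR : 0 < R := by positivity
  have hm := (hmin R hR).eventually (gt_mem_nhds (half_pos hε))
  filter_upwards [hm, hB'] with i h1 h2
  have hFi := hF i
  rw [Real.dist_eq, sub_zero, abs_of_nonneg (integral_nonneg fun _ => norm_nonneg _)]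
  have hle : ∫ x in cubeN N, ‖F i x - f x‖ ≤
      ∫ x in cubeN N, (min ‖F i x - f x‖ R + R⁻¹ * ‖F i x - f x‖ ^ 2) := by
    refine integral_mono (integ (by fun_prop)) (integ (by fun_prop)) fun x => ?_
    simp only
    set h := ‖F i x - f x‖
    have hh : 0 ≤ h := norm_nonneg _
    rcases le_total h R with h' | h'
    · rw [min_eq_left h']
      have : 0 ≤ R⁻¹ * h ^ 2 := by positivity
      linarith
    · have : h ≤ R⁻¹ * h ^ 2 := by
        rw [inv_mul_eq_div, le_div_iff₀ hR]
        nlinarith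
      have : 0 ≤ min h R := le_min hh hR.le
      linarith
  rw [integral_add (integ (by fun_prop)) (integ (by fun_prop)), integral_const_mul] at hle
  have h3 : R⁻¹ * ∫ x in cubeN N, ‖F i x - f x‖ ^ 2 ≤ ε / 2 := by
    calc R⁻¹ * ∫ x in cubeN N, ‖F i x - f x‖ ^ 2 ≤ R⁻¹ * B' := by gcongr
      _ = ε / 2 := by simp only [R]; field_simp
  linarith

open Filter Topology in
lemma WKmul {ι 𝕜 : Type*} [RCLike 𝕜] {N : ℕ} {l : Filter ι} [l.IsCountablyGenerated]
    {F : ι → V3 → 𝕜} {f g : V3 → 𝕜} (hF : ∀ i, Continuous (F i)) (hf : Continuous f)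
    (hg : Continuous g)
    (hlim : ∀ x, Tendsto (fun i => F i x) l (𝓝 (f x))) {B : ℝ}
    (hB : ∀ᶠ i in l, ∫ x in cubeN N, ‖F i x‖ ^ 2 ≤ B) :
    Tendsto (fun i => ∫ x in cubeN N, g x * F i x) l (𝓝 (∫ x in cubeN N, g x * f x)) := by
  obtain ⟨G, hG⟩ := (isCompact_Icc (a := (fun _ : Fin 3 => (0:ℝ)))
    (b := (fun _ : Fin 3 => (N:ℝ)))).exists_bound_of_continuousOn hg.continuousOn
  have h := WK hF hf hlim hB
  rw [tendsto_iff_norm_sub_tendsto_zero]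
  refine squeeze_zero (fun _ => norm_nonneg _) (fun i => ?_) (by simpa using h.const_mul G)
  have hFi := hF i
  rw [← integral_sub (integ (by fun_prop)) (integ (by fun_prop)), ← integral_const_mul]
  refine (norm_integral_le_integral_norm _).trans ?_
  refine setIntegral_mono_on (integ (by fun_prop)) (integ (by fun_prop)) (measSet_cube N) ?_
  intro x hx
  rw [← mul_sub, norm_mul]
  gcongr
  exact hG x (cube_sub N hx)

/-- Baire portion lemma -/
lemma baire_portion {K : Set ℝ} (hK : IsClosed K) (hne : K.Nonempty) (C : ℕ → Set ℝ)
    (hC : ∀ n, IsClosed (C n)) (hcov : ∀ t, ∃ n, t ∈ C n) :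
    ∃ n, ∃ κ ∈ K, ∃ δ > 0, ∀ t ∈ K, |t - κ| < δ → t ∈ C n := by
  have : Nonempty K := hne.to_subtype
  have : CompleteSpace K := hK.completeSpace_coe
  obtain ⟨n, x, hx⟩ := nonempty_interior_of_iUnion_of_closed
    (f := fun n => (Subtype.val : K → ℝ) ⁻¹' C n) (fun n => (hC n).preimage continuous_subtype_val)
    (by
      ext t
      simp only [Set.mem_iUnion, Set.mem_preimage, Set.mem_univ, iff_true]
      exact hcov t)
  rw [mem_interior_iff_mem_nhds, Metric.mem_nhds_iff] at hx
  obtain ⟨δ, hδ, hb⟩ := hx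
  refine ⟨n, x, x.2, δ, hδ, fun t ht htx => ?_⟩
  exact hb (show (⟨t, ht⟩ : K) ∈ Metric.ball x δ from by
    rw [Metric.mem_ball, Subtype.dist_eq, Real.dist_eq]; exact htx)

/-- last point of a closed set before `t` -/
lemma last_pt {K : Set ℝ} (hK : IsClosed K) {κ t : ℝ} (hκ : κ ∈ K) (h : κ ≤ t) :
    ∃ a ∈ K, κ ≤ a ∧ a ≤ t ∧ ∀ s ∈ K, s ≤ t → s ≤ a := by
  have hc : IsCompact (K ∩ Set.Icc κ t) := isCompact_Icc.inter_left hK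
  obtain ⟨a, ha, hm⟩ := hc.exists_isGreatest ⟨κ, hκ, le_refl _, h⟩
  refine ⟨a, ha.1, ha.2.1, ha.2.2, fun s hs hst => ?_⟩
  rcases le_total κ s with h1 | h1
  · exact hm ⟨hs, h1, hst⟩
  · exact h1.trans ha.2.1

lemma first_pt {K : Set ℝ} (hK : IsClosed K) {κ t : ℝ} (hκ : κ ∈ K) (h : t ≤ κ) :
    ∃ a ∈ K, a ≤ κ ∧ t ≤ a ∧ ∀ s ∈ K, t ≤ s → a ≤ s := by
  have hc : IsCompact (K ∩ Set.Icc t κ) := isCompact_Icc.inter_left hK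
  obtain ⟨a, ha, hm⟩ := hc.exists_isLeast ⟨κ, hκ, h, le_refl _⟩
  refine ⟨a, ha.1, ha.2.2, ha.2.1, fun s hs hst => ?_⟩
  rcases le_total s κ with h1 | h1
  · exact hm ⟨hs, hst, h1⟩
  · exact ha.2.2.trans h1

/-- a differential inequality -/
lemma sqrt_lip {Y Y' : ℝ → ℝ} {a b A : ℝ} (hab : a < b) (hc : ContinuousOn Y (Set.Icc a b))
    (h0 : ∀ t, 0 ≤ Y t) (hA : 0 ≤ A) (hd : ∀ t ∈ Set.Ioo a b, HasDerivAt Y (Y' t) t)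
    (hY' : ∀ t ∈ Set.Ioo a b, |Y' t| ≤ 2 * A * √(Y t)) :
    |√(Y b) - √(Y a)| ≤ A * (b - a) := by
  have key : ∀ ε : ℝ, 0 < ε → |√(Y b + ε) - √(Y a + ε)| ≤ A * (b - a) := by
    intro ε hε
    have hp : ∀ t, 0 < Y t + ε := fun t => by have := h0 t; linarith
    have hd2 : ∀ t ∈ Set.Ioo a b, HasDerivAt (fun t => √(Y t + ε))
        (Y' t / (2 * √(Y t + ε))) t := fun t ht =>
      ((hd t ht).add_const ε).sqrt (hp t).ne'
    have hc2 : ContinuousOn (fun t => √(Y t + ε)) (Set.Icc a b) :=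
      Real.continuous_sqrt.comp_continuousOn (hc.add continuousOn_const)
    obtain ⟨c, hcm, hce⟩ := exists_hasDerivAt_eq_slope _ _ hab hc2 hd2
    have hba : 0 < b - a := by linarith
    rw [eq_div_iff hba.ne'] at hce
    rw [← hce, abs_mul, abs_of_pos hba]
    gcongr
    have hs := Real.sqrt_pos.mpr (hp c)
    rw [abs_div, abs_of_pos (by positivity : 0 < 2 * √(Y c + ε)), div_le_iff₀ (by positivity)]
    refine (hY' c hcm).trans ?_
    have : √(Y c) ≤ √(Y c + ε) := Real.sqrt_le_sqrt (by linarith)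
    nlinarith [mul_le_mul_of_nonneg_left this hA]
  have hlim : Filter.Tendsto (fun ε : ℝ => |√(Y b + ε) - √(Y a + ε)|) (nhdsWithin 0 (Set.Ioi 0))
      (nhds |√(Y b + 0) - √(Y a + 0)|) := by
    have : Continuous (fun ε : ℝ => |√(Y b + ε) - √(Y a + ε)|) := by fun_prop
    exact (this.tendsto 0).mono_left nhdsWithin_le_nhds
  rw [add_zero, add_zero] at hlim
  refine le_of_tendsto hlim ?_
  filter_upwards [self_mem_nhdsWithin] with ε hε using key ε hε

/-! ### Part 5: the chain lemma -/

lemma chain {N : ℕ} {f f' : V3 → ℝ → ℂ} (hfx : ∀ t, Continuous fun x => f x t)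
    (hft : ∀ x t, HasDerivAt (f x) (f' x t) t) {K : Set ℝ} (hK : IsClosed K)
    {a b n C h : ℝ} (hC : 0 ≤ C) (hn : 0 ≤ n) (hh : 0 < h)
    (hbd : ∀ τ ∈ K, a ≤ τ → τ ≤ b → ∀ x, ‖f' x τ‖ ≤ n)
    (hgap : ∀ p ∈ K, ∀ u ∈ K, a ≤ p → p < u → u ≤ b → (∀ s ∈ Set.Ioo p u, s ∉ K) →
      l2 N (fun x => f x u - f x p) ≤ C * (u - p)) (m : ℕ) :
    ∀ κ ∈ K, ∀ κ' ∈ K, a ≤ κ → κ ≤ κ' → κ' ≤ b → κ' - κ ≤ m * h →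
      ∃ G : V3 → ℂ, Continuous G ∧ l2 N G ≤ C * (κ' - κ) ∧ ∀ x, ∀ ε : ℝ, 0 ≤ ε →
        (∀ τ ∈ Set.Icc a b, ∀ τ' ∈ Set.Icc a b, |τ - τ'| ≤ h → ‖f' x τ - f' x τ'‖ ≤ ε) →
        ‖f x κ' - f x κ - G x‖ ≤ (n + ε) * (κ' - κ) := by
  have mvt : ∀ κ ∈ K, ∀ p, a ≤ κ → κ ≤ p → p ≤ b → p ≤ κ + h → ∀ x, ∀ ε : ℝ, 0 ≤ ε →
      (∀ τ ∈ Set.Icc a b, ∀ τ' ∈ Set.Icc a b, |τ - τ'| ≤ h → ‖f' x τ - f' x τ'‖ ≤ ε) →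
      ‖f x p - f x κ‖ ≤ (n + ε) * (p - κ) := by
    intro κ hκ p h1 h2 h3 h4 x ε hε hmod
    have := Convex.norm_image_sub_le_of_norm_hasDerivWithin_le (f := f x) (f' := f' x)
      (s := Set.Icc κ p) (x := κ) (y := p) (C := n + ε)
      (fun t _ => (hft x t).hasDerivWithinAt) (fun t ht => ?_) (convex_Icc κ p)
      ⟨le_refl _, h2⟩ ⟨h2, le_refl _⟩
    · rwa [Real.norm_of_nonneg (by linarith)] at this
    · have e1 := hmod t ⟨h1.trans ht.1, ht.2.trans h3⟩ κ ⟨h1, h2.trans h3⟩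
        (by rw [abs_of_nonneg (by linarith [ht.1])]; linarith [ht.2])
      have e2 := hbd κ hκ h1 (h2.trans h3) x
      calc ‖f' x t‖ = ‖f' x κ + (f' x t - f' x κ)‖ := by rw [add_sub_cancel]
        _ ≤ _ := norm_add_le _ _
        _ ≤ n + ε := add_le_add e2 e1
  induction m with
  | zero =>
    intro κ _ κ' _ _ h2 _ h4
    have : κ' = κ := by
      simp at h4; linarith
    subst this
    refine ⟨fun _ => 0, continuous_const, by rw [l2_zero]; simp, fun x ε _ _ => by simp⟩
  | succ m ih =>
    intro κ hκ κ' hκ' h1 h2 h3 h4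
    rcases le_or_gt κ' (κ + h) with hle | hlt
    · refine ⟨fun _ => 0, continuous_const, ?_, fun x ε hε hmod => ?_⟩
      · rw [l2_zero]
        exact mul_nonneg hC (by linarith)
      · rw [sub_zero]
        exact mvt κ hκ κ' h1 h2 h3 hle x ε hε hmod
    obtain ⟨p, hpK, hp1, hp2, hp3⟩ := last_pt hK hκ (show κ ≤ κ + h by linarith)
    obtain ⟨u, huK, hu1, hu2, hu3⟩ := first_pt hK hκ' hlt.le
    obtain ⟨G, hGc, hG2, hGe⟩ := ih u huK κ' hκ' (by linarith) hu1 h3 (by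
      push_cast at h4; linarith)
    refine ⟨fun x => G x + (f x u - f x p), hGc.add ((hfx u).sub (hfx p)), ?_, ?_⟩
    · have hg : l2 N (fun x => f x u - f x p) ≤ C * (u - p) := by
        rcases eq_or_lt_of_le (hp2.trans hu2) with he | hl
        · subst he
          simp only [sub_self, mul_zero]
          rw [l2_zero]
        · refine hgap p hpK u huK (by linarith) hl (by linarith) fun s hs hsK => ?_
          rcases le_total s (κ + h) with h5 | h5
          · exact absurd (hp3 s hsK h5) (not_le.mpr hs.1)
          · exact absurd (hu3 s hsK h5) (not_le.mpr hs.2)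
      have := l2_add (N := N) (g := fun x => f x u - f x p) hGc ((hfx u).sub (hfx p))
      have h6 : C * (p - κ) ≥ 0 := mul_nonneg hC (by linarith)
      have h7 : C * (κ' - κ) = C * (κ' - u) + C * (u - p) + C * (p - κ) := by ring
      rw [h7]
      linarith
    · intro x ε hε hmod
      have e1 := hGe x ε hε hmod
      have e2 := mvt κ hκ p h1 hp1 (by linarith) hp2 x ε hε hmod
      have e3 : f x κ' - f x κ - (G x + (f x u - f x p)) =
        (f x κ' - f x u - G x) + (f x p - f x κ) := by ring
      simp only
      rw [e3]
      refine (norm_add_le _ _).trans ?_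
      have h7 : 0 ≤ (n + ε) * (u - p) := mul_nonneg (by linarith) (by linarith)
      have h8 : (n + ε) * (κ' - κ) = (n + ε) * (κ' - u) + (n + ε) * (u - p) + (n + ε) * (p - κ) := by
        ring
      rw [h8]
      linarith

lemma chain_l2 {N : ℕ} {f f' : V3 → ℝ → ℂ} (hfx : ∀ t, Continuous fun x => f x t)
    (hfx' : ∀ t, Continuous fun x => f' x t) (hfc' : ∀ x, Continuous (f' x))
    (hft : ∀ x t, HasDerivAt (f x) (f' x t) t) {K : Set ℝ} (hK : IsClosed K)
    {a b n C : ℝ} (hC : 0 ≤ C) (hn : 0 ≤ n) (ha : a ∈ K) (hb : b ∈ K) (hab : a ≤ b)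
    (hbd : ∀ τ ∈ K, a ≤ τ → τ ≤ b → ∀ x, ‖f' x τ‖ ≤ n)
    (hgap : ∀ p ∈ K, ∀ u ∈ K, a ≤ p → p < u → u ≤ b → (∀ s ∈ Set.Ioo p u, s ∉ K) →
      l2 N (fun x => f x u - f x p) ≤ C * (u - p)) :
    ∫ x in cubeN N, ‖f x b - f x a‖ ^ 2 ≤
      (2 * C ^ 2 + 2 * (n + 1) ^ 2 * (N:ℝ)^3) * (b - a) ^ 2 := by
  let A : ℕ → Set V3 := fun j => {x | ∀ τ ∈ Set.Icc a b, ∀ τ' ∈ Set.Icc a b,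
    |τ - τ'| ≤ 1 / ((j:ℝ) + 1) → ‖f' x τ - f' x τ'‖ ≤ 1}
  have hAc : ∀ j, IsClosed (A j) := by
    intro j
    simp only [A, Set.setOf_forall]
    refine isClosed_iInter fun τ => isClosed_iInter fun _ => isClosed_iInter fun τ' =>
      isClosed_iInter fun _ => isClosed_iInter fun _ => ?_
    exact isClosed_le ((hfx' τ).sub (hfx' τ')).norm continuous_const
  have hAm : Monotone A := by
    intro i j hij x hx τ hτ τ' hτ' hle
    refine hx τ hτ τ' hτ' (hle.trans ?_)
    have : (i:ℝ) ≤ j := by exact_mod_cast hij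
    gcongr
  have hAu : ⋃ j, A j = Set.univ := by
    refine Set.eq_univ_of_forall fun x => ?_
    have huc := isCompact_Icc.uniformContinuousOn_of_continuous (hfc' x).continuousOn
      (s := Set.Icc a b)
    rw [Metric.uniformContinuousOn_iff_le] at huc
    obtain ⟨δ, hδ, hh⟩ := huc 1 one_pos
    obtain ⟨j, hj⟩ := exists_nat_one_div_lt hδ
    refine Set.mem_iUnion.mpr ⟨j, fun τ hτ τ' hτ' hle => ?_⟩
    have := hh τ hτ τ' hτ' (by rw [Real.dist_eq]; exact hle.trans hj.le)
    rwa [dist_eq_norm] at this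
  have hDc : Continuous fun x => ‖f x b - f x a‖ ^ 2 := by
    have h1 := hfx a; have h2 := hfx b
    fun_prop
  have hlim := tendsto_setIntegral_of_monotone (μ := volume.restrict (cubeN N))
    (f := fun x => ‖f x b - f x a‖ ^ 2) (s := A) (fun j => (hAc j).measurableSet) hAm
    (integ hDc).integrableOn
  rw [hAu, setIntegral_univ] at hlim
  refine le_of_tendsto hlim (Filter.Eventually.of_forall fun j => ?_)
  have hj : (0:ℝ) < 1 / ((j:ℝ) + 1) := by positivity
  obtain ⟨m, hm⟩ := exists_nat_ge ((b - a) / (1 / ((j:ℝ) + 1)))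
  rw [div_le_iff₀ hj] at hm
  obtain ⟨G, hGc, hG2, hGe⟩ := chain hfx hft hK hC hn hj hbd hgap m a ha b hb le_rfl hab le_rfl hm
  have hint : Integrable (fun x => 2 * ‖G x‖ ^ 2 + 2 * ((n + 1) * (b - a)) ^ 2)
    (volume.restrict (cubeN N)) := integ (by fun_prop)
  calc ∫ x in A j, ‖f x b - f x a‖ ^ 2 ∂(volume.restrict (cubeN N))
      ≤ ∫ x in A j, (2 * ‖G x‖ ^ 2 + 2 * ((n + 1) * (b - a)) ^ 2) ∂(volume.restrict (cubeN N)) := by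
        refine setIntegral_mono_on (integ hDc).integrableOn hint.integrableOn
          (hAc j).measurableSet fun x hx => ?_
        have h1 := hGe x 1 zero_le_one hx
        have h2 : ‖f x b - f x a‖ ≤ ‖G x‖ + (n + 1) * (b - a) := by
          calc ‖f x b - f x a‖ = ‖G x + (f x b - f x a - G x)‖ := by rw [add_sub_cancel]
            _ ≤ _ := (norm_add_le _ _).trans (by gcongr)
        have h3 := pow_le_pow_left₀ (norm_nonneg _) h2 2
        nlinarith [sq_nonneg (‖G x‖ - (n + 1) * (b - a))]
    _ ≤ ∫ x in cubeN N, (2 * ‖G x‖ ^ 2 + 2 * ((n + 1) * (b - a)) ^ 2) :=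
        setIntegral_le_integral hint (Filter.Eventually.of_forall fun x => by positivity)
    _ = 2 * l2 N G ^ 2 + (N:ℝ)^3 * (2 * ((n + 1) * (b - a)) ^ 2) := by
        rw [integral_add (integ (by fun_prop)) (integ (by fun_prop)), integral_const_mul,
          int_const, l2_sq]
    _ ≤ 2 * (C * (b - a)) ^ 2 + (N:ℝ)^3 * (2 * ((n + 1) * (b - a)) ^ 2) := by
        have := l2_nonneg N G
        gcongr
    _ = _ := by ring

/-! ### Part 6: basic facts about the system -/

/-- The standing assumptions. -/
structure Ctx (N : ℕ) (σ : V3 → ℝ) (e M : ℝ)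
    (ψ : V3 → ℝ → ℂ) (Φ : V3 → ℝ → ℝ) (q : ℝ → GammaIdx N → V3) : Prop where
  hN : 0 < N
  he : 0 < e
  hM : 0 < M
  hper : IsPerN N σ
  hreg : ContDiff ℝ 2 σ
  hsol : IsSPN N σ e M ψ Φ q

section CtxLemmas

open Filter Topology

variable {N : ℕ} {σ : V3 → ℝ} {e M : ℝ} {ψ : V3 → ℝ → ℂ} {Φ : V3 → ℝ → ℝ}
  {q : ℝ → GammaIdx N → V3}

/-- Time derivative of `ψ`. -/
def wv (ψ : V3 → ℝ → ℂ) (x : V3) (t : ℝ) : ℂ := deriv (fun s => ψ x s) t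

lemma psi_c (H : Ctx N σ e M ψ Φ q) (t : ℝ) : Continuous fun x => ψ x t :=
  (H.hsol.regx_psi t).continuous

lemma Phi_c (H : Ctx N σ e M ψ Φ q) (t : ℝ) : Continuous fun x => Φ x t :=
  (H.hsol.regx_Phi t).continuous

lemma psi_ct (H : Ctx N σ e M ψ Φ q) (x : V3) : Continuous (ψ x) :=
  (H.hsol.regt_psi x).continuous

lemma Phi_ct (H : Ctx N σ e M ψ Φ q) (x : V3) : Continuous (Φ x) :=
  (H.hsol.regt_Phi x).continuous

lemma psi_hd (H : Ctx N σ e M ψ Φ q) (x : V3) (t : ℝ) : HasDerivAt (ψ x) (wv ψ x t) t :=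
  ((H.hsol.regt_psi x).differentiable one_ne_zero t).hasDerivAt

lemma w_eq (H : Ctx N σ e M ψ Φ q) (x : V3) (t : ℝ) :
    wv ψ x t = Complex.I / 2 * lapC (fun y => ψ y t) x
      + Complex.I * (e:ℂ) * (Φ x t : ℂ) * ψ x t := by
  have h := H.hsol.schrodinger x t
  have h2 : wv ψ x t = -Complex.I * (Complex.I * wv ψ x t) := by
    rw [← mul_assoc, neg_mul, Complex.I_mul_I]; ring
  rw [h2, wv, h]
  ring

lemma w_ct (H : Ctx N σ e M ψ Φ q) (x : V3) : Continuous (wv ψ x) :=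
  (H.hsol.regt_psi x).continuous_deriv le_rfl

lemma w_c (H : Ctx N σ e M ψ Φ q) (t : ℝ) : Continuous fun x => wv ψ x t := by
  have h : (fun x => wv ψ x t) = fun x => Complex.I / 2 * lapC (fun y => ψ y t) x
      + Complex.I * (e:ℂ) * (Φ x t : ℂ) * ψ x t := funext fun x => w_eq H x t
  rw [h]
  have h1 := lapC_cont (H.hsol.regx_psi t)
  have h2 := psi_c H t
  have h3 := Phi_c H t
  fun_prop

lemma w_per (H : Ctx N σ e M ψ Φ q) (t : ℝ) : IsPerN N fun x => wv ψ x t := by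
  intro x k
  simp only [wv]
  congr 1
  funext s
  exact H.hsol.per_psi s x k

/-- The charge density at time `t`. -/
def rh (N : ℕ) (σ : V3 → ℝ) (e : ℝ) (ψ : V3 → ℝ → ℂ) (q : ℝ → GammaIdx N → V3)
    (t : ℝ) (x : V3) : ℝ := rhoT N σ e (fun y => ψ y t) (q t) x

lemma rh_eq (t : ℝ) (x : V3) : rh N σ e ψ q t x =
    (∑ n : GammaIdx N, σ (x - embG n - q t n)) - e * ‖ψ x t‖ ^ 2 := by
  rw [rh, rhoT, Complex.normSq_eq_norm_sq]

lemma lap_rh (H : Ctx N σ e M ψ Φ q) (t : ℝ) :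
    lapR (fun y => Φ y t) = fun x => - rh N σ e ψ q t x := by
  funext x
  have := H.hsol.poisson x t
  rw [rh, rhoT]
  linarith

lemma rh_c (H : Ctx N σ e M ψ Φ q) (t : ℝ) : Continuous (rh N σ e ψ q t) := by
  have h : rh N σ e ψ q t = fun x => - lapR (fun y => Φ y t) x := by
    rw [lap_rh H]; simp
  rw [h]
  exact (lapR_cont (H.hsol.regx_Phi t)).neg

lemma rh_int (H : Ctx N σ e M ψ Φ q) (t : ℝ) : ∫ x in cubeN N, rh N σ e ψ q t x = 0 := by
  have h := lapR_int_zero (H.hsol.regx_Phi t) (H.hsol.per_Phi t)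
  rw [lap_rh H, integral_neg] at h
  linarith

lemma shift_per (hp : IsPerN N σ) (v : V3) : IsPerN N (fun x => σ (x - v)) := by
  intro x k
  have := hp (x - v) k
  simp only
  rw [← this]
  congr 1
  abel

lemma path_deriv (hN : 0 < N) (hp : IsPerN N σ) (hs : ContDiff ℝ 1 σ) {g : V3 → ℝ}
    (hg : Continuous g) {r : ℝ → V3} (hr : ContDiff ℝ 1 r) (t : ℝ) :
    HasDerivAt (fun s => ∫ x in cubeN N, g x * σ (x - r s))
      (- ∫ x in cubeN N, g x * fderiv ℝ σ (x - r t) (deriv r t)) t := by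
  have hfc : Continuous (fderiv ℝ σ) := hs.continuous_fderiv one_ne_zero
  have hfp : IsPerN N (fderiv ℝ σ) := by
    intro x k
    ext v
    exact per_fderiv hp v x k
  obtain ⟨C, hC0, hC⟩ := per_bdd hN hfc hfp
  have hrc : Continuous (deriv r) := hr.continuous_deriv le_rfl
  have hnb : {s | ‖deriv r s‖ < ‖deriv r t‖ + 1} ∈ 𝓝 t :=
    (isOpen_lt hrc.norm continuous_const).mem_nhds (by simp)
  have hrd : ∀ s, HasDerivAt r (deriv r s) s := fun s =>
    (hr.differentiable one_ne_zero s).hasDerivAt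
  have hsc := hs.continuous
  have hrc0 := hr.continuous
  have key := hasDerivAt_integral_of_dominated_loc_of_deriv_le
    (μ := volume.restrict (cubeN N)) (F := fun s x => g x * σ (x - r s))
    (F' := fun s x => - (g x * fderiv ℝ σ (x - r s) (deriv r s)))
    (bound := fun x => |g x| * (C * (‖deriv r t‖ + 1))) (x₀ := t) hnb ?_ ?_ ?_ ?_ ?_ ?_
  · have := key.2
    rwa [integral_neg] at this
  · exact Eventually.of_forall fun s => (integ (by fun_prop)).aestronglyMeasurable
  · exact integ (by fun_prop)
  · exact (integ (by fun_prop)).aestronglyMeasurable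
  · refine Eventually.of_forall fun x s hs => ?_
    rw [norm_neg, norm_mul, Real.norm_eq_abs]
    have h1 := (fderiv ℝ σ (x - r s)).le_opNorm (deriv r s)
    have h2 : ‖deriv r s‖ ≤ ‖deriv r t‖ + 1 := le_of_lt hs
    have h3 := hC (x - r s)
    gcongr
    refine h1.trans ?_
    gcongr
  · exact integ (by fun_prop)
  · refine Eventually.of_forall fun x s _ => ?_
    have h1 : HasDerivAt (fun s => x - r s) (- deriv r s) s := by
      simpa using (hrd s).const_sub x
    have h2 := ((hs.differentiable one_ne_zero (x - r s)).hasFDerivAt).comp_hasDerivAt s h1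
    have h3 := h2.const_mul (g x)
    simpa using h3

lemma fderiv_sum (f : V3 → ℝ) (x v : V3) :
    fderiv ℝ f x v = ∑ i, v i * fderiv ℝ f x (Pi.single i 1) := by
  conv_lhs => rw [← Finset.univ_sum_single v]
  rw [map_sum]
  refine Finset.sum_congr rfl fun i _ => ?_
  have : (Pi.single i (v i) : V3) = v i • Pi.single i (1:ℝ) := by
    rw [← Pi.single_smul]; simp
  rw [this, map_smul, smul_eq_mul]

lemma shift_int (hN : 0 < N) (hp : IsPerN N σ) (hs : ContDiff ℝ 1 σ) (v : V3) :
    ∫ x in cubeN N, σ (x - v) = ∫ x in cubeN N, σ x := by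
  have hd : ∀ t : ℝ, HasDerivAt (fun s : ℝ => ∫ x in cubeN N, 1 * σ (x - s • v)) 0 t := by
    intro t
    have h := path_deriv hN hp hs (g := fun _ => 1) continuous_const (r := fun s : ℝ => s • v)
      (by fun_prop) t
    convert h using 1
    rw [eq_comm, neg_eq_zero]
    set u := deriv (fun s : ℝ => s • v) t
    have hc : ContDiff ℝ 1 (fun x => σ (x - t • v)) := hs.comp (by fun_prop)
    have h2 : ∀ x, (1:ℝ) * fderiv ℝ σ (x - t • v) u =
        ∑ i, u i * fderiv ℝ (fun y => σ (y - t • v)) x (Pi.single i 1) := by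
      intro x
      rw [one_mul, ← fderiv_sum, fderiv_comp_sub]
    simp_rw [h2]
    rw [integral_finsetSum _ fun i _ => integ ((cont_fderiv hc _).const_mul _)]
    refine Finset.sum_eq_zero fun i _ => ?_
    rw [integral_const_mul, int_fderiv_zero hc (shift_per hp _) i, mul_zero]
  have := is_const_of_deriv_eq_zero (fun t => (hd t).differentiableAt) (fun t => (hd t).deriv) 1 0
  simpa using this

lemma charge (H : Ctx N σ e M ψ Φ q) (t : ℝ) :
    ∫ x in cubeN N, ‖ψ x t‖ ^ 2 = ∫ x in cubeN N, ‖ψ x 0‖ ^ 2 := by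
  have hs := H.hreg.continuous
  have key : ∀ t, e * ∫ x in cubeN N, ‖ψ x t‖ ^ 2 = ∑ _n : GammaIdx N, ∫ x in cubeN N, σ x := by
    intro t
    have h := rh_int H t
    simp_rw [rh_eq] at h
    have hp := psi_c H t
    rw [integral_sub (integ (by fun_prop)) (integ (by fun_prop)),
      integral_finsetSum _ fun i _ => integ (by fun_prop), integral_const_mul] at h
    have h2 : ∀ n : GammaIdx N, ∫ x in cubeN N, σ (x - embG n - q t n) = ∫ x in cubeN N, σ x := by
      intro n
      rw [← shift_int H.hN H.hper (H.hreg.of_le one_le_two) (embG n + q t n)]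
      simp_rw [sub_sub]
    simp_rw [h2] at h
    linarith
  have h1 := (key t).trans (key 0).symm
  exact mul_left_cancel₀ H.he.ne' h1

lemma rho_L1 (H : Ctx N σ e M ψ Φ q) : ∃ R : ℝ, 0 ≤ R ∧ ∀ t,
    ∫ x in cubeN N, |rh N σ e ψ q t x| ≤ R := by
  obtain ⟨C, hC0, hC⟩ := per_bdd H.hN H.hreg.continuous H.hper
  refine ⟨(N:ℝ)^3 * (Fintype.card (GammaIdx N) * C) + e * ∫ x in cubeN N, ‖ψ x 0‖ ^ 2, ?_, ?_⟩
  · have := H.he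
    have : 0 ≤ ∫ x in cubeN N, ‖ψ x 0‖ ^ 2 := integral_nonneg fun x => by positivity
    positivity
  · intro t
    have hp := psi_c H t
    have hr := rh_c H t
    rw [← charge H t, ← int_const, ← integral_const_mul, ← integral_add (integ (by fun_prop))
      (integ (by fun_prop))]
    refine integral_mono (integ (by fun_prop)) (integ (by fun_prop)) fun x => ?_
    simp only
    rw [rh_eq]
    refine (abs_sub _ _).trans ?_
    have he := H.he
    rw [abs_of_nonneg (show 0 ≤ e * ‖ψ x t‖ ^ 2 by positivity)]
    gcongr
    refine (Finset.abs_sum_le_sum_abs _ _).trans ?_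
    refine (Finset.sum_le_sum fun n _ => hC (x - embG n - q t n)).trans ?_
    simp

lemma Phi0_L2 (H : Ctx N σ e M ψ Φ q) : ∃ P : ℝ, 0 ≤ P ∧ ∀ t,
    ∫ x in cubeN N, (Φ x t - mn N (fun y => Φ y t)) ^ 2 ≤ P := by
  obtain ⟨R, hR0, hR⟩ := rho_L1 H
  obtain ⟨C, hC0, hC⟩ := poisson_L2 H.hN
  refine ⟨C * R ^ 2, by positivity, fun t => ?_⟩
  refine (hC _ (H.hsol.regx_Phi t) (H.hsol.per_Phi t)).trans ?_
  rw [lap_rh H]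
  simp only [abs_neg]
  have h0 : 0 ≤ ∫ x in cubeN N, |rh N σ e ψ q t x| := integral_nonneg fun x => abs_nonneg _
  have := hR t
  gcongr

lemma Phi_L2 (H : Ctx N σ e M ψ Φ q) (a b : ℝ) : ∃ P : ℝ, 0 ≤ P ∧ ∀ t ∈ Set.Icc a b,
    ∫ x in cubeN N, (Φ x t) ^ 2 ≤ P := by
  obtain ⟨P, hP0, hP⟩ := Phi0_L2 H
  let A : ℕ → Set V3 := fun n => {x | ∀ t ∈ Set.Icc a b, |Φ x t| ≤ n}
  have hAc : ∀ n, IsClosed (A n) := by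
    intro n
    have : A n = ⋂ t ∈ Set.Icc a b, {x | |Φ x t| ≤ n} := by
      ext x; simp [A]
    rw [this]
    exact isClosed_biInter fun t _ => isClosed_le (Phi_c H t).abs continuous_const
  have hAu : ⋃ n, A n = Set.univ := by
    refine Set.eq_univ_of_forall fun x => ?_
    obtain ⟨B, hB⟩ := isCompact_Icc.exists_bound_of_continuousOn (s := Set.Icc a b)
      (Phi_ct H x).continuousOn
    obtain ⟨n, hn⟩ := exists_nat_ge B
    exact Set.mem_iUnion.mpr ⟨n, fun t ht => (hB t ht).trans hn⟩
  have hex : ∃ n, (volume.restrict (cubeN N)) (A n) ≠ 0 := by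
    by_contra hcon
    push Not at hcon
    have h1 := measure_iUnion_null (μ := volume.restrict (cubeN N)) hcon
    rw [hAu, Measure.restrict_apply_univ, vol_cube] at h1
    have := H.hN
    simp at h1
    omega
  obtain ⟨n, hn⟩ := hex
  set μ := volume.restrict (cubeN N) with hμ
  have hm : 0 < μ.real (A n) := ENNReal.toReal_pos hn (measure_ne_top _ _)
  have hmb : ∀ t ∈ Set.Icc a b, mn N (fun y => Φ y t) ^ 2 ≤ 2 * n ^ 2 + 2 * P / μ.real (A n) := by
    intro t ht
    set m := mn N (fun y => Φ y t) with hmdef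
    have hc := Phi_c H t
    have hi : Integrable (fun x => 2 * (Φ x t - m) ^ 2) μ := integ (by fun_prop)
    have h1 : ∫ x in A n, m ^ 2 ∂μ ≤ ∫ x in A n, (2 * (n:ℝ) ^ 2 + 2 * (Φ x t - m) ^ 2) ∂μ := by
      refine setIntegral_mono_on (integrable_const _).integrableOn
        ((integrable_const _).add hi).integrableOn (hAc n).measurableSet fun x hx => ?_
      have h2 := hx t ht
      have h3 : (Φ x t) ^ 2 ≤ (n:ℝ) ^ 2 := by
        rw [← sq_abs]
        gcongr
      nlinarith [sq_nonneg (Φ x t + (Φ x t - m))]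
    rw [integral_add (integrable_const _).integrableOn hi.integrableOn, setIntegral_const,
      setIntegral_const, smul_eq_mul, smul_eq_mul] at h1
    have h2 : ∫ x in A n, 2 * (Φ x t - m) ^ 2 ∂μ ≤ 2 * P := by
      refine (setIntegral_le_integral hi (Eventually.of_forall fun x => by positivity)).trans ?_
      rw [integral_const_mul]
      have := hP t
      linarith
    rw [← sub_le_iff_le_add', le_div_iff₀ hm]
    nlinarith
  refine ⟨2 * P + (N:ℝ)^3 * (2 * (2 * n ^ 2 + 2 * P / μ.real (A n))), by positivity,
    fun t ht => ?_⟩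
  set m := mn N (fun y => Φ y t) with hmdef
  have hc := Phi_c H t
  calc ∫ x in cubeN N, (Φ x t) ^ 2 ≤ ∫ x in cubeN N, (2 * (Φ x t - m) ^ 2 + 2 * m ^ 2) := by
        refine integral_mono (integ (by fun_prop)) (integ (by fun_prop)) fun x => ?_
        simp only
        nlinarith [sq_nonneg (Φ x t - m - m)]
    _ = 2 * (∫ x in cubeN N, (Φ x t - m) ^ 2) + (N:ℝ)^3 * (2 * m ^ 2) := by
        rw [integral_add (integ (by fun_prop)) (integ (by fun_prop)), integral_const_mul,
          int_const]
    _ ≤ _ := by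
        have h1 := hP t
        have h2 := hmb t ht
        gcongr

end CtxLemmas

/-! ### Part 7: Lipschitz continuity in `L²` -/

section PLSec

open Filter Topology

variable {N : ℕ} {σ : V3 → ℝ} {e M : ℝ} {ψ : V3 → ℝ → ℂ} {Φ : V3 → ℝ → ℝ}
  {q : ℝ → GammaIdx N → V3}

/-- Pointwise Lipschitz property at time `s`. -/
def PL (N : ℕ) (ψ : V3 → ℝ → ℂ) (s : ℝ) : Prop :=
  ∃ C : ℝ, ∀ᶠ t in 𝓝 s, ∫ x in cubeN N, ‖ψ x t - ψ x s‖ ^ 2 ≤ C * (t - s) ^ 2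

lemma weak_deriv (H : Ctx N σ e M ψ Φ q) {s : ℝ} (hs : PL N ψ s) {g : V3 → ℂ}
    (hg : Continuous g) :
    HasDerivAt (fun t => ∫ x in cubeN N, g x * ψ x t) (∫ x in cubeN N, g x * wv ψ x s) s := by
  rw [hasDerivAt_iff_tendsto_slope]
  obtain ⟨C, hC⟩ := hs
  have hD : ∀ t, Continuous fun x => (((t - s)⁻¹ : ℝ) : ℂ) * (ψ x t - ψ x s) := by
    intro t
    have h1 := psi_c H t
    have h2 := psi_c H s
    fun_prop
  have key := WKmul (N := N) (l := 𝓝[≠] s)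
    (F := fun t x => (((t - s)⁻¹ : ℝ) : ℂ) * (ψ x t - ψ x s)) (f := fun x => wv ψ x s) (g := g)
    hD (w_c H s) hg (B := C) ?_ ?_
  · refine key.congr fun t => ?_
    rw [slope_def_module]
    have h1 := psi_c H t
    have h2 := psi_c H s
    rw [← integral_sub (integ (by fun_prop)) (integ (by fun_prop)), ← integral_smul]
    congr 1
    funext x
    rw [Complex.real_smul]
    push_cast
    ring
  · intro x
    have h := hasDerivAt_iff_tendsto_slope.mp (psi_hd H x s)
    refine h.congr fun t => ?_
    rw [slope_def_module, Complex.real_smul]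
  · have h1 : ∀ᶠ t in 𝓝[≠] s, t ≠ s := eventually_mem_nhdsWithin
    filter_upwards [hC.filter_mono nhdsWithin_le_nhds, h1] with t ht hne
    have hpos : 0 < (t - s) ^ 2 := by
      have : t - s ≠ 0 := sub_ne_zero.mpr hne
      positivity
    have h2 : ∀ x, ‖(((t - s)⁻¹ : ℝ) : ℂ) * (ψ x t - ψ x s)‖ ^ 2
        = ((t - s) ^ 2)⁻¹ * ‖ψ x t - ψ x s‖ ^ 2 := by
      intro x
      rw [norm_mul, mul_pow, Complex.norm_real, norm_inv, inv_pow,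
        Real.norm_eq_abs, sq_abs]
    simp_rw [h2]
    rw [integral_const_mul, inv_mul_le_iff₀ hpos]
    linarith

lemma weak_cont (H : Ctx N σ e M ψ Φ q) {g : V3 → ℂ} (hg : Continuous g) :
    Continuous (fun t => ∫ x in cubeN N, g x * ψ x t) := by
  rw [continuous_iff_continuousAt]
  intro s
  exact WKmul (N := N) (l := 𝓝 s) (F := fun t x => ψ x t) (f := fun x => ψ x s) (g := g)
    (fun t => psi_c H t) (psi_c H s) hg (fun x => (psi_ct H x).tendsto s)
    (B := ∫ x in cubeN N, ‖ψ x 0‖ ^ 2) (Eventually.of_forall fun t => (charge H t).le)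

lemma dist_sq (H : Ctx N σ e M ψ Φ q) (t κ : ℝ) :
    ∫ x in cubeN N, ‖ψ x t - ψ x κ‖ ^ 2 = 2 * (∫ x in cubeN N, ‖ψ x 0‖ ^ 2)
      - 2 * (∫ x in cubeN N, (starRingEnd ℂ) (ψ x κ) * ψ x t).re := by
  have h1 := psi_c H t
  have h2 := psi_c H κ
  have hc : Continuous fun x => (starRingEnd ℂ) (ψ x κ) * ψ x t :=
    (Complex.continuous_conj.comp h2).mul h1
  have h3 : ∀ x, ‖ψ x t - ψ x κ‖ ^ 2 = ‖ψ x t‖ ^ 2 + ‖ψ x κ‖ ^ 2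
      - 2 * ((starRingEnd ℂ) (ψ x κ) * ψ x t).re := by
    intro x
    rw [← Complex.normSq_eq_norm_sq, ← Complex.normSq_eq_norm_sq, ← Complex.normSq_eq_norm_sq,
      Complex.normSq_sub]
    simp
    ring
  simp_rw [h3]
  have hre : (∫ x in cubeN N, (starRingEnd ℂ) (ψ x κ) * ψ x t).re =
      ∫ x in cubeN N, ((starRingEnd ℂ) (ψ x κ) * ψ x t).re := by
    have := integral_re (𝕜 := ℂ) (μ := volume.restrict (cubeN N)) (integ hc)
    exact this.symm
  have hc2 : Continuous fun x => ((starRingEnd ℂ) (ψ x κ) * ψ x t).re :=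
    Complex.continuous_re.comp hc
  rw [hre, integral_sub (integ (by fun_prop)) (integ (hc2.const_mul 2)),
    integral_add (integ (by fun_prop)) (integ (by fun_prop)), integral_const_mul,
    charge H t, charge H κ]
  ring

lemma lapC_symm {u v : V3 → ℂ} (hu : ContDiff ℝ 2 u) (hv : ContDiff ℝ 2 v)
    (hup : IsPerN N u) (hvp : IsPerN N v) :
    ∫ x in cubeN N, (starRingEnd ℂ) (u x) * lapC v x =
      ∫ x in cubeN N, (starRingEnd ℂ) (lapC u x) * v x := by
  have h1 := greenC (hu.of_le one_le_two) hv hup hvp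
  have h2 := greenC (hv.of_le one_le_two) hu hvp hup
  have h3 := congrArg (starRingEnd ℂ) h2
  rw [map_neg, ← integral_conj, ← integral_conj] at h3
  simp only [map_mul, map_sum, Complex.conj_conj] at h3
  rw [h1]
  calc _ = -∫ x in cubeN N, ∑ i, fderiv ℝ v x (Pi.single i 1) *
        (starRingEnd ℂ) (fderiv ℝ u x (Pi.single i 1)) := by
        congr 2; funext x; exact Finset.sum_congr rfl fun i _ => mul_comm _ _
    _ = _ := by rw [← h3]; congr 1; funext x; exact mul_comm _ _

lemma greenC_self {u : V3 → ℂ} (hu : ContDiff ℝ 2 u) (hup : IsPerN N u) :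
    ∫ x in cubeN N, (starRingEnd ℂ) (lapC u x) * u x
      = ((- ∫ x in cubeN N, gradSq u x : ℝ) : ℂ) := by
  rw [← lapC_symm hu hu hup hup, greenC (hu.of_le one_le_two) hu hup hup, Complex.ofReal_neg,
    ← integral_complex_ofReal]
  congr 2
  funext x
  rw [gradSq]
  push_cast
  exact Finset.sum_congr rfl fun i _ => (Complex.normSq_eq_conj_mul_self).symm

lemma Yd_bound (H : Ctx N σ e M ψ Φ q) {t κ n P : ℝ} (hn : ∀ x, ‖ψ x κ‖ ≤ n)
    (hP : ∫ x in cubeN N, (Φ x t) ^ 2 ≤ P) :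
    |(∫ x in cubeN N, (starRingEnd ℂ) (ψ x κ) * wv ψ x t).re| ≤
      (1 / 2 * l2 N (lapC fun y => ψ y κ) + e * n * √P) * l2 N (fun x => ψ x t - ψ x κ) := by
  have he := H.he
  have hn0 : 0 ≤ n := (norm_nonneg _).trans (hn 0)
  have ht := psi_c H t
  have hk := psi_c H κ
  have hkc : Continuous fun x => (starRingEnd ℂ) (ψ x κ) := Complex.continuous_conj.comp hk
  have hΦ := Phi_c H t
  have hLt := lapC_cont (H.hsol.regx_psi t)
  have hLk := lapC_cont (H.hsol.regx_psi κ)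
  have hLkc : Continuous fun x => (starRingEnd ℂ) (lapC (fun y => ψ y κ) x) :=
    Complex.continuous_conj.comp hLk
  have e1 : ∫ x in cubeN N, (starRingEnd ℂ) (ψ x κ) * wv ψ x t =
      Complex.I / 2 * (∫ x in cubeN N, (starRingEnd ℂ) (lapC (fun y => ψ y κ) x) *
        (ψ x t - ψ x κ)) + Complex.I / 2 * ((- ∫ x in cubeN N, gradSq (fun y => ψ y κ) x : ℝ) : ℂ)
      + (∫ x in cubeN N, (Complex.I * e * Φ x t * (starRingEnd ℂ) (ψ x κ)) * (ψ x t - ψ x κ))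
      + Complex.I * ((∫ x in cubeN N, e * Φ x t * ‖ψ x κ‖ ^ 2 : ℝ) : ℂ) := by
    rw [← greenC_self (H.hsol.regx_psi κ) (H.hsol.per_psi κ), ← mul_add,
      ← integral_add (integ (by fun_prop)) (integ (by fun_prop))]
    have a1 : ∀ x, (starRingEnd ℂ) (lapC (fun y => ψ y κ) x) * (ψ x t - ψ x κ) +
      (starRingEnd ℂ) (lapC (fun y => ψ y κ) x) * ψ x κ =
      (starRingEnd ℂ) (lapC (fun y => ψ y κ) x) * ψ x t := fun x => by ring
    simp_rw [a1]
    rw [← lapC_symm (H.hsol.regx_psi κ) (H.hsol.regx_psi t) (H.hsol.per_psi κ)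
      (H.hsol.per_psi t), ← integral_complex_ofReal, ← integral_const_mul, ← integral_const_mul,
      ← integral_add (integ (by fun_prop)) (integ (by fun_prop)),
      ← integral_add (integ (by fun_prop)) (integ (by fun_prop))]
    congr 1
    funext x
    rw [w_eq H]
    have : ((e * Φ x t * ‖ψ x κ‖ ^ 2 : ℝ) : ℂ) =
        e * Φ x t * ((starRingEnd ℂ) (ψ x κ) * ψ x κ) := by
      rw [← Complex.normSq_eq_conj_mul_self, Complex.normSq_eq_norm_sq]
      push_cast; ring
    rw [this]
    ring
  set B1 := ∫ x in cubeN N, (starRingEnd ℂ) (lapC (fun y => ψ y κ) x) * (ψ x t - ψ x κ)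
  set B2 := ∫ x in cubeN N, (Complex.I * e * Φ x t * (starRingEnd ℂ) (ψ x κ)) * (ψ x t - ψ x κ)
  have e2 : (∫ x in cubeN N, (starRingEnd ℂ) (ψ x κ) * wv ψ x t).re = (Complex.I / 2 * B1).re
      + B2.re := by
    rw [e1]
    simp
  have b1 : ‖B1‖ ≤ l2 N (lapC fun y => ψ y κ) * l2 N (fun x => ψ x t - ψ x κ) := by
    have := cs_norm (N := N) (g := fun x => ψ x t - ψ x κ) hLkc (ht.sub hk)
    simpa only [RCLike.norm_conj, l2] using this
  have b2 : ‖B2‖ ≤ (e * n * √P) * l2 N (fun x => ψ x t - ψ x κ) := by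
    have h1 := cs_norm (N := N) (f := fun x => Complex.I * e * Φ x t * (starRingEnd ℂ) (ψ x κ))
      (g := fun x => ψ x t - ψ x κ) (by fun_prop) (by fun_prop)
    refine h1.trans ?_
    rw [l2]
    gcongr
    rw [← Real.sqrt_sq (show 0 ≤ e * n by positivity), ← Real.sqrt_mul (by positivity)]
    refine Real.sqrt_le_sqrt ?_
    calc _ ≤ ∫ x in cubeN N, (e * n) ^ 2 * (Φ x t) ^ 2 := by
          refine integral_mono (integ (by fun_prop)) (integ (by fun_prop)) fun x => ?_
          simp only [norm_mul, Complex.norm_I, Complex.norm_real, RCLike.norm_conj,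
            Real.norm_eq_abs, abs_of_pos he, one_mul]
          have := hn x
          calc (e * |Φ x t| * ‖ψ x κ‖) ^ 2 ≤ (e * |Φ x t| * n) ^ 2 := by gcongr
            _ = _ := by rw [mul_pow, mul_pow, sq_abs]; ring
      _ ≤ _ := by rw [integral_const_mul]; gcongr
  rw [e2]
  have c1 := Complex.abs_re_le_norm (Complex.I / 2 * B1)
  have c2 := Complex.abs_re_le_norm B2
  have c3 : ‖Complex.I / 2 * B1‖ = 1 / 2 * ‖B1‖ := by simp
  refine (abs_add_le _ _).trans ?_
  rw [c3] at c1
  nlinarith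

lemma gap_est (H : Ctx N σ e M ψ Φ q) {a b κ n P : ℝ} (hab : a < b) (hn : ∀ x, ‖ψ x κ‖ ≤ n)
    (hP : ∀ t ∈ Set.Icc a b, ∫ x in cubeN N, (Φ x t) ^ 2 ≤ P)
    (hPL : ∀ t ∈ Set.Ioo a b, PL N ψ t) :
    |l2 N (fun x => ψ x b - ψ x κ) - l2 N (fun x => ψ x a - ψ x κ)| ≤
      (1 / 2 * l2 N (lapC fun y => ψ y κ) + e * n * √P) * (b - a) := by
  have hn0 : 0 ≤ n := (norm_nonneg _).trans (hn 0)
  have he := H.he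
  have hk := psi_c H κ
  have hkc : Continuous fun x => (starRingEnd ℂ) (ψ x κ) := Complex.continuous_conj.comp hk
  refine sqrt_lip (Y := fun t => ∫ x in cubeN N, ‖ψ x t - ψ x κ‖ ^ 2)
    (Y' := fun t => - 2 * (∫ x in cubeN N, (starRingEnd ℂ) (ψ x κ) * wv ψ x t).re) hab
    ?_ ?_ ?_ ?_ ?_
  · refine Continuous.continuousOn ?_
    simp_rw [dist_sq H]
    have := Complex.continuous_re.comp (weak_cont H hkc)
    exact continuous_const.sub (this.const_mul 2)
  · exact fun t => integral_nonneg fun x => by positivity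
  · have := l2_nonneg N (lapC fun y => ψ y κ)
    positivity
  · intro t ht
    simp_rw [dist_sq H]
    have h1 := weak_deriv H (hPL t ht) hkc
    have h2 := (Complex.reCLM.hasFDerivAt.comp_hasDerivAt t h1)
    have h3 := (h2.const_mul 2).const_sub (2 * ∫ x in cubeN N, ‖ψ x 0‖ ^ 2)
    exact h3.congr_deriv (by rw [Complex.reCLM_apply]; ring)
  · intro t ht
    have := Yd_bound H hn (hP t ⟨ht.1.le, ht.2.le⟩)
    have h5 : √(∫ x in cubeN N, ‖ψ x t - ψ x κ‖ ^ 2) = l2 N (fun x => ψ x t - ψ x κ) := rfl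
    rw [abs_mul]
    rw [h5]
    simp only [abs_neg, abs_two]
    linarith

lemma lap_l2 (H : Ctx N σ e M ψ Φ q) {t n P : ℝ} (hw : ∀ x, ‖wv ψ x t‖ ≤ n)
    (hn : ∀ x, ‖ψ x t‖ ≤ n) (hP : ∫ x in cubeN N, (Φ x t) ^ 2 ≤ P) :
    l2 N (lapC fun y => ψ y t) ≤ √((N:ℝ)^3 * (8 * n ^ 2) + 8 * e ^ 2 * n ^ 2 * P) := by
  have hn0 : 0 ≤ n := (norm_nonneg _).trans (hn 0)
  have he := H.he
  refine Real.sqrt_le_sqrt ?_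
  have hL := lapC_cont (H.hsol.regx_psi t)
  have hΦ := Phi_c H t
  calc _ ≤ ∫ x in cubeN N, (8 * n ^ 2 + 8 * e ^ 2 * n ^ 2 * (Φ x t) ^ 2) := by
        refine integral_mono (integ (by fun_prop)) (integ (by fun_prop)) fun x => ?_
        have h1 : lapC (fun y => ψ y t) x = -2 * Complex.I * wv ψ x t
            + (-2) * ((e:ℂ) * Φ x t * ψ x t) := by
          rw [w_eq H]
          linear_combination (lapC (fun y => ψ y t) x) * Complex.I_mul_I
            + 2 * ((e:ℂ) * Φ x t * ψ x t) * Complex.I_mul_I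
        have h2 : ‖lapC (fun y => ψ y t) x‖ ≤ 2 * n + 2 * (e * |Φ x t| * n) := by
          rw [h1]
          refine (norm_add_le _ _).trans ?_
          simp only [norm_mul, Complex.norm_I, Complex.norm_real, norm_neg, Complex.norm_ofNat,
            Real.norm_eq_abs, abs_of_pos he, mul_one]
          have h3 := hw x
          have h4 := hn x
          gcongr
        have h3 := pow_le_pow_left₀ (norm_nonneg _) h2 2
        refine h3.trans ?_
        rw [← sq_abs (Φ x t)]
        nlinarith [sq_nonneg (2 * n - 2 * (e * |Φ x t| * n))]
    _ = (N:ℝ)^3 * (8 * n ^ 2) + 8 * e ^ 2 * n ^ 2 * ∫ x in cubeN N, (Φ x t) ^ 2 := by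
        rw [integral_add (integ (by fun_prop)) (integ (by fun_prop)), int_const,
          integral_const_mul]
    _ ≤ _ := by gcongr

lemma PL_all (H : Ctx N σ e M ψ Φ q) (s : ℝ) : PL N ψ s := by
  have he := H.he
  set K : Set ℝ := {s | ¬ ∀ᶠ t in 𝓝 s, PL N ψ t} with hKdef
  have hPLout : ∀ t, t ∉ K → PL N ψ t := by
    intro t ht
    have : ∀ᶠ t in 𝓝 t, PL N ψ t := not_not.mp ht
    exact this.self_of_nhds
  by_cases hne : K.Nonempty
  swap
  · exact hPLout s fun hs => hne ⟨s, hs⟩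
  exfalso
  have hK : IsClosed K := by
    rw [← isOpen_compl_iff]
    have : Kᶜ = {s | ∀ᶠ t in 𝓝 s, PL N ψ t} := by
      ext t; simp [hKdef]
    rw [this]
    exact isOpen_setOf_eventually_nhds
  have hcl : ∀ n : ℕ, IsClosed {t | ∀ x, ‖wv ψ x t‖ ≤ n ∧ ‖ψ x t‖ ≤ n} := by
    intro n
    have : {t | ∀ x, ‖wv ψ x t‖ ≤ n ∧ ‖ψ x t‖ ≤ n} =
        ⋂ x, ({t | ‖wv ψ x t‖ ≤ n} ∩ {t | ‖ψ x t‖ ≤ n}) := by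
      ext t; simp
    rw [this]
    exact isClosed_iInter fun x => (isClosed_le (w_ct H x).norm continuous_const).inter
      (isClosed_le (psi_ct H x).norm continuous_const)
  have hcov : ∀ t, ∃ n : ℕ, t ∈ {t | ∀ x, ‖wv ψ x t‖ ≤ n ∧ ‖ψ x t‖ ≤ n} := by
    intro t
    obtain ⟨C1, _, h1⟩ := per_bdd H.hN (w_c H t) (w_per H t)
    obtain ⟨C2, _, h2⟩ := per_bdd H.hN (psi_c H t) (H.hsol.per_psi t)
    obtain ⟨n, hn⟩ := exists_nat_ge (max C1 C2)
    exact ⟨n, fun x => ⟨(h1 x).trans ((le_max_left _ _).trans hn),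
      (h2 x).trans ((le_max_right _ _).trans hn)⟩⟩
  obtain ⟨n, κ0, hκ0, δ, hδ, hpor⟩ := baire_portion hK hne _ hcl hcov
  obtain ⟨P, hP0, hP⟩ := Phi_L2 H (κ0 - δ) (κ0 + δ)
  set A : ℝ := 1 / 2 * √((N:ℝ)^3 * (8 * (n:ℝ) ^ 2) + 8 * e ^ 2 * (n:ℝ) ^ 2 * P) + e * n * √P with hA
  have hA0 : 0 ≤ A := by positivity
  have hn0 : (0:ℝ) ≤ n := by positivity
  have hI : ∀ t, t ∈ Set.Ioo (κ0 - δ) (κ0 + δ) ↔ |t - κ0| < δ := by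
    intro t
    rw [abs_lt, Set.mem_Ioo]
    constructor <;> rintro ⟨h1, h2⟩ <;> constructor <;> linarith
  -- gap estimate
  have gap : ∀ p u, κ0 - δ < p → p < u → u < κ0 + δ → (p ∈ K ∨ u ∈ K) →
      (∀ s ∈ Set.Ioo p u, s ∉ K) → l2 N (fun x => ψ x u - ψ x p) ≤ A * (u - p) := by
    intro p u h1 h2 h3 h4 h5
    have hPL : ∀ t ∈ Set.Ioo p u, PL N ψ t := fun t ht => hPLout t (h5 t ht)
    have hP' : ∀ t ∈ Set.Icc p u, ∫ x in cubeN N, (Φ x t) ^ 2 ≤ P := fun t ht =>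
      hP t ⟨by linarith [ht.1], by linarith [ht.2]⟩
    have gen : ∀ κ ∈ Set.Icc p u, κ ∈ K →
        |l2 N (fun x => ψ x u - ψ x κ) - l2 N (fun x => ψ x p - ψ x κ)| ≤ A * (u - p) := by
      intro κ hκ hκK
      have hb := hpor κ hκK ((hI κ).mp ⟨by linarith [hκ.1], by linarith [hκ.2]⟩)
      refine (gap_est H h2 (fun x => (hb x).2) hP' hPL).trans ?_
      have := lap_l2 H (fun x => (hb x).1) (fun x => (hb x).2) (hP' κ hκ)
      rw [hA]
      have h6 : 0 ≤ u - p := by linarith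
      gcongr
    rcases h4 with h4 | h4
    · have := gen p ⟨le_rfl, h2.le⟩ h4
      simp only [sub_self] at this
      rw [l2_zero, sub_zero] at this
      exact (le_abs_self _).trans this
    · have := gen u ⟨h2.le, le_rfl⟩ h4
      simp only [sub_self] at this
      rw [l2_zero, zero_sub, abs_neg, l2_neg_sub] at this
      exact (le_abs_self _).trans this
  set B : ℝ := √(2 * A ^ 2 + 2 * ((n:ℝ) + 1) ^ 2 * (N:ℝ)^3) with hB
  have hB0 : 0 ≤ B := Real.sqrt_nonneg _
  have chn : ∀ p ∈ K, ∀ u ∈ K, κ0 - δ < p → p ≤ u → u < κ0 + δ →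
      l2 N (fun x => ψ x u - ψ x p) ≤ B * (u - p) := by
    intro p hp u hu h1 h2 h3
    have := chain_l2 (N := N) (f := ψ) (f' := wv ψ) (psi_c H) (w_c H) (w_ct H) (psi_hd H) hK
      hA0 hn0 hp hu h2
      (fun τ hτ h4 h5 x => (hpor τ hτ ((hI τ).mp ⟨by linarith, by linarith⟩) x).1)
      (fun p' hp' u' hu' h4 h5 h6 h7 => gap p' u' (by linarith) h5 (by linarith) (Or.inl hp') h7)
    rw [l2, hB, ← Real.sqrt_sq (show 0 ≤ u - p by linarith), ← Real.sqrt_mul (by positivity)]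
    exact Real.sqrt_le_sqrt this
  have tri : ∀ a b c, l2 N (fun x => ψ x c - ψ x a) ≤
      l2 N (fun x => ψ x c - ψ x b) + l2 N (fun x => ψ x b - ψ x a) := by
    intro a b c
    have := l2_add (N := N) (f := fun x => ψ x c - ψ x b) (g := fun x => ψ x b - ψ x a)
      ((psi_c H c).sub (psi_c H b)) ((psi_c H b).sub (psi_c H a))
    simpa using this
  have main : ∀ u v, κ0 - δ < u → u ≤ v → v < κ0 + δ → (u ∈ K ∨ v ∈ K) →
      l2 N (fun x => ψ x v - ψ x u) ≤ (A + B) * (v - u) := by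
    intro u v h1 h2 h3 h4
    rcases h4 with h4 | h4
    · obtain ⟨a, haK, ha1, ha2, ha3⟩ := last_pt hK h4 h2
      have c1 := chn u h4 a haK h1 ha1 (by linarith)
      have c2 : l2 N (fun x => ψ x v - ψ x a) ≤ A * (v - a) := by
        rcases eq_or_lt_of_le ha2 with h | h
        · subst h
          simp only [sub_self, mul_zero]
          rw [l2_zero]
        · exact gap a v (by linarith) h h3 (Or.inl haK) fun s hs hsK =>
            absurd (ha3 s hsK hs.2.le) (not_le.mpr hs.1)
      have := tri u a v
      nlinarith [mul_nonneg hA0 (sub_nonneg.mpr ha1), mul_nonneg hB0 (sub_nonneg.mpr ha2)]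
    · obtain ⟨a, haK, ha1, ha2, ha3⟩ := first_pt hK h4 h2
      have c1 := chn a haK v h4 (by linarith) ha1 h3
      have c2 : l2 N (fun x => ψ x a - ψ x u) ≤ A * (a - u) := by
        rcases eq_or_lt_of_le ha2 with h | h
        · subst h
          simp only [sub_self, mul_zero]
          rw [l2_zero]
        · exact gap u a h1 h (by linarith) (Or.inr haK) fun s hs hsK =>
            absurd (ha3 s hsK hs.1.le) (not_le.mpr hs.2)
      have := tri u a v
      nlinarith [mul_nonneg hA0 (sub_nonneg.mpr ha1), mul_nonneg hB0 (sub_nonneg.mpr ha2)]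
  have hball : ∀ s ∈ Set.Ioo (κ0 - δ) (κ0 + δ), PL N ψ s := by
    intro s hs
    by_cases hsK : s ∈ K
    swap
    · exact hPLout s hsK
    refine ⟨(A + B) ^ 2, ?_⟩
    filter_upwards [isOpen_Ioo.mem_nhds hs] with t ht
    rw [← l2_sq, ← mul_pow, ← sq_abs ((A + B) * (t - s))]
    refine pow_le_pow_left₀ (l2_nonneg _ _) ?_ 2
    rw [abs_mul, abs_of_nonneg (show 0 ≤ A + B by positivity)]
    rcases le_total s t with h | h
    · rw [abs_of_nonneg (by linarith)]
      exact main s t hs.1 h ht.2 (Or.inl hsK)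
    · rw [abs_of_nonpos (by linarith), l2_neg_sub, neg_sub]
      exact main t s ht.1 h hs.2 (Or.inr hsK)
  apply hκ0
  filter_upwards [isOpen_Ioo.mem_nhds (show κ0 ∈ Set.Ioo (κ0 - δ) (κ0 + δ) from
    ⟨by linarith, by linarith⟩)] with t ht
  exact hball t ht

end PLSec

/-! ### Part 8: bounds in `H¹` -/

section H1Sec

open Filter Topology

lemma hess_bound {N : ℕ} (hN : 0 < N) : ∃ C : ℝ, 0 ≤ C ∧ ∀ u : V3 → ℝ, ContDiff ℝ 2 u →
    IsPerN N u → ∀ i, ∫ x in cubeN N, (fderiv ℝ u x (Pi.single i 1)) ^ 4 ≤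
      C * (∫ x in cubeN N, (lapR u x) ^ 2) ^ 2 := by
  obtain ⟨C0, hC0, hg⟩ := gns hN
  have hsum := summ_xi hN
  set T := ∑' k : Fin 3 → ℤ, (nsqV (xiN N k))⁻¹ ^ 2 with hT
  have hT0 : 0 ≤ T := tsum_nonneg fun k => by positivity
  refine ⟨C0 * (T + 2) ^ 2, by positivity, fun u hu hp i => ?_⟩
  set f : V3 → ℂ := fun x => ((fderiv ℝ u x (Pi.single i 1) : ℝ) : ℂ) with hf
  have hfc : ContDiff ℝ 1 f := ofReal_contDiff (c1_fderiv hu _)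
  have hfp : IsPerN N f := by
    intro x k
    simp only [hf]
    exact congrArg Complex.ofReal (per_fderiv hp (Pi.single i 1) x k)
  set uc : V3 → ℂ := fun x => (u x : ℂ) with huc
  have hucc : ContDiff ℝ 2 uc := ofReal_contDiff hu
  have hucp : IsPerN N uc := by
    intro x k
    simp only [huc]
    rw [hp x k]
  have hfu : f = fun x => fderiv ℝ uc x (Pi.single i 1) := by
    funext x
    simp only [hf, huc]
    rw [ofReal_fderiv (hu.differentiable two_ne_zero x)]
  have hcoef : ∀ k, ‖fc N f k‖ ^ 2 = (xiN N k i) ^ 2 * ‖fc N uc k‖ ^ 2 := by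
    intro k
    rw [hfu, fc_fderiv hN (hucc.of_le one_le_two) hucp]
    simp [mul_pow]
  have hlapc : lapC uc = fun x => ((lapR u x : ℝ) : ℂ) := funext fun x => lapC_ofReal hu x
  have hL := parseval hN (lapC_cont hucc) (lapC_per hucp)
  have hL2 : (fun k => ‖fc N (lapC uc) k‖ ^ 2) = fun k => nsqV (xiN N k) ^ 2 * ‖fc N uc k‖ ^ 2 := by
    funext k
    rw [fc_lapC hN hucc hucp]
    simp [mul_pow]
  rw [hL2] at hL
  have hA := (grad_parseval hN hfc hfp).add (parseval hN hfc.continuous hfp)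
  have hle := hasSum_le (fun k => ?_) hA (hL.mul_left (T + 2))
  · have hNpos : (0:ℝ) < (N:ℝ)^3 := by positivity
    have h1 : ∫ x in cubeN N, (gradSq f x + ‖f x‖ ^ 2) ≤ (T + 2) *
        ∫ x in cubeN N, (lapR u x) ^ 2 := by
      have hfc0 := hfc.continuous
      have hgc := gradSq_cont hfc
      rw [integral_add (integ (by fun_prop)) (integ (by fun_prop))]
      have h2 : ∫ x in cubeN N, ‖lapC uc x‖ ^ 2 = ∫ x in cubeN N, (lapR u x) ^ 2 := by
        rw [hlapc]
        simp
      rw [h2] at hle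
      nlinarith
    have h2 := hg f hfc hfp
    have h3 : ∫ x in cubeN N, ‖f x‖ ^ 4 = ∫ x in cubeN N, (fderiv ℝ u x (Pi.single i 1)) ^ 4 := by
      simp only [hf, Complex.norm_real, Real.norm_eq_abs]
      congr 1
      funext x
      exact Even.pow_abs (by decide) _
    rw [← h3]
    refine h2.trans ?_
    have h4 : 0 ≤ ∫ x in cubeN N, (gradSq f x + ‖f x‖ ^ 2) := integral_nonneg fun x =>
      add_nonneg (gradSq_nonneg _ _) (by positivity)
    calc C0 * (∫ x in cubeN N, (gradSq f x + ‖f x‖ ^ 2)) ^ 2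
        ≤ C0 * ((T + 2) * ∫ x in cubeN N, (lapR u x) ^ 2) ^ 2 := by gcongr
      _ = _ := by ring
  · rw [hcoef]
    have hi : xiN N k i ^ 2 ≤ nsqV (xiN N k) := by
      rw [nsqV]
      exact Finset.single_le_sum (f := fun i => xiN N k i ^ 2) (fun i _ => sq_nonneg _)
        (Finset.mem_univ i)
    have hc0 : 0 ≤ ‖fc N uc k‖ ^ 2 := by positivity
    rcases eq_or_ne k 0 with hk | hk
    · have : xiN N k i = 0 := by simp [xiN, hk]
      rw [this]
      have : 0 ≤ (T + 2) * (nsqV (xiN N k) ^ 2 * ‖fc N uc k‖ ^ 2) := by positivity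
      simpa using this
    · have hy := nsqV_xi_pos hN hk
      set y := nsqV (xiN N k)
      have h1 : y⁻¹ ^ 2 ≤ T := hsum.le_tsum k (fun j _ => by positivity)
      have h2 : y⁻¹ ≤ T + 1 := by
        by_contra hcon
        push Not at hcon
        nlinarith
      have h3 : y ≤ (T + 1) * y ^ 2 := by
        have := mul_le_mul_of_nonneg_right h2 (show 0 ≤ y ^ 2 by positivity)
        rwa [sq, ← mul_assoc, inv_mul_cancel₀ hy.ne', one_mul, ← sq] at this
      have h4 : (y + 1) * xiN N k i ^ 2 ≤ (T + 2) * y ^ 2 := by nlinarith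
      calc _ = ((y + 1) * xiN N k i ^ 2) * ‖fc N uc k‖ ^ 2 := by ring
        _ ≤ ((T + 2) * y ^ 2) * ‖fc N uc k‖ ^ 2 := by gcongr
        _ = _ := by ring

variable {N : ℕ} {σ : V3 → ℝ} {e M : ℝ} {ψ : V3 → ℝ → ℂ} {Φ : V3 → ℝ → ℝ}
  {q : ℝ → GammaIdx N → V3}

/-- The potential with zero mean. -/
def P0 (N : ℕ) (Φ : V3 → ℝ → ℝ) (t : ℝ) (x : V3) : ℝ := Φ x t - mn N (fun y => Φ y t)

lemma P0_cd (H : Ctx N σ e M ψ Φ q) (t : ℝ) : ContDiff ℝ 2 (P0 N Φ t) :=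
  (H.hsol.regx_Phi t).sub contDiff_const

lemma P0_per (H : Ctx N σ e M ψ Φ q) (t : ℝ) : IsPerN N (P0 N Φ t) := by
  intro x k
  have := H.hsol.per_Phi t x k
  simp only [P0] at *
  rw [this]

lemma H1bounds (H : Ctx N σ e M ψ Φ q) (G : ℝ) : ∃ S GF : ℝ, 0 ≤ S ∧ 0 ≤ GF ∧ ∀ t,
    ∫ x in cubeN N, gradSq (fun y => ψ y t) x ≤ G →
    (∀ x, |P0 N Φ t x| ≤ S) ∧
      ∫ x in cubeN N, gradSq (fun y => (P0 N Φ t y : ℂ) * ψ y t) x ≤ GF := by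
  have he := H.he
  obtain ⟨Cg, hCg0, hg⟩ := gns H.hN
  obtain ⟨Cs, hCs0, hs⟩ := poisson_sup H.hN
  obtain ⟨Ch, hCh0, hh⟩ := hess_bound H.hN
  obtain ⟨Cσ, hCσ0, hσ⟩ := per_bdd H.hN H.hreg.continuous H.hper
  set Z0 := ∫ x in cubeN N, ‖ψ x 0‖ ^ 2 with hZ0
  have hZ00 : 0 ≤ Z0 := integral_nonneg fun x => by positivity
  set A := Fintype.card (GammaIdx N) * Cσ with hA
  set Q := Cg * (G + Z0) ^ 2 with hQ
  set R := (N:ℝ)^3 * (2 * A ^ 2) + 2 * e ^ 2 * Q with hR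
  set S := Cs * √R with hS
  refine ⟨S, 2 * S ^ 2 * |G| + 3 * (Q + Ch * R ^ 2), by positivity, by positivity, fun t ht => ?_⟩
  have hpc := psi_c H t
  have hg1 := gradSq_cont ((H.hsol.regx_psi t).of_le one_le_two)
  have hpsi4 : ∫ x in cubeN N, ‖ψ x t‖ ^ 4 ≤ Q := by
    refine (hg _ ((H.hsol.regx_psi t).of_le one_le_two) (H.hsol.per_psi t)).trans ?_
    rw [integral_add (integ hg1) (integ (by fun_prop)), charge H t]
    have h0 : 0 ≤ ∫ x in cubeN N, gradSq (fun y => ψ y t) x :=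
      integral_nonneg fun x => gradSq_nonneg _ _
    rw [hQ]
    gcongr
  have hrc := rh_c H t
  have hrho : ∫ x in cubeN N, (lapR (fun y => Φ y t) x) ^ 2 ≤ R := by
    rw [lap_rh H]
    calc _ ≤ ∫ x in cubeN N, (2 * A ^ 2 + 2 * e ^ 2 * ‖ψ x t‖ ^ 4) := by
          refine integral_mono (integ (by fun_prop)) (integ (by fun_prop)) fun x => ?_
          simp only
          rw [rh_eq]
          have h1 : |∑ n : GammaIdx N, σ (x - embG n - q t n)| ≤ A := by
            refine (Finset.abs_sum_le_sum_abs _ _).trans ?_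
            refine (Finset.sum_le_sum fun n _ => hσ (x - embG n - q t n)).trans ?_
            simp [hA]
          have h2 := pow_le_pow_left₀ (abs_nonneg _) h1 2
          rw [sq_abs] at h2
          nlinarith [sq_nonneg ((∑ n : GammaIdx N, σ (x - embG n - q t n)) + e * ‖ψ x t‖ ^ 2)]
      _ = (N:ℝ)^3 * (2 * A ^ 2) + 2 * e ^ 2 * ∫ x in cubeN N, ‖ψ x t‖ ^ 4 := by
          rw [integral_add (integ (by fun_prop)) (integ (by fun_prop)), int_const,
            integral_const_mul]
      _ ≤ R := by rw [hR]; gcongr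
  have hsup : ∀ x, |P0 N Φ t x| ≤ S := by
    intro x
    refine (hs _ (H.hsol.regx_Phi t) (H.hsol.per_Phi t) x).trans ?_
    rw [hS]
    gcongr
  refine ⟨hsup, ?_⟩
  have hdΦ : ∀ i : Fin 3, Continuous fun x => fderiv ℝ (fun y => Φ y t) x (Pi.single i 1) :=
    fun i => cont_fderiv ((H.hsol.regx_Phi t).of_le one_le_two) _
  have hptw : ∀ x, gradSq (fun y => (P0 N Φ t y : ℂ) * ψ y t) x ≤
      2 * S ^ 2 * gradSq (fun y => ψ y t) x +
      ∑ i : Fin 3, (‖ψ x t‖ ^ 4 + (fderiv ℝ (fun y => Φ y t) x (Pi.single i 1)) ^ 4) := by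
    intro x
    rw [gradSq, gradSq, Finset.mul_sum, ← Finset.sum_add_distrib]
    refine Finset.sum_le_sum fun i _ => ?_
    have hd1 : DifferentiableAt ℝ (fun y => (P0 N Φ t y : ℂ)) x :=
      (ofReal_contDiff (P0_cd H t)).differentiable two_ne_zero x
    have hd2 : DifferentiableAt ℝ (fun y => ψ y t) x :=
      (H.hsol.regx_psi t).differentiable two_ne_zero x
    rw [fderiv_fun_mul hd1 hd2]
    have h0 : fderiv ℝ (P0 N Φ t) x = fderiv ℝ (fun y => Φ y t) x := by
      have : P0 N Φ t = fun y => Φ y t - mn N (fun y => Φ y t) := rfl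
      rw [this, fderiv_sub_const]
    simp only [add_apply, smul_apply, smul_eq_mul]
    rw [ofReal_fderiv ((P0_cd H t).differentiable two_ne_zero x), h0]
    set d := fderiv ℝ (fun y => ψ y t) x (Pi.single i 1)
    set f := fderiv ℝ (fun y => Φ y t) x (Pi.single i 1)
    rw [Complex.normSq_eq_norm_sq, Complex.normSq_eq_norm_sq]
    have h1 : ‖(P0 N Φ t x : ℂ) * d + ψ x t * (f : ℂ)‖ ≤ S * ‖d‖ + ‖ψ x t‖ * |f| := by
      refine (norm_add_le _ _).trans ?_
      rw [norm_mul, norm_mul, Complex.norm_real, Complex.norm_real, Real.norm_eq_abs,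
        Real.norm_eq_abs]
      have := hsup x
      gcongr
    have h2 := pow_le_pow_left₀ (norm_nonneg _) h1 2
    have h3 : |f| ^ 4 = f ^ 4 := Even.pow_abs (by decide) _
    rw [← h3]
    nlinarith [sq_nonneg (S * ‖d‖ - ‖ψ x t‖ * |f|), sq_nonneg (‖ψ x t‖ ^ 2 - |f| ^ 2)]
  have hFc : Continuous (gradSq fun y => (P0 N Φ t y : ℂ) * ψ y t) :=
    gradSq_cont (((ofReal_contDiff (P0_cd H t)).mul (H.hsol.regx_psi t)).of_le one_le_two)
  calc _ ≤ ∫ x in cubeN N, (2 * S ^ 2 * gradSq (fun y => ψ y t) x +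
      ∑ i : Fin 3, (‖ψ x t‖ ^ 4 + (fderiv ℝ (fun y => Φ y t) x (Pi.single i 1)) ^ 4)) :=
        integral_mono (integ hFc) (integ (by fun_prop)) hptw
    _ = 2 * S ^ 2 * (∫ x in cubeN N, gradSq (fun y => ψ y t) x) +
        ∑ i : Fin 3, ((∫ x in cubeN N, ‖ψ x t‖ ^ 4) +
          ∫ x in cubeN N, (fderiv ℝ (fun y => Φ y t) x (Pi.single i 1)) ^ 4) := by
        rw [integral_add (integ (by fun_prop)) (integ (by fun_prop)), integral_const_mul,
          integral_finsetSum _ fun i _ => integ (by fun_prop)]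
        congr 1
        refine Finset.sum_congr rfl fun i _ => ?_
        rw [integral_add (integ (by fun_prop)) (integ (by fun_prop))]
    _ ≤ 2 * S ^ 2 * |G| + ∑ _i : Fin 3, (Q + Ch * R ^ 2) := by
        have hG := ht.trans (le_abs_self G)
        gcongr with i
        refine (hh _ (H.hsol.regx_Phi t) (H.hsol.per_Phi t) i).trans ?_
        have h0 : 0 ≤ ∫ x in cubeN N, (lapR (fun y => Φ y t) x) ^ 2 :=
          integral_nonneg fun x => by positivity
        gcongr
    _ = _ := by simp; ring

lemma fc_deriv (H : Ctx N σ e M ψ Φ q) (k : Fin 3 → ℤ) (t : ℝ) :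
    HasDerivAt (fun s => fc N (fun x => ψ x s) k) (fc N (fun x => wv ψ x t) k) t :=
  weak_deriv H (PL_all H t) (ekc_contDiff N k).continuous

lemma fc_w (H : Ctx N σ e M ψ Φ q) (k : Fin 3 → ℤ) (t : ℝ) :
    fc N (fun x => wv ψ x t) k =
      Complex.I * ((- (nsqV (xiN N k)) / 2 + e * mn N (fun y => Φ y t) : ℝ) : ℂ) *
        fc N (fun x => ψ x t) k
      + Complex.I * e * fc N (fun y => (P0 N Φ t y : ℂ) * ψ y t) k := by
  have h1 : fc N (fun x => wv ψ x t) k = Complex.I / 2 * fc N (lapC fun y => ψ y t) k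
      + Complex.I * e * mn N (fun y => Φ y t) * fc N (fun x => ψ x t) k
      + Complex.I * e * fc N (fun y => (P0 N Φ t y : ℂ) * ψ y t) k := by
    have hE := (ekc_contDiff N k).continuous
    have hL := lapC_cont (H.hsol.regx_psi t)
    have hp := psi_c H t
    have hP := (ofReal_contDiff (P0_cd H t)).continuous
    simp only [fc]
    rw [← integral_const_mul, ← integral_const_mul, ← integral_const_mul,
      ← integral_add (integ (by fun_prop)) (integ (by fun_prop)),
      ← integral_add (integ (by fun_prop)) (integ (by fun_prop))]
    congr 1
    funext x
    rw [w_eq H, P0]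
    push_cast
    ring
  rw [h1, fc_lapC H.hN (H.hsol.regx_psi t) (H.hsol.per_psi t)]
  push_cast
  ring

lemma grad_lip (H : Ctx N σ e M ψ Φ q) {a b G : ℝ}
    (hG : ∀ t ∈ Set.Icc a b, ∫ x in cubeN N, gradSq (fun y => ψ y t) x ≤ G) :
    ∃ L : ℝ, ∀ t ∈ Set.Icc a b, ∀ s ∈ Set.Icc a b,
      |(∫ x in cubeN N, gradSq (fun y => ψ y t) x) - ∫ x in cubeN N, gradSq (fun y => ψ y s) x|
        ≤ L * |t - s| := by
  have he := H.he
  have hN3 : (0:ℝ) < (N:ℝ)^3 := by have := H.hN; positivity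
  obtain ⟨S, GF, hS, hGF, hb⟩ := H1bounds H G
  set c : (Fin 3 → ℤ) → ℝ → ℂ := fun k t => fc N (fun x => ψ x t) k with hc
  set F : (Fin 3 → ℤ) → ℝ → ℂ := fun k t => fc N (fun y => (P0 N Φ t y : ℂ) * ψ y t) k with hF
  set y : (Fin 3 → ℤ) → ℝ := fun k => nsqV (xiN N k) with hy
  have hy0 : ∀ k, 0 ≤ y k := fun k => Finset.sum_nonneg fun i _ => sq_nonneg _
  have hpc : ∀ t, HasSum (fun k => y k * ‖c k t‖ ^ 2)
      ((N:ℝ)^3 * ∫ x in cubeN N, gradSq (fun y => ψ y t) x) := fun t =>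
    grad_parseval H.hN ((H.hsol.regx_psi t).of_le one_le_two) (H.hsol.per_psi t)
  have hpF : ∀ t, HasSum (fun k => y k * ‖F k t‖ ^ 2)
      ((N:ℝ)^3 * ∫ x in cubeN N, gradSq (fun y => (P0 N Φ t y : ℂ) * ψ y t) x) := by
    intro t
    refine grad_parseval H.hN
      (((ofReal_contDiff (P0_cd H t)).mul (H.hsol.regx_psi t)).of_le one_le_two) ?_
    intro x k
    have h1 := P0_per H t x k
    have h2 := H.hsol.per_psi t x k
    simp only at h2 ⊢
    rw [h1, h2]
  have hfin : ∀ T : Finset (Fin 3 → ℤ), ∀ t ∈ Set.Icc a b, ∀ s ∈ Set.Icc a b,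
      ‖(∑ k ∈ T, y k * ‖c k t‖ ^ 2) - ∑ k ∈ T, y k * ‖c k s‖ ^ 2‖ ≤
        e * ((N:ℝ)^3 * G + (N:ℝ)^3 * GF) * ‖t - s‖ := by
    intro T t ht s hs
    refine Convex.norm_image_sub_le_of_norm_hasDerivWithin_le
      (f := fun t => ∑ k ∈ T, y k * ‖c k t‖ ^ 2)
      (f' := fun t => ∑ k ∈ T, y k * (2 * inner ℝ (c k t) (fc N (fun x => wv ψ x t) k)))
      (s := Set.Icc a b) (fun τ hτ => ?_) (fun τ hτ => ?_) (convex_Icc a b) hs ht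
    · refine HasDerivAt.hasDerivWithinAt ?_
      exact HasDerivAt.fun_sum fun k _ => ((fc_deriv H k τ).norm_sq).const_mul (y k)
    · have hterm : ∀ k ∈ T, |y k * (2 * inner ℝ (c k τ) (fc N (fun x => wv ψ x τ) k))| ≤
          e * (y k * ‖c k τ‖ ^ 2 + y k * ‖F k τ‖ ^ 2) := by
        intro k _
        have h1 : inner ℝ (c k τ) (fc N (fun x => wv ψ x τ) k) =
            e * inner ℝ (c k τ) (Complex.I * F k τ) := by
          rw [fc_w H, Complex.inner, Complex.inner]
          have h2 : (starRingEnd ℂ (c k τ) * (Complex.I *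
            ((- (nsqV (xiN N k)) / 2 + e * mn N (fun y => Φ y τ) : ℝ) : ℂ) * c k τ)).re = 0 := by
            rw [show (starRingEnd ℂ (c k τ) * (Complex.I *
              ((- (nsqV (xiN N k)) / 2 + e * mn N (fun y => Φ y τ) : ℝ) : ℂ) * c k τ)) =
              Complex.I * (((- (nsqV (xiN N k)) / 2 + e * mn N (fun y => Φ y τ)) *
                Complex.normSq (c k τ) : ℝ) : ℂ) by
              rw [Complex.ofReal_mul, Complex.normSq_eq_conj_mul_self]; ring]
            simp
          have h3 : starRingEnd ℂ (c k τ) * (Complex.I * (e:ℂ) * F k τ) =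
              (e:ℂ) * (starRingEnd ℂ (c k τ) * (Complex.I * F k τ)) := by ring
          have h4 : ((e:ℂ) * (starRingEnd ℂ (c k τ) * (Complex.I * F k τ))).re =
              e * (starRingEnd ℂ (c k τ) * (Complex.I * F k τ)).re := Complex.re_ofReal_mul _ _
          rw [mul_comm _ (starRingEnd ℂ (c k τ)), mul_comm _ (starRingEnd ℂ (c k τ)), mul_add,
            Complex.add_re]
          change (starRingEnd ℂ (c k τ) * (Complex.I *
            ((- (nsqV (xiN N k)) / 2 + e * mn N (fun y => Φ y τ) : ℝ) : ℂ) * c k τ)).re +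
            (starRingEnd ℂ (c k τ) * (Complex.I * (e:ℂ) * F k τ)).re = _
          rw [h2, h3, h4, zero_add]
        have h2 := abs_real_inner_le_norm (c k τ) (Complex.I * F k τ)
        rw [norm_mul, Complex.norm_I, one_mul] at h2
        rw [h1, abs_mul, abs_mul, abs_mul, abs_of_nonneg (hy0 k), abs_two, abs_of_pos he]
        have h3 : 2 * |inner ℝ (c k τ) (Complex.I * F k τ)| ≤ ‖c k τ‖ ^ 2 + ‖F k τ‖ ^ 2 := by
          nlinarith [sq_nonneg (‖c k τ‖ - ‖F k τ‖)]
        have h4 := mul_le_mul_of_nonneg_left h3 (mul_nonneg he.le (hy0 k))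
        linarith
      rw [Real.norm_eq_abs]
      refine (Finset.abs_sum_le_sum_abs _ _).trans ((Finset.sum_le_sum hterm).trans ?_)
      rw [← Finset.mul_sum, Finset.sum_add_distrib]
      have s1 : ∑ k ∈ T, y k * ‖c k τ‖ ^ 2 ≤ (N:ℝ)^3 * G :=
        (sum_le_hasSum T (fun k _ => mul_nonneg (hy0 k) (by positivity)) (hpc τ)).trans
          (mul_le_mul_of_nonneg_left (hG τ hτ) hN3.le)
      have s2 : ∑ k ∈ T, y k * ‖F k τ‖ ^ 2 ≤ (N:ℝ)^3 * GF :=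
        (sum_le_hasSum T (fun k _ => mul_nonneg (hy0 k) (by positivity)) (hpF τ)).trans
          (mul_le_mul_of_nonneg_left (hb τ (hG τ hτ)).2 hN3.le)
      gcongr
  refine ⟨e * (G + GF), fun t ht s hs => ?_⟩
  have hlim := ((hpc t).sub (hpc s)).norm
  have h1 : ‖(N:ℝ)^3 * (∫ x in cubeN N, gradSq (fun y => ψ y t) x) -
      (N:ℝ)^3 * ∫ x in cubeN N, gradSq (fun y => ψ y s) x‖ ≤
      e * ((N:ℝ)^3 * G + (N:ℝ)^3 * GF) * ‖t - s‖ := by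
    refine le_of_tendsto hlim (Eventually.of_forall fun T => ?_)
    rw [Finset.sum_sub_distrib]
    exact hfin T t ht s hs
  rw [← mul_sub, norm_mul, Real.norm_of_nonneg hN3.le, Real.norm_eq_abs, Real.norm_eq_abs] at h1
  refine le_of_mul_le_mul_left (h1.trans (le_of_eq ?_)) hN3
  ring

end H1Sec

/-! ### Part 9: energy, Dini derivatives -/

section EnSec

open Filter Topology

lemma dini_mono {f : ℝ → ℝ} {a b : ℝ} (hc : ContinuousOn f (Set.Icc a b))
    (hd : ∀ s, ∃ g : ℝ → ℝ, (∀ t, g t ≤ f t) ∧ g s = f s ∧ HasDerivAt g 0 s) :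
    ∀ x ∈ Set.Icc a b, f a ≤ f x := by
  intro x hx
  have := image_le_of_liminf_slope_right_le_deriv_boundary (f := fun t => - f t) (a := a) (b := b)
    hc.neg (B := fun _ => - f a) (B' := fun _ => 0) le_rfl
    continuousOn_const (fun x _ => hasDerivWithinAt_const _ _ _) (fun x hx r hr => ?_) hx
  · linarith
  · obtain ⟨g, hg1, hg2, hg3⟩ := hd x
    have h1 := hasDerivAt_iff_tendsto_slope.mp hg3.neg
    rw [neg_zero] at h1
    have h2 : ∀ᶠ z in 𝓝[>] x, slope (-g) x z < r :=
      (h1.mono_left (nhdsWithin_mono x (fun z hz => ne_of_gt hz))).eventually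
        (gt_mem_nhds hr)
    refine Eventually.frequently ?_
    filter_upwards [h2, self_mem_nhdsWithin] with z hz hxz
    refine lt_of_le_of_lt ?_ hz
    have hpos : 0 < z - x := sub_pos.mpr hxz
    rw [slope_def_field, slope_def_field]
    refine div_le_div_of_nonneg_right ?_ hpos.le
    have := hg1 z
    simp only [Pi.neg_apply]
    linarith

lemma dini_const {f : ℝ → ℝ} {a b : ℝ} (hc : ContinuousOn f (Set.Icc a b))
    (hd : ∀ s, ∃ g : ℝ → ℝ, (∀ t, g t ≤ f t) ∧ g s = f s ∧ HasDerivAt g 0 s) :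
    ∀ x ∈ Set.Icc a b, f x = f a := by
  intro x hx
  refine le_antisymm ?_ (dini_mono hc hd x hx)
  have := dini_mono (f := fun t => f (-t)) (a := -x) (b := -a) ?_ ?_ (-a)
    ⟨by linarith [hx.1], le_rfl⟩
  · simpa using this
  · refine hc.comp continuous_neg.continuousOn fun t ht => ⟨by linarith [ht.2], ?_⟩
    linarith [ht.1, hx.2]
  · intro s
    obtain ⟨g, h1, h2, h3⟩ := hd (-s)
    refine ⟨fun t => g (-t), fun t => h1 _, h2, ?_⟩
    have h4 := HasDerivAt.comp s h3 (hasDerivAt_neg s)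
    exact h4.congr_deriv (by simp)

variable {N : ℕ} {σ : V3 → ℝ} {e M : ℝ} {ψ : V3 → ℝ → ℂ} {Φ : V3 → ℝ → ℝ}
  {q : ℝ → GammaIdx N → V3}

/-- gradient term -/
def gE (N : ℕ) (ψ : V3 → ℝ → ℂ) (t : ℝ) : ℝ := ∫ x in cubeN N, gradSq (fun y => ψ y t) x

/-- potential term -/
def UE (N : ℕ) (σ : V3 → ℝ) (e : ℝ) (ψ : V3 → ℝ → ℂ) (Φ : V3 → ℝ → ℝ)
    (q : ℝ → GammaIdx N → V3) (t s : ℝ) : ℝ := ∫ x in cubeN N, Φ x t * rh N σ e ψ q s x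

/-- kinetic term -/
def TE (N : ℕ) (q : ℝ → GammaIdx N → V3) (t : ℝ) : ℝ :=
  ∑ n : GammaIdx N, nsqV (fun i => deriv (fun u => q u n i) t)

/-- the energy -/
def En (N : ℕ) (σ : V3 → ℝ) (e M : ℝ) (ψ : V3 → ℝ → ℂ) (Φ : V3 → ℝ → ℝ)
    (q : ℝ → GammaIdx N → V3) (t : ℝ) : ℝ :=
  (1 / 2) * gE N ψ t + (1 / 2) * UE N σ e ψ Φ q t t + (M / 2) * TE N q t

lemma UE_green (H : Ctx N σ e M ψ Φ q) (t s : ℝ) : UE N σ e ψ Φ q t s =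
    ∫ x in cubeN N, dotP (gradV (fun y => Φ y t) x) (gradV (fun y => Φ y s) x) := by
  have h := greenR ((H.hsol.regx_Phi t).of_le one_le_two) (H.hsol.regx_Phi s)
    (H.hsol.per_Phi t) (H.hsol.per_Phi s)
  rw [lap_rh H] at h
  simp only [mul_neg, integral_neg, neg_inj] at h
  exact h

lemma UE_sym (H : Ctx N σ e M ψ Φ q) (t s : ℝ) :
    UE N σ e ψ Φ q t s = UE N σ e ψ Φ q s t := by
  rw [UE_green H, UE_green H]
  simp only [dotP, mul_comm]

lemma gradV_c (H : Ctx N σ e M ψ Φ q) (t : ℝ) (i : Fin 3) :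
    Continuous fun x => gradV (fun y => Φ y t) x i :=
  cont_fderiv ((H.hsol.regx_Phi t).of_le one_le_two) _

lemma UE_nonneg (H : Ctx N σ e M ψ Φ q) (t : ℝ) : 0 ≤ UE N σ e ψ Φ q t t := by
  rw [UE_green H]
  exact integral_nonneg fun x => Finset.sum_nonneg fun i _ => mul_self_nonneg _

lemma UE_lower (H : Ctx N σ e M ψ Φ q) (t s : ℝ) :
    2 * UE N σ e ψ Φ q s t - UE N σ e ψ Φ q s s ≤ UE N σ e ψ Φ q t t := by
  have h1 := gradV_c H t
  have h2 := gradV_c H s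
  rw [UE_green H, UE_green H, UE_green H, ← integral_const_mul, ← integral_sub]
  · refine integral_mono ?_ ?_ fun x => ?_
    · exact integ (by simp only [dotP]; fun_prop)
    · exact integ (by simp only [dotP]; fun_prop)
    · simp only [dotP]
      rw [Finset.mul_sum, ← Finset.sum_sub_distrib]
      refine Finset.sum_le_sum fun i _ => ?_
      nlinarith [sq_nonneg (gradV (fun y => Φ y t) x i - gradV (fun y => Φ y s) x i)]
  · exact integ (by simp only [dotP]; fun_prop)
  · exact integ (by simp only [dotP]; fun_prop)

lemma TE_nonneg (t : ℝ) : 0 ≤ TE N q t :=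
  Finset.sum_nonneg fun n _ => Finset.sum_nonneg fun i _ => sq_nonneg _

lemma gE_nonneg (t : ℝ) : 0 ≤ gE N ψ t := integral_nonneg fun x => gradSq_nonneg _ _

lemma re_int {f : V3 → ℂ} (hf : Continuous f) :
    (∫ x in cubeN N, f x).re = ∫ x in cubeN N, (f x).re :=
  (integral_re (𝕜 := ℂ) (μ := volume.restrict (cubeN N)) (integ hf)).symm

lemma gE_lower (H : Ctx N σ e M ψ Φ q) (t s : ℝ) :
    2 * (-(∫ x in cubeN N, (starRingEnd ℂ) (lapC (fun y => ψ y s) x) * ψ x t).re) - gE N ψ s ≤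
      gE N ψ t := by
  have hct : ∀ i : Fin 3, Continuous fun x => fderiv ℝ (fun y => ψ y t) x (Pi.single i 1) :=
    fun i => cont_fderiv ((H.hsol.regx_psi t).of_le one_le_two) _
  have hcs : ∀ i : Fin 3, Continuous fun x => fderiv ℝ (fun y => ψ y s) x (Pi.single i 1) :=
    fun i => cont_fderiv ((H.hsol.regx_psi s).of_le one_le_two) _
  have hcc : ∀ i : Fin 3, Continuous fun x =>
      (starRingEnd ℂ) (fderiv ℝ (fun y => ψ y s) x (Pi.single i 1)) := fun i =>
    Complex.continuous_conj.comp (hcs i)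
  have hg1 := gradSq_cont ((H.hsol.regx_psi t).of_le one_le_two)
  have hg2 := gradSq_cont ((H.hsol.regx_psi s).of_le one_le_two)
  have hsc : Continuous fun x => ∑ i, (starRingEnd ℂ) (fderiv ℝ (fun y => ψ y s) x (Pi.single i 1))
    * fderiv ℝ (fun y => ψ y t) x (Pi.single i 1) := by fun_prop
  have hre : Continuous fun x =>
      (∑ i, (starRingEnd ℂ) (fderiv ℝ (fun y => ψ y s) x (Pi.single i 1))
        * fderiv ℝ (fun y => ψ y t) x (Pi.single i 1)).re := Complex.continuous_re.comp hsc
  rw [← lapC_symm (H.hsol.regx_psi s) (H.hsol.regx_psi t) (H.hsol.per_psi s) (H.hsol.per_psi t),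
    greenC ((H.hsol.regx_psi s).of_le one_le_two) (H.hsol.regx_psi t) (H.hsol.per_psi s)
      (H.hsol.per_psi t), Complex.neg_re, neg_neg, re_int hsc, gE, gE, ← integral_const_mul,
    ← integral_sub (integ (hre.const_mul 2)) (integ hg2)]
  refine integral_mono (integ ((hre.const_mul 2).sub hg2))
    (integ hg1) fun x => ?_
  simp only [gradSq]
  rw [Complex.re_sum, Finset.mul_sum, ← Finset.sum_sub_distrib]
  refine Finset.sum_le_sum fun i _ => ?_
  set z := fderiv ℝ (fun y => ψ y s) x (Pi.single i 1)
  set w := fderiv ℝ (fun y => ψ y t) x (Pi.single i 1)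
  simp only [Complex.mul_re, Complex.conj_re, Complex.conj_im, Complex.normSq_apply]
  nlinarith [sq_nonneg (z.re - w.re), sq_nonneg (z.im - w.im)]

lemma l2sq_tendsto (H : Ctx N σ e M ψ Φ q) (s : ℝ) :
    Tendsto (fun t => ∫ x in cubeN N, ‖ψ x t - ψ x s‖ ^ 2) (𝓝 s) (𝓝 0) := by
  obtain ⟨C, hC⟩ := PL_all H s
  have h1 : Tendsto (fun t => C * (t - s) ^ 2) (𝓝 s) (𝓝 0) := by
    have : Continuous fun t : ℝ => C * (t - s) ^ 2 := by fun_prop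
    simpa using this.tendsto s
  exact tendsto_of_tendsto_of_tendsto_of_le_of_le' tendsto_const_nhds h1
    (Eventually.of_forall fun t => integral_nonneg fun x => by positivity) hC

lemma rho_L1c (H : Ctx N σ e M ψ Φ q) (s : ℝ) :
    Tendsto (fun t => ∫ x in cubeN N, |rh N σ e ψ q t x - rh N σ e ψ q s x|) (𝓝 s) (𝓝 0) := by
  have he := H.he
  have hσc := H.hreg.continuous
  obtain ⟨Cσ, hCσ0, hσ⟩ := per_bdd H.hN hσc H.hper
  obtain ⟨B, hB0, hB⟩ := per_bdd H.hN (psi_c H s) (H.hsol.per_psi s)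
  set I : ℝ → V3 → ℝ := fun t x => ∑ n : GammaIdx N, σ (x - embG n - q t n) with hI
  have hIc : ∀ t, Continuous (I t) := fun t => by simp only [hI]; fun_prop
  have hqc := H.hsol.reg_q.continuous
  have h1 : Tendsto (fun t => ∫ x in cubeN N, ‖I t x - I s x‖) (𝓝 s) (𝓝 0) := by
    refine WK hIc (hIc s) (fun x => ?_) (B := (N:ℝ)^3 * (Fintype.card (GammaIdx N) * Cσ) ^ 2)
      (Eventually.of_forall fun t => ?_)
    · have : Continuous fun t => I t x := by simp only [hI]; fun_prop
      exact this.tendsto s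
    · rw [← int_const]
      have := hIc t
      refine integral_mono (integ (by fun_prop)) (integ (by fun_prop)) fun x => ?_
      refine pow_le_pow_left₀ (norm_nonneg _) ?_ 2
      refine (norm_sum_le _ _).trans ?_
      refine (Finset.sum_le_sum fun n _ => hσ (x - embG n - q t n)).trans ?_
      simp
  have h2 : Tendsto (fun t => ∫ x in cubeN N, ‖ψ x t - ψ x s‖) (𝓝 s) (𝓝 0) :=
    WK (fun t => psi_c H t) (psi_c H s) (fun x => (psi_ct H x).tendsto s)
      (B := ∫ x in cubeN N, ‖ψ x 0‖ ^ 2) (Eventually.of_forall fun t => (charge H t).le)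
  have h3 := l2sq_tendsto H s
  have h4 := h1.add ((h3.const_mul e).add (h2.const_mul (2 * e * B)))
  simp only [mul_zero, add_zero] at h4
  refine tendsto_of_tendsto_of_tendsto_of_le_of_le tendsto_const_nhds h4
    (fun t => integral_nonneg fun x => abs_nonneg _) fun t => ?_
  have c1 := hIc t
  have c2 := hIc s
  have c3 := psi_c H t
  have c4 := psi_c H s
  have c5 := rh_c H t
  have c6 := rh_c H s
  simp only
  rw [← integral_const_mul, ← integral_const_mul,
    ← integral_add (integ (by fun_prop)) (integ (by fun_prop)),
    ← integral_add (integ (by fun_prop)) (integ (by fun_prop))]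
  refine integral_mono (integ (by fun_prop)) (integ (by fun_prop)) fun x => ?_
  simp only
  rw [rh_eq, rh_eq]
  have e1 : (∑ n : GammaIdx N, σ (x - embG n - q t n)) - e * ‖ψ x t‖ ^ 2 -
      ((∑ n : GammaIdx N, σ (x - embG n - q s n)) - e * ‖ψ x s‖ ^ 2) =
      (I t x - I s x) - e * (‖ψ x t‖ ^ 2 - ‖ψ x s‖ ^ 2) := by simp only [hI]; ring
  rw [e1]
  refine (abs_sub _ _).trans ?_
  rw [abs_mul, abs_of_pos he, Real.norm_eq_abs]
  have e2 : |‖ψ x t‖ ^ 2 - ‖ψ x s‖ ^ 2| ≤ ‖ψ x t - ψ x s‖ ^ 2 + 2 * B * ‖ψ x t - ψ x s‖ := by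
    have f1 := abs_norm_sub_norm_le (ψ x t) (ψ x s)
    have f2 := hB x
    have f3 := norm_nonneg (ψ x s)
    have f4 := norm_nonneg (ψ x t)
    rw [sq_sub_sq, abs_mul, abs_of_nonneg (by positivity)]
    have f5 : ‖ψ x t‖ + ‖ψ x s‖ ≤ ‖ψ x t - ψ x s‖ + 2 * B := by
      linarith [le_abs_self (‖ψ x t‖ - ‖ψ x s‖)]
    calc _ ≤ (‖ψ x t - ψ x s‖ + 2 * B) * ‖ψ x t - ψ x s‖ := by gcongr
      _ = _ := by ring
  have := mul_le_mul_of_nonneg_left e2 he.le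
  linarith

lemma UE_cont (H : Ctx N σ e M ψ Φ q) {a b G : ℝ} (hG : ∀ t ∈ Set.Icc a b, gE N ψ t ≤ G) :
    ContinuousOn (fun t => UE N σ e ψ Φ q t t) (Set.Icc a b) := by
  obtain ⟨S, GF, hS, hGF, hb⟩ := H1bounds H G
  intro s hs
  rw [ContinuousWithinAt, tendsto_iff_norm_sub_tendsto_zero]
  have h1 := ((rho_L1c H s).const_mul (2 * S)).mono_left (nhdsWithin_le_nhds (s := Set.Icc a b))
  rw [mul_zero] at h1
  refine tendsto_of_tendsto_of_tendsto_of_le_of_le' tendsto_const_nhds h1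
    (Eventually.of_forall fun t => norm_nonneg _) ?_
  filter_upwards [self_mem_nhdsWithin] with t ht
  have c1 := Phi_c H t
  have c2 := Phi_c H s
  have c3 := rh_c H t
  have c4 := rh_c H s
  have c5 := (P0_cd H t).continuous
  have c6 := (P0_cd H s).continuous
  have e0 : UE N σ e ψ Φ q t t - UE N σ e ψ Φ q s s =
      ∫ x in cubeN N, (Φ x t + Φ x s) * (rh N σ e ψ q t x - rh N σ e ψ q s x) := by
    have h2 := UE_sym H t s
    have h3 : ∫ x in cubeN N, (Φ x t + Φ x s) * (rh N σ e ψ q t x - rh N σ e ψ q s x) =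
        ((UE N σ e ψ Φ q t t - UE N σ e ψ Φ q t s) + UE N σ e ψ Φ q s t)
          - UE N σ e ψ Φ q s s := by
      simp only [UE]
      rw [← integral_sub (integ (by fun_prop)) (integ (by fun_prop)),
        ← integral_add (integ (by fun_prop)) (integ (by fun_prop)),
        ← integral_sub (integ (by fun_prop)) (integ (by fun_prop))]
      congr 1
      funext x
      ring
    rw [h3]
    linarith
  have e1 : ∫ x in cubeN N, (Φ x t + Φ x s) * (rh N σ e ψ q t x - rh N σ e ψ q s x) =
      ∫ x in cubeN N, (P0 N Φ t x + P0 N Φ s x) * (rh N σ e ψ q t x - rh N σ e ψ q s x) := by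
    set m := mn N (fun y => Φ y t) + mn N (fun y => Φ y s) with hm
    have h5 : ∫ x in cubeN N, m * (rh N σ e ψ q t x - rh N σ e ψ q s x) = 0 := by
      rw [integral_const_mul, integral_sub (integ c3) (integ c4), rh_int H, rh_int H]
      simp
    rw [← sub_eq_zero, ← integral_sub (integ (by fun_prop)) (integ (by fun_prop)), ← h5]
    congr 1
    funext x
    simp only [P0, hm]
    ring
  rw [e0, e1, ← integral_const_mul]
  refine (norm_integral_le_integral_norm _).trans ?_
  refine integral_mono (integ (by fun_prop)) (integ (by fun_prop)) fun x => ?_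
  simp only [norm_mul, Real.norm_eq_abs]
  have f1 := (hb t (hG t ht)).1 x
  have f2 := (hb s (hG s hs)).1 x
  have f3 := abs_add_le (P0 N Φ t x) (P0 N Φ s x)
  gcongr
  linarith

lemma q_comp (H : Ctx N σ e M ψ Φ q) (n : GammaIdx N) (i : Fin 3) :
    ContDiff ℝ 2 (fun u => q u n i) :=
  contDiff_pi.mp (contDiff_pi.mp H.hsol.reg_q n) i

lemma q_vec (H : Ctx N σ e M ψ Φ q) (n : GammaIdx N) : ContDiff ℝ 2 (fun u => q u n) :=
  contDiff_pi.mp H.hsol.reg_q n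

lemma q_hd (H : Ctx N σ e M ψ Φ q) (n : GammaIdx N) (i : Fin 3) (t : ℝ) :
    HasDerivAt (fun s => deriv (fun u => q u n i) s) (deriv (fun s => deriv (fun u => q u n i) s) t)
      t := by
  have h : ContDiff ℝ 1 (deriv (fun u => q u n i)) :=
    ((contDiff_succ_iff_deriv (n := 1)).mp (q_comp H n i)).2.2
  exact (h.differentiable one_ne_zero t).hasDerivAt

lemma TE_hd (H : Ctx N σ e M ψ Φ q) (t : ℝ) :
    HasDerivAt (fun s => (M / 2) * TE N q s)
      (- ∑ n : GammaIdx N, ∑ i, deriv (fun u => q u n i) t *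
        ∫ x in cubeN N, fderiv ℝ (fun y => Φ y t) x (Pi.single i 1) * σ (x - embG n - q t n)) t := by
  have h1 : HasDerivAt (fun s => (M / 2) * TE N q s) ((M / 2) * ∑ n : GammaIdx N, ∑ i : Fin 3,
      (2 * deriv (fun u => q u n i) t ^ 1 * deriv (fun s => deriv (fun u => q u n i) s) t)) t := by
    refine HasDerivAt.const_mul _ ?_
    change HasDerivAt (fun s => ∑ n : GammaIdx N, ∑ i, (deriv (fun u => q u n i) s) ^ 2) _ t
    refine HasDerivAt.fun_sum fun n _ => HasDerivAt.fun_sum fun i _ => ?_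
    exact ((q_hd H n i t).fun_pow 2).congr_deriv (by norm_num)
  refine h1.congr_deriv ?_
  rw [Finset.mul_sum, ← Finset.sum_neg_distrib]
  refine Finset.sum_congr rfl fun n _ => ?_
  rw [Finset.mul_sum, ← Finset.sum_neg_distrib]
  refine Finset.sum_congr rfl fun i _ => ?_
  have := H.hsol.newton n t i
  rw [← mul_neg, ← this]
  ring

lemma ion_hd (H : Ctx N σ e M ψ Φ q) (n : GammaIdx N) (s : ℝ) :
    HasDerivAt (fun t => ∫ x in cubeN N, Φ x s * σ (x - embG n - q t n))
      (∑ i, deriv (fun u => q u n i) s *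
        ∫ x in cubeN N, fderiv ℝ (fun y => Φ y s) x (Pi.single i 1) * σ (x - embG n - q s n)) s := by
  have hs1 : ContDiff ℝ 1 σ := H.hreg.of_le one_le_two
  have hr : ContDiff ℝ 1 (fun t => embG n + q t n) :=
    contDiff_const.add ((q_vec H n).of_le one_le_two)
  have h := path_deriv H.hN H.hper hs1 (Phi_c H s) hr s
  have e1 : (fun t => ∫ x in cubeN N, Φ x s * σ (x - (embG n + q t n))) =
      fun t => ∫ x in cubeN N, Φ x s * σ (x - embG n - q t n) := by
    simp only [sub_sub]
  rw [e1] at h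
  refine h.congr_deriv ?_
  have hdr : deriv (fun t => embG n + q t n) s = fun i => deriv (fun u => q u n i) s := by
    rw [deriv_const_add]
    exact deriv_pi fun i => (q_comp H n i).differentiable two_ne_zero s
  rw [hdr]
  set v : V3 := fun i => deriv (fun u => q u n i) s with hv
  set τ : V3 → ℝ := fun x => σ (x - (embG n + q s n)) with hτ
  have hτc : ContDiff ℝ 1 τ := hs1.comp (by fun_prop)
  have hτp : IsPerN N τ := shift_per H.hper _
  have e2 : ∀ x, Φ x s * fderiv ℝ σ (x - (embG n + q s n)) v =
      ∑ i, v i * (Φ x s * fderiv ℝ τ x (Pi.single i 1)) := by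
    intro x
    rw [fderiv_sum, Finset.mul_sum]
    refine Finset.sum_congr rfl fun i _ => ?_
    rw [hτ, fderiv_comp_sub]
    ring
  simp_rw [e2]
  have hΦc := Phi_c H s
  have hdc : ∀ i : Fin 3, Continuous fun x => fderiv ℝ τ x (Pi.single i 1) := fun i =>
    cont_fderiv hτc _
  rw [integral_finsetSum _ fun i _ => integ (by fun_prop), ← Finset.sum_neg_distrib]
  refine Finset.sum_congr rfl fun i _ => ?_
  rw [integral_const_mul, ibp ((H.hsol.regx_Phi s).of_le one_le_two) hτc (H.hsol.per_Phi s) hτp i]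
  simp only [hτ, sub_sub, hv]
  ring

lemma dens_hd (H : Ctx N σ e M ψ Φ q) (s : ℝ) :
    HasDerivAt (fun t => ∫ x in cubeN N, Φ x s * ‖ψ x t‖ ^ 2)
      (2 * (∫ x in cubeN N, ((Φ x s : ℂ) * (starRingEnd ℂ) (ψ x s)) * wv ψ x s).re) s := by
  obtain ⟨B, hB0, hB⟩ := per_bdd H.hN (Phi_c H s) (H.hsol.per_Phi s)
  have cΦ := Phi_c H s
  have cs := psi_c H s
  have ccs : Continuous fun x => (starRingEnd ℂ) (ψ x s) := Complex.continuous_conj.comp cs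
  have hg : Continuous fun x => (Φ x s : ℂ) * (starRingEnd ℂ) (ψ x s) := by fun_prop
  have h1 := weak_deriv H (PL_all H s) hg
  have h2 := (Complex.reCLM.hasFDerivAt.comp_hasDerivAt s h1)
  have h3 := h2.const_mul 2
  have h4 : HasDerivAt (fun t => ∫ x in cubeN N, Φ x s * ‖ψ x t - ψ x s‖ ^ 2) 0 s := by
    obtain ⟨C, hC⟩ := PL_all H s
    have hO : (fun t => ∫ x in cubeN N, Φ x s * ‖ψ x t - ψ x s‖ ^ 2)
        =O[𝓝 s] fun t => ‖t - s‖ ^ 2 := by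
      refine Asymptotics.IsBigO.of_bound (B * C) ?_
      filter_upwards [hC] with t ht
      have ct := psi_c H t
      refine (norm_integral_le_integral_norm _).trans ?_
      calc _ ≤ ∫ x in cubeN N, B * ‖ψ x t - ψ x s‖ ^ 2 := by
            refine integral_mono (integ (by fun_prop)) (integ (by fun_prop)) fun x => ?_
            simp only [norm_mul, norm_pow, norm_norm]
            have := hB x
            gcongr
        _ ≤ B * (C * (t - s) ^ 2) := by
            rw [integral_const_mul]; gcongr
        _ = _ := by
            simp only [norm_pow, norm_norm, Real.norm_eq_abs, sq_abs]; ring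
    have := Asymptotics.IsBigO.hasFDerivAt (𝕜 := ℝ) hO (by norm_num)
    have h5 := this.hasDerivAt
    exact h5.congr_deriv (by simp)
  have h6 := (h3.add h4).sub_const (∫ x in cubeN N, Φ x s * ‖ψ x s‖ ^ 2)
  have h7 : (fun t => ∫ x in cubeN N, Φ x s * ‖ψ x t‖ ^ 2) = fun t =>
      2 * (∫ x in cubeN N, ((Φ x s : ℂ) * (starRingEnd ℂ) (ψ x s)) * ψ x t).re +
      (∫ x in cubeN N, Φ x s * ‖ψ x t - ψ x s‖ ^ 2) - ∫ x in cubeN N, Φ x s * ‖ψ x s‖ ^ 2 := by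
    funext t
    have ct := psi_c H t
    have hgm : Continuous fun x => ((Φ x s : ℂ) * (starRingEnd ℂ) (ψ x s)) * ψ x t := hg.mul ct
    have cre : Continuous fun x => (((Φ x s : ℂ) * (starRingEnd ℂ) (ψ x s)) * ψ x t).re :=
      Complex.continuous_re.comp hgm
    have cadd : Continuous fun x => 2 * (((Φ x s : ℂ) * (starRingEnd ℂ) (ψ x s)) * ψ x t).re +
        Φ x s * ‖ψ x t - ψ x s‖ ^ 2 := by fun_prop
    have cn : Continuous fun x => Φ x s * ‖ψ x s‖ ^ 2 := by fun_prop
    rw [re_int hgm, ← integral_const_mul, ← integral_add (integ (cre.const_mul 2))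
      (integ (by fun_prop)), ← integral_sub (integ cadd) (integ cn)]
    congr 1
    funext x
    rw [← Complex.normSq_eq_norm_sq, ← Complex.normSq_eq_norm_sq, ← Complex.normSq_eq_norm_sq]
    simp only [Complex.normSq_apply, Complex.mul_re, Complex.mul_im, Complex.conj_re,
      Complex.conj_im, Complex.ofReal_re, Complex.ofReal_im, Complex.sub_re, Complex.sub_im]
    ring
  rw [h7]
  exact h6.congr_deriv (by rw [Complex.reCLM_apply]; ring)

lemma dini_support (H : Ctx N σ e M ψ Φ q) (s : ℝ) : ∃ g : ℝ → ℝ,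
    (∀ t, g t ≤ En N σ e M ψ Φ q t) ∧ g s = En N σ e M ψ Φ q s ∧ HasDerivAt g 0 s := by
  have hΦ := Phi_c H s
  have hσc := H.hreg.continuous
  have cs := psi_c H s
  have ccs : Continuous fun x => (starRingEnd ℂ) (ψ x s) := Complex.continuous_conj.comp cs
  have cL := lapC_cont (H.hsol.regx_psi s)
  have ccL : Continuous fun x => (starRingEnd ℂ) (lapC (fun y => ψ y s) x) :=
    Complex.continuous_conj.comp cL
  have cw := w_c H s
  refine ⟨fun t => (1 / 2) *
      (2 * (-(∫ x in cubeN N, (starRingEnd ℂ) (lapC (fun y => ψ y s) x) * ψ x t).re) - gE N ψ s)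
    + (1 / 2) * (2 * UE N σ e ψ Φ q s t - UE N σ e ψ Φ q s s) + (M / 2) * TE N q t, ?_, ?_, ?_⟩
  · intro t
    have h1 := gE_lower H t s
    have h2 := UE_lower H t s
    rw [En]
    linarith
  · simp only
    rw [greenC_self (H.hsol.regx_psi s) (H.hsol.per_psi s), Complex.ofReal_re, En, gE]
    ring
  · have h1 := weak_deriv H (PL_all H s) ccL
    have h2 := (Complex.reCLM.hasFDerivAt.comp_hasDerivAt s h1)
    have h3 : (fun t => UE N σ e ψ Φ q s t) = fun t =>
        (∑ n : GammaIdx N, ∫ x in cubeN N, Φ x s * σ (x - embG n - q t n))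
          - e * ∫ x in cubeN N, Φ x s * ‖ψ x t‖ ^ 2 := by
      funext t
      have ct := psi_c H t
      rw [← integral_finsetSum _ fun i _ => integ (by fun_prop), ← integral_const_mul,
        ← integral_sub (integ (by fun_prop)) (integ (by fun_prop)), UE]
      congr 1
      funext x
      rw [rh_eq, ← Finset.mul_sum]
      ring
    have h4' := (HasDerivAt.fun_sum fun n (_ : n ∈ Finset.univ) => ion_hd H n s).sub
      ((dens_hd H s).const_mul e)
    have h4 := h4'.congr_of_eventuallyEq (f₁ := fun t => UE N σ e ψ Φ q s t)
      (Eventually.of_forall fun t => congrFun h3 t)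
    have h5 := ((((h2.neg.const_mul 2).sub_const (gE N ψ s)).const_mul (1 / 2)).add
      (((h4.const_mul 2).sub_const (UE N σ e ψ Φ q s s)).const_mul (1 / 2))).add (TE_hd H s)
    refine h5.congr_deriv ?_
    rw [Complex.reCLM_apply]
    have h6 : (∫ x in cubeN N, (starRingEnd ℂ) (lapC (fun y => ψ y s) x) * wv ψ x s).re +
        2 * e * (∫ x in cubeN N, ((Φ x s : ℂ) * (starRingEnd ℂ) (ψ x s)) * wv ψ x s).re = 0 := by
      have h7 : 2 * e * (∫ x in cubeN N, ((Φ x s : ℂ) * (starRingEnd ℂ) (ψ x s)) * wv ψ x s).re =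
          (((2 * e : ℝ) : ℂ) *
            ∫ x in cubeN N, ((Φ x s : ℂ) * (starRingEnd ℂ) (ψ x s)) * wv ψ x s).re := by
        rw [Complex.re_ofReal_mul]
      rw [h7, ← Complex.add_re, ← integral_const_mul,
        ← integral_add (integ (by fun_prop)) (integ (by fun_prop))]
      have h8 : ∀ x, (starRingEnd ℂ) (lapC (fun y => ψ y s) x) * wv ψ x s +
          ((2 * e : ℝ) : ℂ) * (((Φ x s : ℂ) * (starRingEnd ℂ) (ψ x s)) * wv ψ x s) =
          Complex.I * ((2 * Complex.normSq (wv ψ x s) : ℝ) : ℂ) := by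
        intro x
        have h9 : lapC (fun y => ψ y s) x = -2 * Complex.I * wv ψ x s
            - 2 * ((e:ℂ) * Φ x s * ψ x s) := by
          rw [w_eq H]
          linear_combination (lapC (fun y => ψ y s) x) * Complex.I_mul_I
            + 2 * ((e:ℂ) * Φ x s * ψ x s) * Complex.I_mul_I
        rw [h9]
        push_cast
        rw [Complex.normSq_eq_conj_mul_self]
        simp only [map_sub, map_mul, map_neg, Complex.conj_I, Complex.conj_ofReal, map_ofNat]
        ring
      simp_rw [h8]
      rw [integral_const_mul, integral_complex_ofReal]
      simp
    linarith

lemma En_const (H : Ctx N σ e M ψ Φ q) {a b B : ℝ}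
    (hB : ∀ t ∈ Set.Icc a b, En N σ e M ψ Φ q t ≤ B) :
    ∀ t ∈ Set.Icc a b, En N σ e M ψ Φ q t = En N σ e M ψ Φ q a := by
  have hM := H.hM
  have hG : ∀ t ∈ Set.Icc a b, gE N ψ t ≤ 2 * B := by
    intro t ht
    have h1 := hB t ht
    have h2 := UE_nonneg H t
    have h3 := TE_nonneg (q := q) t
    rw [En] at h1
    have : 0 ≤ M / 2 * TE N q t := by positivity
    linarith
  refine dini_const ?_ (dini_support H)
  have c1 : ContinuousOn (gE N ψ) (Set.Icc a b) := by
    obtain ⟨L, hL⟩ := grad_lip H hG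
    have : LipschitzOnWith (Real.toNNReal L) (gE N ψ) (Set.Icc a b) := by
      refine LipschitzOnWith.of_dist_le_mul fun t ht s hs => ?_
      rw [Real.dist_eq, Real.dist_eq]
      refine (hL t ht s hs).trans ?_
      gcongr
      exact Real.le_coe_toNNReal L
    exact this.continuousOn
  have c2 := UE_cont H hG
  have c3 : Continuous fun t => (M / 2) * TE N q t :=
    continuous_iff_continuousAt.mpr fun t => (TE_hd H t).continuousAt
  exact ((c1.const_mul (1 / 2)).add (c2.const_mul (1 / 2))).add c3.continuousOn

end EnSec

/-! ### Part 10: globalization -/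

section GlobSec

open Filter Topology

lemma loc_bdd {f : ℝ → ℝ} {a b : ℝ}
    (h : ∀ t ∈ Set.Icc a b, ∃ B, ∀ᶠ s in 𝓝 t, f s ≤ B) :
    ∃ B, ∀ t ∈ Set.Icc a b, f t ≤ B := by
  refine (isCompact_Icc (a := a) (b := b)).induction_on
    (p := fun S => ∃ B, ∀ t ∈ S, f t ≤ B) ⟨0, by simp⟩ ?_ ?_ ?_
  · rintro s t hst ⟨B, hB⟩
    exact ⟨B, fun x hx => hB x (hst hx)⟩
  · rintro s t ⟨B, hB⟩ ⟨B', hB'⟩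
    refine ⟨max B B', ?_⟩
    rintro x (hx | hx)
    · exact (hB x hx).trans (le_max_left _ _)
    · exact (hB' x hx).trans (le_max_right _ _)
  · intro x hx
    obtain ⟨B, hB⟩ := h x hx
    exact ⟨_, mem_nhdsWithin_of_mem_nhds hB, B, fun t ht => ht⟩

lemma glob {f : ℝ → ℝ}
    (hc : ∀ a b B, (∀ t ∈ Set.Icc a b, f t ≤ B) → ∀ t ∈ Set.Icc a b, f t = f a)
    (C : ℕ → Set ℝ) (hC : ∀ n, IsClosed (C n)) (hcov : ∀ t, ∃ n, t ∈ C n)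
    (hbd : ∀ n a b, ∃ B, ∀ t ∈ C n, t ∈ Set.Icc a b → f t ≤ B) (t s : ℝ) : f t = f s := by
  have key : ∀ t, ∃ B, ∀ᶠ s in 𝓝 t, f s ≤ B := by
    by_contra hcon
    set K : Set ℝ := {t | ¬ ∃ B, ∀ᶠ s in 𝓝 t, f s ≤ B} with hKdef
    have hne : K.Nonempty := by
      push Not at hcon
      obtain ⟨t, ht⟩ := hcon
      refine ⟨t, ?_⟩
      rintro ⟨B, hB⟩
      obtain ⟨s, hs⟩ := ((ht B).and_eventually hB).exists
      exact absurd hs.2 (by simpa using hs.1)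
    have hK : IsClosed K := by
      rw [← isOpen_compl_iff, isOpen_iff_mem_nhds]
      intro x hx
      simp only [hKdef, Set.mem_compl_iff, Set.mem_setOf_eq, not_not] at hx
      obtain ⟨B, hB⟩ := hx
      filter_upwards [eventually_eventually_nhds.mpr hB] with y hy
      simp only [hKdef, Set.mem_compl_iff, Set.mem_setOf_eq, not_not]
      exact ⟨B, hy⟩
    have hcV : ∀ a b, (∀ u ∈ Set.Icc a b, u ∉ K) → ∀ u ∈ Set.Icc a b, f u = f a := by
      intro a b h
      obtain ⟨B, hB⟩ := loc_bdd (f := f) (a := a) (b := b) fun u hu => by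
        have := h u hu
        simpa only [hKdef, Set.mem_setOf_eq, not_not] using this
      exact hc a b B hB
    obtain ⟨n, κ, hκ, δ, hδ, hp⟩ := baire_portion hK hne C hC hcov
    obtain ⟨B, hB⟩ := hbd n (κ - δ) (κ + δ)
    have hBK : ∀ t ∈ K, |t - κ| < δ → f t ≤ B := by
      intro t ht htd
      refine hB t (hp t ht htd) ?_
      rw [abs_lt] at htd
      exact ⟨by linarith [htd.1], by linarith [htd.2]⟩
    refine hκ ⟨B, ?_⟩
    filter_upwards [Metric.ball_mem_nhds κ hδ] with t ht
    rw [Metric.mem_ball, Real.dist_eq] at ht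
    by_cases htK : t ∈ K
    · exact hBK t htK ht
    have ht' := abs_lt.mp ht
    rcases le_total κ t with h | h
    · obtain ⟨a, haK, h1, h2, h3⟩ := last_pt hK hκ h
      have hab : f a ≤ B := hBK a haK (by rw [abs_lt]; constructor <;> linarith [ht'.1, ht'.2])
      have h4 : ∀ u ∈ Set.Icc a t, f u ≤ max (f a) (f t) := by
        intro u hu
        rcases eq_or_lt_of_le hu.1 with h5 | h5
        · rw [← h5]; exact le_max_left _ _
        · have := hcV u t (fun v hv hvK => by linarith [h3 v hvK hv.2, hv.1]) t ⟨hu.2, le_rfl⟩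
          rw [← this]; exact le_max_right _ _
      have := hc a t _ h4 t ⟨h2, le_rfl⟩
      linarith
    · obtain ⟨a, haK, h1, h2, h3⟩ := first_pt hK hκ h
      have hab : f a ≤ B := hBK a haK (by rw [abs_lt]; constructor <;> linarith [ht'.1, ht'.2])
      have h4 : ∀ u ∈ Set.Icc t a, f u ≤ max (f a) (f t) := by
        intro u hu
        rcases eq_or_lt_of_le hu.2 with h5 | h5
        · rw [h5]; exact le_max_left _ _
        · have := hcV t u (fun v hv hvK => by linarith [h3 v hvK hv.1, hv.2]) u ⟨hu.1, le_rfl⟩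
          rw [this]; exact le_max_right _ _
      have := hc t a _ h4 a ⟨h2, le_rfl⟩
      linarith
  have hmain : ∀ a b, a ≤ b → f b = f a := by
    intro a b hab
    obtain ⟨B, hB⟩ := loc_bdd (f := f) (a := a) (b := b) fun u _ => key u
    exact hc a b B hB b ⟨hab, le_rfl⟩
  rcases le_total t s with h | h
  · exact (hmain t s h).symm
  · exact hmain s t h

variable {N : ℕ} {σ : V3 → ℝ} {e M : ℝ} {ψ : V3 → ℝ → ℂ} {Φ : V3 → ℝ → ℝ}
  {q : ℝ → GammaIdx N → V3}

/-- closed sets of uniformly controlled times -/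
def Cset (ψ : V3 → ℝ → ℂ) (Φ : V3 → ℝ → ℝ) (n : ℕ) : Set ℝ :=
  {t | (∀ x y, ‖ψ x t - ψ y t‖ ≤ n * ‖x - y‖) ∧ ∀ x, ‖Φ x t‖ ≤ n}

lemma Cset_closed (H : Ctx N σ e M ψ Φ q) (n : ℕ) : IsClosed (Cset ψ Φ n) := by
  have h1 := psi_ct H
  have h2 := Phi_ct H
  have : Cset ψ Φ n = (⋂ x, ⋂ y, {t | ‖ψ x t - ψ y t‖ ≤ n * ‖x - y‖}) ∩
      ⋂ x, {t | ‖Φ x t‖ ≤ n} := by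
    ext t
    simp [Cset]
  rw [this]
  refine IsClosed.inter (isClosed_iInter fun x => isClosed_iInter fun y => ?_)
    (isClosed_iInter fun x => ?_)
  · exact isClosed_le ((h1 x).sub (h1 y)).norm continuous_const
  · exact isClosed_le (h2 x).norm continuous_const

lemma Cset_cov (H : Ctx N σ e M ψ Φ q) (t : ℝ) : ∃ n, t ∈ Cset ψ Φ n := by
  have hc : ContDiff ℝ 1 (fun x => ψ x t) := (H.hsol.regx_psi t).of_le one_le_two
  have hfp : IsPerN N (fderiv ℝ (fun x => ψ x t)) := by
    intro x k
    have h1 : (fun y => (fun x => ψ x t) (y + fun i => (N:ℝ) * (k i : ℝ))) = fun x => ψ x t := by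
      funext y
      exact H.hsol.per_psi t y k
    rw [← fderiv_comp_add_right, h1]
  obtain ⟨B, hB0, hB⟩ := per_bdd H.hN (hc.continuous_fderiv one_ne_zero) hfp
  obtain ⟨D, hD0, hD⟩ := per_bdd H.hN (Phi_c H t) (H.hsol.per_Phi t)
  obtain ⟨n, hn⟩ := exists_nat_ge (max B D)
  refine ⟨n, fun x y => ?_, fun x => (hD x).trans ((le_max_right _ _).trans hn)⟩
  have := convex_univ.norm_image_sub_le_of_norm_fderiv_le (𝕜 := ℝ) (f := fun x => ψ x t) (C := B)
    (fun z _ => hc.differentiable one_ne_zero z) (fun z _ => hB z) (Set.mem_univ y)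
    (Set.mem_univ x)
  refine this.trans ?_
  gcongr
  exact (le_max_left _ _).trans hn

lemma Cset_bd (H : Ctx N σ e M ψ Φ q) (n : ℕ) (a b : ℝ) :
    ∃ B, ∀ t ∈ Cset ψ Φ n, t ∈ Set.Icc a b → En N σ e M ψ Φ q t ≤ B := by
  obtain ⟨R, hR0, hR⟩ := rho_L1 H
  have c3 : Continuous fun t => (M / 2) * TE N q t :=
    continuous_iff_continuousAt.mpr fun t => (TE_hd H t).continuousAt
  obtain ⟨T, hT⟩ := (isCompact_Icc (a := a) (b := b)).exists_bound_of_continuousOn c3.continuousOn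
  refine ⟨(1 / 2) * ((N:ℝ) ^ 3 * (3 * (n:ℝ) ^ 2)) + (1 / 2) * (n * R) + T, ?_⟩
  rintro t ⟨h1, h2⟩ ht
  have hg : gE N ψ t ≤ (N:ℝ) ^ 3 * (3 * (n:ℝ) ^ 2) := by
    rw [gE, ← int_const]
    refine integral_mono (integ (gradSq_cont ((H.hsol.regx_psi t).of_le one_le_two)))
      (integ continuous_const) fun x => ?_
    have hl : LipschitzWith (n : NNReal) (fun y => ψ y t) :=
      LipschitzWith.of_dist_le_mul fun x y => by
        rw [dist_eq_norm, dist_eq_norm]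
        simpa using h1 x y
    have hf : ‖fderiv ℝ (fun y => ψ y t) x‖ ≤ n := by
      simpa using norm_fderiv_le_of_lipschitz ℝ (x₀ := x) hl
    have : ∀ i : Fin 3, Complex.normSq (fderiv ℝ (fun y => ψ y t) x (Pi.single i 1)) ≤
        (n:ℝ) ^ 2 := by
      intro i
      rw [Complex.normSq_eq_norm_sq]
      refine pow_le_pow_left₀ (norm_nonneg _) ?_ 2
      refine (ContinuousLinearMap.le_opNorm _ _).trans ?_
      rw [Pi.norm_single]
      simpa using hf
    refine (Finset.sum_le_sum fun i _ => this i).trans ?_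
    simp
  have hU : UE N σ e ψ Φ q t t ≤ n * R := by
    have c1 := Phi_c H t
    have c2 := rh_c H t
    refine le_trans ?_ (mul_le_mul_of_nonneg_left (hR t) (Nat.cast_nonneg n))
    rw [UE, ← integral_const_mul]
    refine integral_mono (integ (by fun_prop)) (integ (by fun_prop)) fun x => ?_
    refine (le_abs_self _).trans ?_
    rw [abs_mul]
    have := h2 x
    rw [Real.norm_eq_abs] at this
    gcongr
  have hTt := (le_abs_self _).trans (hT t ht)
  rw [En]
  linarith

lemma En_global (H : Ctx N σ e M ψ Φ q) (t s : ℝ) :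
    En N σ e M ψ Φ q t = En N σ e M ψ Φ q s :=
  glob (fun _ _ _ h => En_const H h) (Cset ψ Φ) (Cset_closed H) (Cset_cov H) (Cset_bd H) t s

end GlobSec

/-- energy conservation for classical solutions of the
Schrödinger–Poisson–Newton system. -/
theorem stmt17 (N : ℕ) (hN : 0 < N) (σ : V3 → ℝ) (e Z M : ℝ)
    (he : 0 < e) (hZ : 0 < Z) (hM : 0 < M)
    (hper : IsPerN N σ) (hreg : ContDiff ℝ 2 σ)
    (hint : (∫ x in cubeN N, σ x) = e * Z)
    (ψ : V3 → ℝ → ℂ) (Φ : V3 → ℝ → ℝ) (q : ℝ → GammaIdx N → V3)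
    (hsol : IsSPN N σ e M ψ Φ q)
    (hnorm : (∫ x in cubeN N, Complex.normSq (ψ x 0)) = Z * (N : ℝ) ^ 3) :
    ∀ t s : ℝ,
      ((1 / 2) * (∫ x in cubeN N, gradSq (fun y => ψ y t) x)
          + (1 / 2) * (∫ x in cubeN N, Φ x t * rhoT N σ e (fun y => ψ y t) (q t) x)
          + (M / 2) * ∑ n : GammaIdx N, nsqV (fun i => deriv (fun u => q u n i) t)) =
        ((1 / 2) * (∫ x in cubeN N, gradSq (fun y => ψ y s) x)
          + (1 / 2) * (∫ x in cubeN N, Φ x s * rhoT N σ e (fun y => ψ y s) (q s) x)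
          + (M / 2) * ∑ n : GammaIdx N, nsqV (fun i => deriv (fun u => q u n i) s)) := by
  have H : Ctx N σ e M ψ Φ q := ⟨hN, he, hM, hper, hreg, hsol⟩
  intro t s
  exact En_global H t s

end SPN
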